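/- Let g be the finite-dimensional simple Lie algebra of type F₄ over ℂ. Every nilpotent element e of g with dim g_e = 16 satisfies dim [g_e,g_e] = 15, e ∉ [g_e,g_e], and g_e = [g_e,g_e] + ℂ·e. (The two nilpotent orbits with centralizer dimension 16 are B₂ and the rigid orbit Ã₂+A₁; neither is reachable, and for Ã₂+A₁ the pair (dim g_e, dim[g_e,g_e]) = (16,15) is the one recorded in the paper.) -/

import Mathlib

namespace F4

/-- Formal integer linear combinations of symbols `0, 1, 2, …`. -/
abbrev Comb := List (ℕ × ℤ)

/-- Evaluation of a formal combination at a sequence. -/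
def ev {M : Type*} [AddCommGroup M] (x : ℕ → M) (l : Comb) : M := (l.map fun p => p.2 • x p.1).sum

section ev

variable {M : Type*} [AddCommGroup M] (x : ℕ → M)

@[simp] theorem ev_nil : ev x [] = 0 := rfl

@[simp] theorem ev_cons (p : ℕ × ℤ) (l : Comb) : ev x (p :: l) = p.2 • x p.1 + ev x l := by
  simp [ev]

theorem ev_append (l m : Comb) : ev x (l ++ m) = ev x l + ev x m := by
  simp [ev]

/-- Multiplication of a formal combination by an integer. -/
def Comb.smul (n : ℤ) (l : Comb) : Comb := l.map fun p => (p.1, n * p.2)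

theorem ev_smul (n : ℤ) (l : Comb) : ev x (Comb.smul n l) = n • ev x l := by
  induction l with
  | nil => simp [Comb.smul]
  | cons p l ih =>
    have : Comb.smul n (p :: l) = (p.1, n * p.2) :: Comb.smul n l := rfl
    rw [this, ev_cons, ih, ev_cons, smul_add, mul_smul]

/-- Insertion of a term into a sorted formal combination. -/
def Comb.ins (p : ℕ × ℤ) : Comb → Comb
  | [] => [p]
  | q :: l => cond (p.1.beq q.1) ((q.1, p.2 + q.2) :: l)
      (cond (p.1.blt q.1) (p :: q :: l) (q :: Comb.ins p l))

theorem ev_ins (p : ℕ × ℤ) (l : Comb) : ev x (Comb.ins p l) = p.2 • x p.1 + ev x l := by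
  induction l with
  | nil => simp [Comb.ins]
  | cons q l ih =>
    rw [Comb.ins]
    rcases h : p.1.beq q.1 with _ | _
    · rcases h' : p.1.blt q.1 with _ | _
      · simp only [cond_false, ev_cons, ih]; abel
      · simp
    · have : p.1 = q.1 := Nat.eq_of_beq_eq_true h
      simp only [cond_true, ev_cons, this, add_smul]; abel

/-- The sorted form of a formal combination. -/
def Comb.norm (l : Comb) : Comb := l.foldr Comb.ins []

theorem ev_norm (l : Comb) : ev x (Comb.norm l) = ev x l := by
  induction l with
  | nil => rfl
  | cons p l ih =>
    have : Comb.norm (p :: l) = Comb.ins p (Comb.norm l) := rfl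
    rw [this, ev_ins, ih, ev_cons]

/-- Boolean test for a formal combination being zero. -/
def Comb.isZero (l : Comb) : Bool := (Comb.norm l).all fun p => decide (p.2 = 0)

theorem ev_eq_zero_of_isZero {l : Comb} (h : Comb.isZero l = true) : ev x l = 0 := by
  rw [← ev_norm]
  simp only [Comb.isZero, List.all_eq_true, decide_eq_true_eq] at h
  generalize Comb.norm l = m at h
  induction m with
  | nil => rfl
  | cons p m ih =>
    rw [ev_cons, h p (by simp), zero_smul, zero_add]
    exact ih fun q hq => h q (by simp [hq])

/-- Boolean test for equality of formal combinations. -/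
def Comb.eqv (l m : Comb) : Bool := Comb.isZero (l ++ Comb.smul (-1) m)

theorem ev_eq_of_eqv {l m : Comb} (h : Comb.eqv l m = true) : ev x l = ev x m := by
  have := ev_eq_zero_of_isZero x h
  rw [ev_append, ev_smul, neg_smul, one_smul, ← sub_eq_add_neg] at this
  exact sub_eq_zero.1 this

theorem map_ev {N F : Type*} [AddCommGroup N] [FunLike F M N] [AddMonoidHomClass F M N] (f : F)
    (l : Comb) : f (ev x l) = ev (fun i => f (x i)) l := by
  induction l with
  | nil => simp
  | cons p l ih => simp [ih, map_zsmul]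

theorem ev_mem {R : Type*} [Ring R] [Module R M] (W : Submodule R M) {l : Comb}
    (h : ∀ p ∈ l, x p.1 ∈ W) : ev x l ∈ W := by
  induction l with
  | nil => simp
  | cons p l ih =>
    rw [ev_cons]
    exact W.add_mem (W.toAddSubgroup.zsmul_mem (h p (by simp)) _)
      (ih fun q hq => h q (by simp [hq]))

/-- Coefficient of a symbol in a formal combination. -/
def Comb.coeff (l : Comb) (k : ℕ) : ℤ := l.foldr (fun p a => cond (p.1.beq k) (p.2 + a) a) 0

theorem Comb.coeff_cons (p : ℕ × ℤ) (l : Comb) (k : ℕ) :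
    Comb.coeff (p :: l) k = (if p.1 = k then p.2 else 0) + Comb.coeff l k := by
  have : Comb.coeff (p :: l) k = cond (p.1.beq k) (p.2 + Comb.coeff l k) (Comb.coeff l k) := rfl
  rw [this]
  rcases h : p.1.beq k with _ | _
  · have : p.1 ≠ k := Nat.ne_of_beq_eq_false h
    simp [this]
  · have : p.1 = k := Nat.eq_of_beq_eq_true h
    simp [this]

end ev

/-- Bilinear extension of a bracket of symbols to formal combinations. -/
def Comb.lie (br : ℕ → ℕ → Comb) (l m : Comb) : Comb :=
  l.flatMap fun p => m.flatMap fun q => Comb.smul (p.2 * q.2) (br p.1 q.1)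

theorem ev_lie {L : Type*} [LieRing L] {x : ℕ → L} {br : ℕ → ℕ → Comb}
    (h : ∀ i j, ⁅x i, x j⁆ = ev x (br i j)) (l m : Comb) :
    ⁅ev x l, ev x m⁆ = ev x (Comb.lie br l m) := by
  have aux : ∀ p : ℕ × ℤ, ⁅p.2 • x p.1, ev x m⁆ =
      ev x (m.flatMap fun q => Comb.smul (p.2 * q.2) (br p.1 q.1)) := by
    intro p
    induction m with
    | nil => simp
    | cons q m ih =>
      rw [List.flatMap_cons, ev_append, ev_smul, ← ih, ev_cons, lie_add, ← h, mul_smul, zsmul_lie,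
        lie_zsmul]
  induction l with
  | nil => simp [Comb.lie]
  | cons p l ih =>
    rw [ev_cons, add_lie, ih, aux, ← ev_append]
    rfl

/-! ### Endomorphisms of `ℕ →₀ ℂ` as formal combinations of elementary matrices -/

/-- The Lie algebra of endomorphisms of `ℕ →₀ ℂ`. -/
def Gl : Type := Module.End ℂ (ℕ →₀ ℂ)

noncomputable instance : LieRing Gl :=
  LieRing.ofAssociativeRing (A := Module.End ℂ (ℕ →₀ ℂ))

noncomputable instance : LieAlgebra ℂ Gl :=
  letI := LieRing.ofAssociativeRing (A := Module.End ℂ (ℕ →₀ ℂ))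
  LieAlgebra.ofAssociativeAlgebra (A := Module.End ℂ (ℕ →₀ ℂ))

/-- The elementary matrix with row `r` and column `c`. -/
noncomputable def single (r c : ℕ) : Module.End ℂ (ℕ →₀ ℂ) :=
  Finsupp.lsingle r ∘ₗ Finsupp.lapply c

theorem single_mul (r c r' c' : ℕ) :
    single r c * single r' c' = if c = r' then single r c' else 0 := by
  ext a b
  by_cases h : c = r'
  · simp [single, h]
  · simp [single, h, Finsupp.single_apply]

/-- The product of `Gl`. -/
noncomputable def Gl.mul (x y : Gl) : Gl :=
  (show Module.End ℂ (ℕ →₀ ℂ) from x) * (show Module.End ℂ (ℕ →₀ ℂ) from y)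

theorem Gl.lie_def (x y : Gl) : ⁅x, y⁆ = Gl.mul x y - Gl.mul y x := rfl

/-- The elementary matrix with row `n / 27` and column `n % 27`. -/
noncomputable def elem (n : ℕ) : Gl := single (n / 27) (n % 27)

/-- Commutators of elementary matrices. -/
def elemLie (m n : ℕ) : Comb :=
  cond ((m % 27).beq (n / 27)) [(27 * (m / 27) + n % 27, 1)] [] ++
    cond ((n % 27).beq (m / 27)) [(27 * (n / 27) + m % 27, -1)] []

theorem elem_lie (m n : ℕ) : ⁅elem m, elem n⁆ = ev elem (elemLie m n) := by
  have key : ∀ m n : ℕ, ∀ a : ℤ,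
      ev elem (cond ((m % 27).beq (n / 27)) [(27 * (m / 27) + n % 27, a)] []) =
        a • Gl.mul (elem m) (elem n) := by
    intro m n a
    have hm : Gl.mul (elem m) (elem n) =
      (if m % 27 = n / 27 then single (m / 27) (n % 27) else 0 : Module.End ℂ (ℕ →₀ ℂ)) :=
      single_mul _ _ _ _
    rw [hm]
    rcases h : (m % 27).beq (n / 27) with _ | _
    · rw [if_neg (Nat.ne_of_beq_eq_false h)]; exact (smul_zero a).symm
    · have h1 : (27 * (m / 27) + n % 27) / 27 = m / 27 := by omega
      have h2 : (27 * (m / 27) + n % 27) % 27 = n % 27 := by omega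
      rw [if_pos (Nat.eq_of_beq_eq_true h), cond_true, ev_cons, ev_nil, add_zero, elem, h1, h2]
  rw [elemLie, ev_append, key, key, one_smul, neg_smul, one_smul]
  exact (Gl.lie_def _ _).trans (sub_eq_add_neg _ _)

/-- The matrix entry functional dual to `elem n`. -/
noncomputable def entry (n : ℕ) : Gl →ₗ[ℂ] ℂ where
  toFun f := (show Module.End ℂ (ℕ →₀ ℂ) from f) (Finsupp.single (n % 27) 1) (n / 27)
  map_add' _ _ := rfl
  map_smul' _ _ := rfl

theorem entry_elem (m n : ℕ) : entry m (elem n) = if n = m then 1 else 0 := by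
  have h0 : entry m (elem n) =
      single (n / 27) (n % 27) (Finsupp.single (m % 27) 1) (m / 27) := rfl
  rw [h0]
  by_cases h : n = m
  · simp [single, h]
  · rw [if_neg h]
    by_cases h1 : n % 27 = m % 27
    · have h2 : n / 27 ≠ m / 27 := by omega
      simp [single, h1, h2]
    · simp [single, Ne.symm h1]

theorem entry_ev (k : ℕ) (l : Comb) : entry k (ev elem l) = (Comb.coeff l k : ℂ) := by
  induction l with
  | nil => simp [Comb.coeff]
  | cons p l ih =>
    rw [Comb.coeff_cons, ev_cons, map_add, map_zsmul, entry_elem, ih]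
    split_ifs <;> simp

end F4

namespace F4

section Serre

variable {L : Type*} [LieRing L]

theorem serre_one {a c : L} (h : ⁅a, c⁆ = 0) (y : L) : ⁅a, ⁅c, y⁆⁆ - ⁅c, ⁅a, y⁆⁆ = 0 := by
  rw [← lie_lie, h, zero_lie]

variable [LieAlgebra ℂ L]

theorem serre_two {a c : L} (h : ⁅a, ⁅a, c⁆⁆ = 0) (y : L) :
    ⁅a, ⁅a, ⁅c, y⁆⁆⁆ - (2 : ℂ) • ⁅a, ⁅c, ⁅a, y⁆⁆⁆ + ⁅c, ⁅a, ⁅a, y⁆⁆⁆ = 0 := by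
  have := serre_one h y
  simp only [lie_lie, lie_sub] at this
  linear_combination (norm := module) (1 : ℂ) • this

theorem serre_three {a c : L} (h : ⁅a, ⁅a, ⁅a, c⁆⁆⁆ = 0) (y : L) :
    ⁅a, ⁅a, ⁅a, ⁅c, y⁆⁆⁆⁆ - (3 : ℂ) • ⁅a, ⁅a, ⁅c, ⁅a, y⁆⁆⁆⁆ + (3 : ℂ) • ⁅a, ⁅c, ⁅a, ⁅a, y⁆⁆⁆⁆ -
      ⁅c, ⁅a, ⁅a, ⁅a, y⁆⁆⁆⁆ = 0 := by
  have := serre_two h y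
  simp only [lie_lie, lie_sub] at this
  linear_combination (norm := module) (1 : ℂ) • this

end Serre

/-- Root vectors of the positive part of `F₄`, given by words in the generators `b 0, …, b 3`. -/
structure PosSystem {L : Type*} [LieRing L] [LieAlgebra ℂ L] (b : ℕ → L) : Prop where
  s01 : ⁅b 0, ⁅b 0, b 1⁆⁆ = 0
  s02 : ⁅b 0, b 2⁆ = 0
  s03 : ⁅b 0, b 3⁆ = 0
  s10 : ⁅b 1, ⁅b 1, b 0⁆⁆ = 0
  s12 : ⁅b 1, ⁅b 1, ⁅b 1, b 2⁆⁆⁆ = 0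
  s13 : ⁅b 1, b 3⁆ = 0
  s21 : ⁅b 2, ⁅b 2, b 1⁆⁆ = 0
  s23 : ⁅b 2, ⁅b 2, b 3⁆⁆ = 0
  s32 : ⁅b 3, ⁅b 3, b 2⁆⁆ = 0
  h0_1 : ⁅b 0, b 1⁆ = (1:ℂ) • b 4
  h1_2 : ⁅b 1, b 2⁆ = (1:ℂ) • b 5
  h2_3 : ⁅b 2, b 3⁆ = (1:ℂ) • b 6
  h0_5 : ⁅b 0, b 5⁆ = (1:ℂ) • b 7
  h1_5 : ⁅b 1, b 5⁆ = (2:ℂ) • b 8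
  h1_6 : ⁅b 1, b 6⁆ = (1:ℂ) • b 9
  h0_8 : ⁅b 0, b 8⁆ = (1:ℂ) • b 10
  h0_9 : ⁅b 0, b 9⁆ = (1:ℂ) • b 11
  h3_8 : ⁅b 3, b 8⁆ = (1:ℂ) • b 12
  h0_10 : ⁅b 0, b 10⁆ = (2:ℂ) • b 13
  h0_12 : ⁅b 0, b 12⁆ = (1:ℂ) • b 14
  h2_12 : ⁅b 2, b 12⁆ = (1:ℂ) • b 15
  h3_13 : ⁅b 3, b 13⁆ = (1:ℂ) • b 16
  h0_15 : ⁅b 0, b 15⁆ = (1:ℂ) • b 17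
  h2_16 : ⁅b 2, b 16⁆ = (1:ℂ) • b 18
  h1_17 : ⁅b 1, b 17⁆ = (1:ℂ) • b 19
  h0_19 : ⁅b 0, b 19⁆ = (1:ℂ) • b 20
  h1_20 : ⁅b 1, b 20⁆ = (2:ℂ) • b 21
  h2_21 : ⁅b 2, b 21⁆ = (1:ℂ) • b 22
  h3_22 : ⁅b 3, b 22⁆ = (1:ℂ) • b 23

set_option linter.unusedSimpArgs false in
theorem PosSystem.lie_mem {L : Type*} [LieRing L] [LieAlgebra ℂ L] {b : ℕ → L} (hb : PosSystem b)
    (i : ℕ) (hi : i < 4) (g : ℕ) (hg : g < 24) :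
    ⁅b i, b g⁆ ∈ Submodule.span ℂ (b '' Set.Iio 24) := by
  obtain ⟨s01, s02, s03, s10, s12, s13, s21, s23, s32, h0_1, h1_2, h2_3, h0_5, h1_5, h1_6, h0_8, h0_9, h3_8, h0_10, h0_12, h2_12, h3_13, h0_15, h2_16, h1_17, h0_19, h1_20, h2_21, h3_22⟩ := hb
  have h0_0 : ⁅b 0, b 0⁆ = 0 := lie_self _
  have h1_1 : ⁅b 1, b 1⁆ = 0 := lie_self _
  have h2_2 : ⁅b 2, b 2⁆ = 0 := lie_self _
  have h3_3 : ⁅b 3, b 3⁆ = 0 := lie_self _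
  have h1_0 : ⁅b 1, b 0⁆ = (-1:ℂ) • b 4 := by rw [← lie_skew, h0_1]; module
  have h2_0 : ⁅b 2, b 0⁆ = 0 := by rw [← lie_skew, s02, neg_zero]
  have h3_0 : ⁅b 3, b 0⁆ = 0 := by rw [← lie_skew, s03, neg_zero]
  have h2_1 : ⁅b 2, b 1⁆ = (-1:ℂ) • b 5 := by rw [← lie_skew, h1_2]; module
  have h3_1 : ⁅b 3, b 1⁆ = 0 := by rw [← lie_skew, s13, neg_zero]
  have h0_2 : ⁅b 0, b 2⁆ = 0 := by rw [← lie_skew, h2_0]; module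
  have h3_2 : ⁅b 3, b 2⁆ = (-1:ℂ) • b 6 := by rw [← lie_skew, h2_3]; module
  have h0_3 : ⁅b 0, b 3⁆ = 0 := by rw [← lie_skew, h3_0]; module
  have h1_3 : ⁅b 1, b 3⁆ = 0 := by rw [← lie_skew, h3_1]; module
  have h0_4 : ⁅b 0, b 4⁆ = 0 := by
    have h := s01; simp only [h0_1, lie_smul, smul_smul] at h
    linear_combination (norm := module) (1:ℂ) • h
  have h1_4 : ⁅b 1, b 4⁆ = 0 := by
    have h := s10; simp only [h1_0, lie_smul, smul_smul] at h
    linear_combination (norm := module) (-1:ℂ) • h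
  have h2_4 : ⁅b 2, b 4⁆ = (-1:ℂ) • b 7 := by
    have h := serre_one s02 (b 1); simp only [h0_1, h0_5, h2_1, lie_smul, lie_zero, smul_zero, smul_smul] at h
    linear_combination (norm := module) (-1:ℂ) • h
  have h3_4 : ⁅b 3, b 4⁆ = 0 := by
    have h := serre_one s03 (b 1); simp only [h0_1, h3_1, lie_smul, lie_zero, smul_zero, smul_smul] at h
    linear_combination (norm := module) (-1:ℂ) • h
  have h2_5 : ⁅b 2, b 5⁆ = 0 := by
    have h := s21; simp only [h2_1, lie_smul, smul_smul] at h
    linear_combination (norm := module) (-1:ℂ) • h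
  have h3_5 : ⁅b 3, b 5⁆ = (-1:ℂ) • b 9 := by
    have h := serre_one s13 (b 2); simp only [h1_2, h1_6, h3_2, lie_smul, lie_zero, smul_zero, smul_smul] at h
    linear_combination (norm := module) (-1:ℂ) • h
  have h0_6 : ⁅b 0, b 6⁆ = 0 := by
    have h := serre_one s02 (b 3); simp only [h0_3, h2_3, lie_smul, lie_zero, smul_zero, smul_smul] at h
    linear_combination (norm := module) (1:ℂ) • h
  have h2_6 : ⁅b 2, b 6⁆ = 0 := by
    have h := s23; simp only [h2_3, lie_smul, smul_smul] at h
    linear_combination (norm := module) (1:ℂ) • h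
  have h3_6 : ⁅b 3, b 6⁆ = 0 := by
    have h := s32; simp only [h3_2, lie_smul, smul_smul] at h
    linear_combination (norm := module) (-1:ℂ) • h
  have h0_7 : ⁅b 0, b 7⁆ = 0 := by
    have h := serre_two s01 (b 2); simp only [h0_2, h0_5, h1_2, lie_smul, lie_zero, smul_zero, smul_smul] at h
    linear_combination (norm := module) (1:ℂ) • h
  have h1_7 : ⁅b 1, b 7⁆ = (1:ℂ) • b 10 := by
    have h := serre_two s10 (b 2); simp only [h0_2, h0_5, h0_8, h1_2, h1_5, lie_smul, lie_zero, smul_zero, smul_smul] at h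
    linear_combination (norm := module) (-1/2:ℂ) • h
  have h2_7 : ⁅b 2, b 7⁆ = 0 := by
    have h := serre_one s02 (b 5); simp only [h0_5, h2_5, lie_smul, lie_zero, smul_zero, smul_smul] at h
    linear_combination (norm := module) (-1:ℂ) • h
  have h3_7 : ⁅b 3, b 7⁆ = (-1:ℂ) • b 11 := by
    have h := serre_one s03 (b 5); simp only [h0_5, h0_9, h3_5, lie_smul, lie_zero, smul_zero, smul_smul] at h
    linear_combination (norm := module) (-1:ℂ) • h
  have h1_8 : ⁅b 1, b 8⁆ = 0 := by
    have h := s12; simp only [h1_2, h1_5, lie_smul, smul_smul] at h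
    linear_combination (norm := module) (1/2:ℂ) • h
  have h2_8 : ⁅b 2, b 8⁆ = 0 := by
    have h := serre_two s21 (b 1); simp only [h1_1, h1_5, h2_1, h2_5, lie_smul, lie_zero, smul_zero, smul_smul] at h
    linear_combination (norm := module) (1/4:ℂ) • h
  have h1_9 : ⁅b 1, b 9⁆ = (-2:ℂ) • b 12 := by
    have h := serre_one s13 (b 5); simp only [h1_5, h3_5, h3_8, lie_smul, lie_zero, smul_zero, smul_smul] at h
    linear_combination (norm := module) (-1:ℂ) • h
  have h2_9 : ⁅b 2, b 9⁆ = 0 := by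
    have h := serre_two s21 (b 3); simp only [h1_3, h1_6, h2_3, h2_6, lie_smul, lie_zero, smul_zero, smul_smul] at h
    linear_combination (norm := module) (-1/2:ℂ) • h
  have h3_9 : ⁅b 3, b 9⁆ = 0 := by
    have h := serre_one s13 (b 6); simp only [h1_6, h3_6, lie_smul, lie_zero, smul_zero, smul_smul] at h
    linear_combination (norm := module) (-1:ℂ) • h
  have h1_10 : ⁅b 1, b 10⁆ = 0 := by
    have h := serre_two s10 (b 5); simp only [h0_5, h0_8, h1_5, h1_7, h1_8, lie_smul, lie_zero, smul_zero, smul_smul] at h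
    linear_combination (norm := module) (-1/3:ℂ) • h
  have h2_10 : ⁅b 2, b 10⁆ = 0 := by
    have h := serre_one s02 (b 8); simp only [h0_8, h2_8, lie_smul, lie_zero, smul_zero, smul_smul] at h
    linear_combination (norm := module) (-1:ℂ) • h
  have h3_10 : ⁅b 3, b 10⁆ = (1:ℂ) • b 14 := by
    have h := serre_one s03 (b 8); simp only [h0_8, h0_12, h3_8, lie_smul, lie_zero, smul_zero, smul_smul] at h
    linear_combination (norm := module) (-1:ℂ) • h
  have h0_11 : ⁅b 0, b 11⁆ = 0 := by
    have h := serre_two s01 (b 6); simp only [h0_6, h0_9, h1_6, lie_smul, lie_zero, smul_zero, smul_smul] at h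
    linear_combination (norm := module) (1:ℂ) • h
  have h1_11 : ⁅b 1, b 11⁆ = (-1:ℂ) • b 14 := by
    have h := serre_two s10 (b 6); simp only [h0_6, h0_9, h0_12, h1_6, h1_9, lie_smul, lie_zero, smul_zero, smul_smul] at h
    linear_combination (norm := module) (-1/2:ℂ) • h
  have h2_11 : ⁅b 2, b 11⁆ = 0 := by
    have h := serre_one s02 (b 9); simp only [h0_9, h2_9, lie_smul, lie_zero, smul_zero, smul_smul] at h
    linear_combination (norm := module) (-1:ℂ) • h
  have h3_11 : ⁅b 3, b 11⁆ = 0 := by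
    have h := serre_one s03 (b 9); simp only [h0_9, h3_9, lie_smul, lie_zero, smul_zero, smul_smul] at h
    linear_combination (norm := module) (-1:ℂ) • h
  have h1_12 : ⁅b 1, b 12⁆ = 0 := by
    have h := serre_three s12 (b 3); simp only [h1_3, h1_6, h1_9, h2_3, lie_smul, lie_zero, smul_zero, smul_smul] at h
    linear_combination (norm := module) (-1/2:ℂ) • h
  have h3_12 : ⁅b 3, b 12⁆ = 0 := by
    have h := serre_one s13 (b 9); simp only [h1_9, h3_9, lie_smul, lie_zero, smul_zero, smul_smul] at h
    linear_combination (norm := module) (1/2:ℂ) • h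
  have h0_13 : ⁅b 0, b 13⁆ = 0 := by
    have h := serre_two s01 (b 7); simp only [h0_7, h0_10, h1_7, lie_smul, lie_zero, smul_zero, smul_smul] at h
    linear_combination (norm := module) (1/2:ℂ) • h
  have h1_13 : ⁅b 1, b 13⁆ = 0 := by
    have h := serre_two s01 (b 8); simp only [h0_8, h0_10, h1_8, h1_10, lie_smul, lie_zero, smul_zero, smul_smul] at h
    linear_combination (norm := module) (1/2:ℂ) • h
  have h2_13 : ⁅b 2, b 13⁆ = 0 := by
    have h := serre_one s02 (b 10); simp only [h0_10, h2_10, lie_smul, lie_zero, smul_zero, smul_smul] at h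
    linear_combination (norm := module) (-1/2:ℂ) • h
  have h0_14 : ⁅b 0, b 14⁆ = (2:ℂ) • b 16 := by
    have h := serre_one s03 (b 10); simp only [h0_10, h3_10, h3_13, lie_smul, lie_zero, smul_zero, smul_smul] at h
    linear_combination (norm := module) (1:ℂ) • h
  have h1_14 : ⁅b 1, b 14⁆ = 0 := by
    have h := serre_two s10 (b 9); simp only [h0_9, h0_12, h1_9, h1_11, h1_12, lie_smul, lie_zero, smul_zero, smul_smul] at h
    linear_combination (norm := module) (1/3:ℂ) • h
  have h2_14 : ⁅b 2, b 14⁆ = (1:ℂ) • b 17 := by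
    have h := serre_one s02 (b 12); simp only [h0_12, h0_15, h2_12, lie_smul, lie_zero, smul_zero, smul_smul] at h
    linear_combination (norm := module) (-1:ℂ) • h
  have h3_14 : ⁅b 3, b 14⁆ = 0 := by
    have h := serre_one s03 (b 12); simp only [h0_12, h3_12, lie_smul, lie_zero, smul_zero, smul_smul] at h
    linear_combination (norm := module) (-1:ℂ) • h
  have h1_15 : ⁅b 1, b 15⁆ = 0 := by
    have h := serre_three s12 (b 6); simp only [h1_6, h1_9, h1_12, h2_6, h2_9, h2_12, lie_smul, lie_zero, smul_zero, smul_smul] at h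
    linear_combination (norm := module) (-1/6:ℂ) • h
  have h2_15 : ⁅b 2, b 15⁆ = 0 := by
    have h := serre_two s21 (b 9); simp only [h1_9, h2_9, h2_12, lie_smul, lie_zero, smul_zero, smul_smul] at h
    linear_combination (norm := module) (-1/2:ℂ) • h
  have h3_15 : ⁅b 3, b 15⁆ = 0 := by
    have h := serre_two s32 (b 8); simp only [h2_8, h2_12, h3_8, h3_12, lie_smul, lie_zero, smul_zero, smul_smul] at h
    linear_combination (norm := module) (-1/2:ℂ) • h
  have h0_16 : ⁅b 0, b 16⁆ = 0 := by
    have h := serre_two s01 (b 11); simp only [h0_11, h0_14, h1_11, lie_smul, lie_zero, smul_zero, smul_smul] at h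
    linear_combination (norm := module) (-1/2:ℂ) • h
  have h1_16 : ⁅b 1, b 16⁆ = 0 := by
    have h := serre_two s01 (b 12); simp only [h0_12, h0_14, h1_12, h1_14, lie_smul, lie_zero, smul_zero, smul_smul] at h
    linear_combination (norm := module) (1/2:ℂ) • h
  have h3_16 : ⁅b 3, b 16⁆ = 0 := by
    have h := serre_one s03 (b 14); simp only [h0_14, h3_14, lie_smul, lie_zero, smul_zero, smul_smul] at h
    linear_combination (norm := module) (-1/2:ℂ) • h
  have h0_17 : ⁅b 0, b 17⁆ = (2:ℂ) • b 18 := by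
    have h := serre_one s02 (b 14); simp only [h0_14, h2_14, h2_16, lie_smul, lie_zero, smul_zero, smul_smul] at h
    linear_combination (norm := module) (1:ℂ) • h
  have h2_17 : ⁅b 2, b 17⁆ = 0 := by
    have h := serre_one s02 (b 15); simp only [h0_15, h2_15, lie_smul, lie_zero, smul_zero, smul_smul] at h
    linear_combination (norm := module) (-1:ℂ) • h
  have h3_17 : ⁅b 3, b 17⁆ = 0 := by
    have h := serre_one s03 (b 15); simp only [h0_15, h3_15, lie_smul, lie_zero, smul_zero, smul_smul] at h
    linear_combination (norm := module) (-1:ℂ) • h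
  have h0_18 : ⁅b 0, b 18⁆ = 0 := by
    have h := serre_one s02 (b 16); simp only [h0_16, h2_16, lie_smul, lie_zero, smul_zero, smul_smul] at h
    linear_combination (norm := module) (1:ℂ) • h
  have h1_18 : ⁅b 1, b 18⁆ = (1:ℂ) • b 20 := by
    have h := serre_two s01 (b 15); simp only [h0_15, h0_17, h0_19, h1_15, h1_17, lie_smul, lie_zero, smul_zero, smul_smul] at h
    linear_combination (norm := module) (1/2:ℂ) • h
  have h2_18 : ⁅b 2, b 18⁆ = 0 := by
    have h := serre_one s02 (b 17); simp only [h0_17, h2_17, lie_smul, lie_zero, smul_zero, smul_smul] at h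
    linear_combination (norm := module) (-1/2:ℂ) • h
  have h3_18 : ⁅b 3, b 18⁆ = 0 := by
    have h := serre_one s03 (b 17); simp only [h0_17, h3_17, lie_smul, lie_zero, smul_zero, smul_smul] at h
    linear_combination (norm := module) (-1/2:ℂ) • h
  have h1_19 : ⁅b 1, b 19⁆ = 0 := by
    have h := serre_two s10 (b 15); simp only [h0_15, h1_15, h1_17, lie_smul, lie_zero, smul_zero, smul_smul] at h
    linear_combination (norm := module) (1:ℂ) • h
  have h2_19 : ⁅b 2, b 19⁆ = 0 := by
    have h := serre_two s21 (b 14); simp only [h1_14, h1_17, h2_14, h2_17, lie_smul, lie_zero, smul_zero, smul_smul] at h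
    linear_combination (norm := module) (-1/2:ℂ) • h
  have h3_19 : ⁅b 3, b 19⁆ = 0 := by
    have h := serre_one s13 (b 17); simp only [h1_17, h3_17, lie_smul, lie_zero, smul_zero, smul_smul] at h
    linear_combination (norm := module) (-1:ℂ) • h
  have h0_20 : ⁅b 0, b 20⁆ = 0 := by
    have h := serre_two s01 (b 17); simp only [h0_17, h0_18, h0_19, h1_17, h1_18, lie_smul, lie_zero, smul_zero, smul_smul] at h
    linear_combination (norm := module) (-1/3:ℂ) • h
  have h2_20 : ⁅b 2, b 20⁆ = 0 := by
    have h := serre_one s02 (b 19); simp only [h0_19, h2_19, lie_smul, lie_zero, smul_zero, smul_smul] at h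
    linear_combination (norm := module) (-1:ℂ) • h
  have h3_20 : ⁅b 3, b 20⁆ = 0 := by
    have h := serre_one s03 (b 19); simp only [h0_19, h3_19, lie_smul, lie_zero, smul_zero, smul_smul] at h
    linear_combination (norm := module) (-1:ℂ) • h
  have h0_21 : ⁅b 0, b 21⁆ = 0 := by
    have h := serre_two s01 (b 19); simp only [h0_19, h0_20, h1_19, h1_20, lie_smul, lie_zero, smul_zero, smul_smul] at h
    linear_combination (norm := module) (-1/4:ℂ) • h
  have h1_21 : ⁅b 1, b 21⁆ = 0 := by
    have h := serre_two s10 (b 19); simp only [h0_19, h1_19, h1_20, lie_smul, lie_zero, smul_zero, smul_smul] at h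
    linear_combination (norm := module) (1/2:ℂ) • h
  have h3_21 : ⁅b 3, b 21⁆ = 0 := by
    have h := serre_one s13 (b 20); simp only [h1_20, h3_20, lie_smul, lie_zero, smul_zero, smul_smul] at h
    linear_combination (norm := module) (-1/2:ℂ) • h
  have h0_22 : ⁅b 0, b 22⁆ = 0 := by
    have h := serre_one s02 (b 21); simp only [h0_21, h2_21, lie_smul, lie_zero, smul_zero, smul_smul] at h
    linear_combination (norm := module) (1:ℂ) • h
  have h1_22 : ⁅b 1, b 22⁆ = 0 := by
    have h := serre_three s12 (b 18); simp only [h1_18, h1_20, h1_21, h2_18, h2_20, h2_21, lie_smul, lie_zero, smul_zero, smul_smul] at h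
    linear_combination (norm := module) (1/6:ℂ) • h
  have h2_22 : ⁅b 2, b 22⁆ = 0 := by
    have h := serre_two s21 (b 20); simp only [h1_20, h2_20, h2_21, lie_smul, lie_zero, smul_zero, smul_smul] at h
    linear_combination (norm := module) (1/2:ℂ) • h
  have h0_23 : ⁅b 0, b 23⁆ = 0 := by
    have h := serre_one s03 (b 22); simp only [h0_22, h3_22, lie_smul, lie_zero, smul_zero, smul_smul] at h
    linear_combination (norm := module) (1:ℂ) • h
  have h1_23 : ⁅b 1, b 23⁆ = 0 := by
    have h := serre_one s13 (b 22); simp only [h1_22, h3_22, lie_smul, lie_zero, smul_zero, smul_smul] at h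
    linear_combination (norm := module) (1:ℂ) • h
  have h2_23 : ⁅b 2, b 23⁆ = 0 := by
    have h := serre_two s23 (b 21); simp only [h2_21, h2_22, h3_21, h3_22, lie_smul, lie_zero, smul_zero, smul_smul] at h
    linear_combination (norm := module) (-1/2:ℂ) • h
  have h3_23 : ⁅b 3, b 23⁆ = 0 := by
    have h := serre_two s32 (b 21); simp only [h2_21, h3_21, h3_22, lie_smul, lie_zero, smul_zero, smul_smul] at h
    linear_combination (norm := module) (1:ℂ) • h
  have hm : ∀ k < 24, ∀ c : ℂ, c • b k ∈ Submodule.span ℂ (b '' Set.Iio 24) := fun k hk c =>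
    Submodule.smul_mem _ _ (Submodule.subset_span ⟨k, hk, rfl⟩)
  have h0 := Submodule.zero_mem (Submodule.span ℂ (b '' Set.Iio 24))
  have r0 : ∀ g < 24, ⁅b 0, b g⁆ ∈ Submodule.span ℂ (b '' Set.Iio 24) := by
    intro g hg; interval_cases g
    · rw [h0_0]; exact h0
    · rw [h0_1]; exact hm 4 (by norm_num) _
    · rw [h0_2]; exact h0
    · rw [h0_3]; exact h0
    · rw [h0_4]; exact h0
    · rw [h0_5]; exact hm 7 (by norm_num) _
    · rw [h0_6]; exact h0
    · rw [h0_7]; exact h0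
    · rw [h0_8]; exact hm 10 (by norm_num) _
    · rw [h0_9]; exact hm 11 (by norm_num) _
    · rw [h0_10]; exact hm 13 (by norm_num) _
    · rw [h0_11]; exact h0
    · rw [h0_12]; exact hm 14 (by norm_num) _
    · rw [h0_13]; exact h0
    · rw [h0_14]; exact hm 16 (by norm_num) _
    · rw [h0_15]; exact hm 17 (by norm_num) _
    · rw [h0_16]; exact h0
    · rw [h0_17]; exact hm 18 (by norm_num) _
    · rw [h0_18]; exact h0
    · rw [h0_19]; exact hm 20 (by norm_num) _
    · rw [h0_20]; exact h0
    · rw [h0_21]; exact h0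
    · rw [h0_22]; exact h0
    · rw [h0_23]; exact h0
  have r1 : ∀ g < 24, ⁅b 1, b g⁆ ∈ Submodule.span ℂ (b '' Set.Iio 24) := by
    intro g hg; interval_cases g
    · rw [h1_0]; exact hm 4 (by norm_num) _
    · rw [h1_1]; exact h0
    · rw [h1_2]; exact hm 5 (by norm_num) _
    · rw [h1_3]; exact h0
    · rw [h1_4]; exact h0
    · rw [h1_5]; exact hm 8 (by norm_num) _
    · rw [h1_6]; exact hm 9 (by norm_num) _
    · rw [h1_7]; exact hm 10 (by norm_num) _
    · rw [h1_8]; exact h0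
    · rw [h1_9]; exact hm 12 (by norm_num) _
    · rw [h1_10]; exact h0
    · rw [h1_11]; exact hm 14 (by norm_num) _
    · rw [h1_12]; exact h0
    · rw [h1_13]; exact h0
    · rw [h1_14]; exact h0
    · rw [h1_15]; exact h0
    · rw [h1_16]; exact h0
    · rw [h1_17]; exact hm 19 (by norm_num) _
    · rw [h1_18]; exact hm 20 (by norm_num) _
    · rw [h1_19]; exact h0
    · rw [h1_20]; exact hm 21 (by norm_num) _
    · rw [h1_21]; exact h0
    · rw [h1_22]; exact h0
    · rw [h1_23]; exact h0
  have r2 : ∀ g < 24, ⁅b 2, b g⁆ ∈ Submodule.span ℂ (b '' Set.Iio 24) := by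
    intro g hg; interval_cases g
    · rw [h2_0]; exact h0
    · rw [h2_1]; exact hm 5 (by norm_num) _
    · rw [h2_2]; exact h0
    · rw [h2_3]; exact hm 6 (by norm_num) _
    · rw [h2_4]; exact hm 7 (by norm_num) _
    · rw [h2_5]; exact h0
    · rw [h2_6]; exact h0
    · rw [h2_7]; exact h0
    · rw [h2_8]; exact h0
    · rw [h2_9]; exact h0
    · rw [h2_10]; exact h0
    · rw [h2_11]; exact h0
    · rw [h2_12]; exact hm 15 (by norm_num) _
    · rw [h2_13]; exact h0
    · rw [h2_14]; exact hm 17 (by norm_num) _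
    · rw [h2_15]; exact h0
    · rw [h2_16]; exact hm 18 (by norm_num) _
    · rw [h2_17]; exact h0
    · rw [h2_18]; exact h0
    · rw [h2_19]; exact h0
    · rw [h2_20]; exact h0
    · rw [h2_21]; exact hm 22 (by norm_num) _
    · rw [h2_22]; exact h0
    · rw [h2_23]; exact h0
  have r3 : ∀ g < 24, ⁅b 3, b g⁆ ∈ Submodule.span ℂ (b '' Set.Iio 24) := by
    intro g hg; interval_cases g
    · rw [h3_0]; exact h0
    · rw [h3_1]; exact h0
    · rw [h3_2]; exact hm 6 (by norm_num) _
    · rw [h3_3]; exact h0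
    · rw [h3_4]; exact h0
    · rw [h3_5]; exact hm 9 (by norm_num) _
    · rw [h3_6]; exact h0
    · rw [h3_7]; exact hm 11 (by norm_num) _
    · rw [h3_8]; exact hm 12 (by norm_num) _
    · rw [h3_9]; exact h0
    · rw [h3_10]; exact hm 14 (by norm_num) _
    · rw [h3_11]; exact h0
    · rw [h3_12]; exact h0
    · rw [h3_13]; exact hm 16 (by norm_num) _
    · rw [h3_14]; exact h0
    · rw [h3_15]; exact h0
    · rw [h3_16]; exact h0
    · rw [h3_17]; exact h0
    · rw [h3_18]; exact h0
    · rw [h3_19]; exact h0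
    · rw [h3_20]; exact h0
    · rw [h3_21]; exact h0
    · rw [h3_22]; exact hm 23 (by norm_num) _
    · rw [h3_23]; exact h0
  interval_cases i
  exacts [r0 g hg, r1 g hg, r2 g hg, r3 g hg]

theorem PosSystem.exists_word {L : Type*} [LieRing L] [LieAlgebra ℂ L] {b : ℕ → L}
    (hb : PosSystem b) (g : ℕ) (hg : 4 ≤ g) (hg' : g < 24) :
    ∃ i < 4, ∃ k < g, ∃ c : ℂ, b g = c • ⁅b i, b k⁆ := by
  have aux : ∀ i < 4, ∀ k g : ℕ, k < g → ∀ c : ℂ, c ≠ 0 → ⁅b i, b k⁆ = c • b g →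
      ∃ i < 4, ∃ k < g, ∃ c : ℂ, b g = c • ⁅b i, b k⁆ := by
    intro i hi k g hk c hc h
    refine ⟨i, hi, k, hk, c⁻¹, ?_⟩
    rw [h, smul_smul, inv_mul_cancel₀ hc, one_smul]
  interval_cases g
  · exact aux 0 (by norm_num) 1 4 (by norm_num) 1 (by norm_num) hb.h0_1
  · exact aux 1 (by norm_num) 2 5 (by norm_num) 1 (by norm_num) hb.h1_2
  · exact aux 2 (by norm_num) 3 6 (by norm_num) 1 (by norm_num) hb.h2_3
  · exact aux 0 (by norm_num) 5 7 (by norm_num) 1 (by norm_num) hb.h0_5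
  · exact aux 1 (by norm_num) 5 8 (by norm_num) 2 (by norm_num) hb.h1_5
  · exact aux 1 (by norm_num) 6 9 (by norm_num) 1 (by norm_num) hb.h1_6
  · exact aux 0 (by norm_num) 8 10 (by norm_num) 1 (by norm_num) hb.h0_8
  · exact aux 0 (by norm_num) 9 11 (by norm_num) 1 (by norm_num) hb.h0_9
  · exact aux 3 (by norm_num) 8 12 (by norm_num) 1 (by norm_num) hb.h3_8
  · exact aux 0 (by norm_num) 10 13 (by norm_num) 2 (by norm_num) hb.h0_10
  · exact aux 0 (by norm_num) 12 14 (by norm_num) 1 (by norm_num) hb.h0_12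
  · exact aux 2 (by norm_num) 12 15 (by norm_num) 1 (by norm_num) hb.h2_12
  · exact aux 3 (by norm_num) 13 16 (by norm_num) 1 (by norm_num) hb.h3_13
  · exact aux 0 (by norm_num) 15 17 (by norm_num) 1 (by norm_num) hb.h0_15
  · exact aux 2 (by norm_num) 16 18 (by norm_num) 1 (by norm_num) hb.h2_16
  · exact aux 1 (by norm_num) 17 19 (by norm_num) 1 (by norm_num) hb.h1_17
  · exact aux 0 (by norm_num) 19 20 (by norm_num) 1 (by norm_num) hb.h0_19
  · exact aux 1 (by norm_num) 20 21 (by norm_num) 2 (by norm_num) hb.h1_20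
  · exact aux 2 (by norm_num) 21 22 (by norm_num) 1 (by norm_num) hb.h2_21
  · exact aux 3 (by norm_num) 22 23 (by norm_num) 1 (by norm_num) hb.h3_22

section Span

variable {L : Type*} [LieRing L] [LieAlgebra ℂ L]

theorem lie_mem_of_span {V W : Submodule ℂ L} {s : Set L} {x : L} (hV : V = Submodule.span ℂ s)
    (h : ∀ y ∈ s, ⁅x, y⁆ ∈ W) {y : L} (hy : y ∈ V) : ⁅x, y⁆ ∈ W := by
  have : V ≤ W.comap (LieAlgebra.ad ℂ L x) := by
    rw [hV, Submodule.span_le]; exact h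
  exact this hy

theorem lie_mem_of_span_left {V W : Submodule ℂ L} {s : Set L} {x : L}
    (hV : V = Submodule.span ℂ s) (h : ∀ y ∈ s, ⁅y, x⁆ ∈ W) {y : L} (hy : y ∈ V) :
    ⁅y, x⁆ ∈ W := by
  rw [← lie_skew]
  exact W.neg_mem (lie_mem_of_span hV (fun y hy => by
    rw [← lie_skew]; exact W.neg_mem (h y hy)) hy)

theorem PosSystem.lie_opposite_mem {e f h : ℕ → L} {H N : Submodule ℂ L} (hf : PosSystem f)
    (hH : H = Submodule.span ℂ (h '' Set.Iio 4)) (hN : N = Submodule.span ℂ (f '' Set.Iio 24))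
    (hef : ∀ i < 4, ∀ j < 4, ⁅e i, f j⁆ ∈ H)
    (hhf : ∀ i < 4, ∀ j < 4, ⁅h i, f j⁆ ∈ Submodule.span ℂ {f j}) (j : ℕ) (hj : j < 4)
    (g : ℕ) (hg : g < 24) : ⁅e j, f g⁆ ∈ H ⊔ N := by
  have hfN : ∀ i < 24, f i ∈ N := fun i hi => hN ▸ Submodule.subset_span ⟨i, hi, rfl⟩
  have hHf : ∀ z ∈ H, ∀ j < 4, ⁅z, f j⁆ ∈ Submodule.span ℂ {f j} := by
    intro z hz j hj
    refine lie_mem_of_span_left hH ?_ hz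
    rintro _ ⟨i, hi, rfl⟩
    exact hhf i hi j hj
  have hfB : ∀ i < 4, ∀ z ∈ H ⊔ N, ⁅f i, z⁆ ∈ N := by
    intro i hi z hz
    obtain ⟨a, ha, c, hc, rfl⟩ := Submodule.mem_sup.1 hz
    rw [lie_add]
    refine N.add_mem ?_ (lie_mem_of_span hN ?_ hc)
    · rw [← lie_skew]
      have : Submodule.span ℂ {f i} ≤ N := by
        rw [Submodule.span_singleton_le_iff_mem]; exact hfN i (by omega)
      exact N.neg_mem (this (hHf a ha i hi))
    · rintro _ ⟨k, hk, rfl⟩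
      rw [hN]
      exact hf.lie_mem i hi k hk
  have key : ∀ g < 24, (∀ z ∈ H, ⁅z, f g⁆ ∈ Submodule.span ℂ {f g}) ∧
      ∀ j < 4, ⁅e j, f g⁆ ∈ H ⊔ N := by
    intro g
    induction g using Nat.strong_induction_on with
    | _ g ih =>
      intro hg
      by_cases h4 : g < 4
      · exact ⟨fun z hz => hHf z hz g h4, fun j hj => Submodule.mem_sup_left (hef j hj g h4)⟩
      · obtain ⟨i, hi, k, hk, c, hc⟩ := hf.exists_word g (by omega) hg
        obtain ⟨ih1, ih2⟩ := ih k hk (by omega)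
        refine ⟨fun z hz => ?_, fun j hj => ?_⟩
        · obtain ⟨a, ha⟩ := Submodule.mem_span_singleton.1 (ih1 z hz)
          obtain ⟨d, hd⟩ := Submodule.mem_span_singleton.1 (hHf z hz i hi)
          refine Submodule.mem_span_singleton.2 ⟨a + d, ?_⟩
          rw [hc, lie_smul, leibniz_lie, ← ha, ← hd]
          simp only [smul_lie, lie_smul]
          module
        · rw [hc, lie_smul, leibniz_lie]
          refine Submodule.smul_mem _ _ (add_mem ?_ (Submodule.mem_sup_right (hfB i hi _ (ih2 j hj))))
          obtain ⟨a, ha⟩ := Submodule.mem_span_singleton.1 (ih1 _ (hef j hj i hi))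
          rw [← ha]
          exact Submodule.smul_mem _ _ (Submodule.mem_sup_right (hfN k (by omega)))
  exact (key g hg).2 j hj

theorem PosSystem.lie_span_mem {e f h : ℕ → L} {H N N' W : Submodule ℂ L} (he : PosSystem e)
    (hf : PosSystem f) (hH : H = Submodule.span ℂ (h '' Set.Iio 4))
    (hN : N = Submodule.span ℂ (f '' Set.Iio 24)) (hN' : N' = Submodule.span ℂ (e '' Set.Iio 24))
    (hW : W = H ⊔ N ⊔ N')
    (hef : ∀ i < 4, ∀ j < 4, ⁅e i, f j⁆ ∈ H)
    (hhf : ∀ i < 4, ∀ j < 4, ⁅h i, f j⁆ ∈ Submodule.span ℂ {f j})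
    (hhe : ∀ i < 4, ∀ j < 4, ⁅h i, e j⁆ ∈ Submodule.span ℂ {e j}) (j : ℕ) (hj : j < 4)
    {w : L} (hw : w ∈ W) : ⁅e j, w⁆ ∈ W := by
  rw [hW] at hw ⊢
  obtain ⟨y, hy, c, hc, rfl⟩ := Submodule.mem_sup.1 hw
  obtain ⟨a, ha, d, hd, rfl⟩ := Submodule.mem_sup.1 hy
  rw [lie_add, lie_add]
  refine add_mem (add_mem ?_ ?_) ?_
  · refine lie_mem_of_span hH ?_ ha
    rintro _ ⟨i, hi, rfl⟩
    rw [← lie_skew]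
    refine neg_mem (Submodule.mem_sup_right ?_)
    have : Submodule.span ℂ {e j} ≤ N' := by
      rw [Submodule.span_singleton_le_iff_mem, hN']
      exact Submodule.subset_span ⟨j, by simp only [Set.mem_Iio]; omega, rfl⟩
    exact this (hhe i hi j hj)
  · refine Submodule.mem_sup_left (lie_mem_of_span hN ?_ hd)
    rintro _ ⟨k, hk, rfl⟩
    exact hf.lie_opposite_mem hH hN hef hhf j hj k hk
  · refine Submodule.mem_sup_right (lie_mem_of_span hN' ?_ hc)
    rintro _ ⟨k, hk, rfl⟩
    rw [hN']
    exact he.lie_mem j hj k hk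

end Span

end F4

namespace F4

/-- The matrices of a Chevalley basis of `F₄` in a representation of dimension 27, where
`16 * n + a + 8` stands for the coefficient `a` of `elem n`. -/
def matTable : List (List ℕ) := [
    [9, 455, 2249, 2697, 3143, 3593, 4039, 4490, 4935, 6726, 7177, 7623, 8073, 8519, 8969, 9415,
    11209, 11655],
    [457, 903, 1353, 1801, 2247, 2695, 3593, 4487, 4938, 6729, 7174, 7623, 8521, 9417, 9863,
    10311, 10761, 11207],
    [905, 1351, 2697, 3591, 4041, 4935, 7177, 7625, 8071, 8519, 10313, 10759],
    [1353, 1799, 2249, 2695, 3145, 4039, 8073, 8521, 8967, 9415, 9865, 10311],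
    [25, 2281, 2745, 3641, 4521, 4537, 5433, 5865, 7193, 8089, 8985, 11225],
    [473, 1385, 1833, 3625, 4969, 4985, 5881, 6313, 6761, 8569, 9449, 10777],
    [921, 2729, 4073, 7209, 7657, 10329],
    [1369, 2265, 3177, 8105, 8553, 9881],
    [41, 1415, 1879, 3655, 3689, 4585, 4999, 5465, 6327, 8137, 9017, 10791],
    [489, 951, 1865, 2759, 4103, 4119, 5913, 6345, 6793, 7703, 9465, 10343],
    [937, 2295, 3207, 7241, 7689, 9895],
    [57, 985, 1911, 2793, 2823, 4137, 4617, 5497, 6359, 7271, 9033, 10361],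
    [519, 1895, 4153, 5049, 6839, 9479],
    [505, 967, 1431, 2329, 3241, 3257, 5945, 6377, 6825, 7719, 8599, 9913],
    [87, 553, 1929, 1945, 2857, 3753, 4167, 5063, 5543, 5975, 9047, 9497],
    [73, 1017, 1481, 2359, 2393, 3271, 4649, 5529, 6391, 7287, 8167, 9927],
    [537, 1463, 3289, 5079, 6857, 8615],
    [121, 1975, 2871, 3767, 4679, 9065],
    [105, 583, 1497, 1513, 2425, 3303, 3783, 5097, 5561, 5993, 8183, 8633],
    [567, 1031, 3319, 4215, 6871, 7751],
    [151, 1543, 2439, 3801, 4697, 8201],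
    [135, 617, 1065, 1081, 2455, 2919, 3337, 4233, 5575, 6007, 7319, 7769],
    [185, 1111, 2473, 2937, 4711, 7337],
    [169, 633, 663, 1127, 1591, 2055, 3383, 4263, 5143, 5593, 6455, 6905],
    [215, 231, 679, 1145, 1609, 2073, 2519, 2967, 3847, 4729, 6041, 6473],
    [265, 713, 1655, 2103, 3865, 5177],
    [295, 743, 1223, 2121, 3001, 4313],
    [329, 777, 1241, 1689, 2569, 3449],
    [441, 3113, 3993, 4889, 5353, 5785, 6681, 6697, 7609, 8505, 9401, 11641],
    [889, 2217, 2665, 4457, 5801, 6233, 7129, 7145, 7593, 9817, 10281, 11193],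
    [1337, 3561, 4905, 8041, 8489, 10745],
    [1785, 2681, 4009, 8937, 9385, 10297],
    [871, 3081, 3961, 5321, 6183, 6665, 7079, 7543, 7577, 9799, 10263, 11625],
    [1319, 2201, 3527, 4425, 5769, 6201, 7991, 8007, 8455, 9785, 10711, 11177],
    [1767, 3545, 4873, 8903, 9351, 10729],
    [1305, 3065, 4823, 5289, 6151, 6633, 7945, 8409, 8439, 9767, 10697, 11609],
    [2183, 4391, 7065, 7961, 9751, 11143],
    [1753, 2631, 3511, 4409, 5737, 6169, 8857, 8873, 9321, 10215, 10679, 11161],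
    [2169, 3047, 5255, 5687, 7015, 7497, 7911, 8393, 9705, 9721, 11129, 11575],
    [1735, 3927, 4807, 5273, 6135, 6601, 8807, 9271, 9305, 10201, 10665, 11593],
    [2615, 4377, 7031, 8825, 10183, 11113],
    [3033, 6551, 7447, 8343, 9671, 11561],
    [2601, 3911, 5241, 5673, 7001, 7463, 8775, 9257, 10137, 10153, 11095, 11545],
    [3479, 4359, 7895, 8791, 10615, 11079],
    [3897, 6537, 7433, 9207, 10103, 11527],
    [3465, 4775, 5223, 5655, 7865, 8327, 8745, 9223, 10569, 10585, 11065, 11511],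
    [4761, 6519, 8297, 9177, 10535, 11497],
    [4329, 5209, 6071, 6951, 7831, 8711, 9623, 10087, 10551, 11001, 11031, 11481],
    [5625, 6057, 6505, 7383, 8263, 9143, 9593, 10041, 10505, 10967, 11447, 11463],
    [6921, 7369, 9559, 10007, 10937, 11417],
    [7785, 8233, 9545, 10439, 10903, 11383],
    [8649, 9097, 9977, 10425, 10889, 11353]]

/-- Coordinate functionals for `matTable`, encoded like `matTable`. -/
def dualTable : List (List ℕ) := [
    [9],
    [9, 457],
    [9, 457, 905],
    [905, 1353],
    [25],
    [473],
    [921],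
    [1369],
    [41],
    [489],
    [937],
    [57],
    [519],
    [505],
    [87],
    [73],
    [537],
    [121],
    [105],
    [567],
    [151],
    [135],
    [185],
    [169],
    [215],
    [265],
    [295],
    [329],
    [441],
    [889],
    [1337],
    [1785],
    [871],
    [1319],
    [1767],
    [1305],
    [2183],
    [1753],
    [2169],
    [1735],
    [2615],
    [3033],
    [2601],
    [3479],
    [3897],
    [3465],
    [4761],
    [4329],
    [5625],
    [6921],
    [7785],
    [8649]]

/-- The structure constants of a Chevalley basis of `F₄`: indices `0, …, 3` are the simple coroots,
`4, …, 27` the positive and `28, …, 51` the negative root vectors. The number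
`1024 * j + 16 * k + a + 8` in row `i` means that the bracket of `i` and `j` has coefficient `a` at `k`. -/
def scTable : List (List ℕ) := [
    [4170, 5207, 8329, 9367, 11449, 12486, 13527, 15609, 16646, 17690, 19766, 20810, 22890, 23927,
    24969, 29126, 30169, 33287, 34329, 36407, 37450, 38489, 40567, 41610, 42646, 44730, 45766,
    47846, 48889, 49927],
    [4167, 5210, 6246, 8329, 10406, 11447, 12490, 14569, 15607, 16650, 18729, 21847, 22886, 23929,
    26010, 29129, 30166, 31210, 33287, 35370, 36409, 37446, 39527, 40569, 41606, 43687, 46809,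
    47850, 48887, 50966],
    [5207, 6250, 7287, 8327, 9369, 10409, 11449, 16647, 18727, 19769, 20807, 21849, 22889, 26007,
    27049, 30169, 31206, 32249, 33289, 34327, 35367, 36407, 41609, 43689, 44727, 45769, 46807,
    47847, 50969, 52007],
    [6247, 7290, 9367, 10409, 11447, 12487, 13529, 14567, 15609, 16649, 17687, 18729, 20809,
    27047, 28089, 31209, 32246, 34329, 35367, 36409, 37449, 38487, 39529, 40567, 41607, 42649,
    43687, 45767, 52009, 53047],
    [70, 1097, 5257, 9401, 12521, 13561, 14618, 16681, 18762, 19801, 21866, 23945, 28681, 33241,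
    36377, 39498, 40537, 42601, 43658, 45737, 46778, 47833, 49913],
    [89, 1110, 2137, 4231, 6297, 9418, 10457, 11497, 13574, 15655, 21881, 22921, 24986, 29721,
    33223, 34282, 37401, 38442, 39481, 41559, 43639, 48857, 49898, 50953],
    [1130, 2150, 3177, 5271, 7337, 8375, 16697, 18777, 20841, 26025, 30761, 34263, 35321, 36359,
    44681, 46761, 47817, 51993],
    [2169, 3190, 6311, 9431, 11511, 12553, 14633, 17737, 27065, 31801, 35303, 38423, 40503, 41545,
    43625, 45721, 53033],
    [135, 1159, 2185, 6329, 9449, 10489, 11546, 13607, 15686, 19831, 21895, 23958, 28759, 29769,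
    32775, 32791, 36326, 39447, 40486, 42551, 43609, 45689, 48826, 49881, 50937],
    [153, 2199, 3225, 4279, 5318, 7385, 8423, 13626, 15705, 18809, 20873, 24998, 29798, 30809,
    33815, 33830, 36297, 37337, 38390, 39433, 44631, 46711, 48807, 49862, 51977],
    [1194, 2215, 3239, 5335, 8439, 12601, 14681, 17769, 26039, 30839, 31849, 34855, 34871, 38361,
    40457, 44615, 46695, 47767, 53017],
    [183, 1209, 2231, 3257, 5351, 7417, 8470, 13657, 15722, 16759, 18823, 23978, 28823, 30857,
    32874, 33863, 35849, 35865, 35882, 39383, 40442, 42503, 46681, 47737, 48774, 49831, 51961],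
    [202, 1222, 3273, 4327, 7431, 10551, 15737, 20889, 22953, 29847, 33879, 36889, 36905, 39367,
    41463, 44583, 48761, 50889, 51945],
    [217, 3287, 4343, 5386, 8489, 9526, 11607, 14713, 17801, 25018, 29862, 31897, 33914, 34903,
    37913, 37930, 37946, 40391, 41433, 43529, 44567, 46647, 48745, 49818, 53001],
    [1255, 3305, 4374, 7463, 10583, 13687, 15753, 18838, 21926, 28870, 29879, 32921, 33927, 35929,
    36937, 38919, 38934, 38950, 42441, 43514, 46634, 48729, 49783, 50857, 51929],
    [247, 1273, 3319, 5417, 8522, 9559, 11622, 12663, 14727, 23990, 28887, 31929, 32938, 34951,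
    35958, 37961, 39943, 39959, 39974, 39990, 43479, 45575, 46617, 47673, 48714, 49769, 52985],
    [266, 1286, 2313, 3335, 4391, 6455, 11641, 17815, 22969, 29913, 31943, 36985, 37975, 40983,
    40999, 41015, 43465, 44521, 48695, 50841, 52967],
    [278, 3353, 7495, 10599, 13703, 16793, 19881, 28903, 32953, 35977, 38983, 41993, 42009, 42025,
    45559, 47655, 49751, 50825, 51897],
    [1319, 2345, 3367, 4422, 6487, 9591, 11657, 14746, 21942, 28934, 29945, 31975, 32983, 38023,
    39030, 40025, 41031, 43017, 43034, 43050, 43066, 45511, 46566, 48663, 49721, 50793, 52951],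
    [314, 2359, 4439, 8569, 17831, 20919, 30983, 34009, 35017, 37033, 38041, 41063, 44057, 44074,
    44089, 46535, 48649, 51863, 52935],
    [326, 2377, 3399, 6503, 9607, 12695, 19897, 28967, 32023, 33015, 40073, 42105, 43081, 45063,
    45079, 45095, 45111, 47593, 49689, 50761, 52919],
    [1369, 2391, 4454, 5495, 8585, 14762, 18874, 28982, 31015, 34041, 35049, 36055, 38073, 39078,
    40087, 43114, 44105, 46087, 46102, 46116, 46134, 47561, 48601, 49671, 51815, 52903],
    [358, 1386, 2407, 5511, 12711, 16823, 29015, 31047, 35097, 36087, 40119, 42153, 45159, 46151,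
    47113, 47129, 47146, 47161, 49623, 51783, 52871],
    [377, 1399, 4487, 8602, 11686, 15802, 30039, 33078, 34089, 36106, 37111, 38119, 39127, 40134,
    41145, 43161, 44167, 46167, 48137, 48155, 48172, 48186, 49607, 50697, 51767, 52857],
    [391, 5526, 9642, 13750, 29047, 30054, 33111, 34122, 36137, 38166, 39161, 40167, 42201, 43191,
    45207, 46217, 47193, 48201, 49158, 49173, 49188, 49206, 50649, 51735, 52825],
    [1430, 2457, 6567, 10681, 30087, 33143, 37191, 39207, 41239, 42247, 43239, 45255, 48263,
    49239, 50185, 50202, 50218, 50233, 51687, 52777],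
    [2471, 3497, 7607, 31127, 34183, 36215, 37223, 39255, 42295, 44313, 46313, 47305, 48313,
    49305, 50281, 51207, 51222, 51237, 51255, 52729],
    [3511, 32167, 35223, 38279, 40311, 41321, 43353, 44361, 45369, 46377, 47369, 48375, 49367,
    50343, 51319, 52233, 52250, 52267, 52282],
    [458, 1479, 4103, 8281, 11417, 14538, 15577, 17641, 18698, 20777, 21818, 22873, 24953, 30217,
    34361, 37481, 38521, 39578, 41641, 43722, 44761, 46826, 48905],
    [471, 1498, 2519, 5143, 8263, 9322, 12441, 13482, 14521, 16599, 18679, 23897, 24938, 25993,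
    29191, 31257, 34378, 35417, 36457, 38534, 40615, 46841, 47881, 49946],
    [1510, 2538, 3559, 6183, 9303, 10361, 11399, 19721, 21801, 22857, 27033, 30231, 32297, 33335,
    41657, 43737, 45801, 50985],
    [2551, 3578, 7223, 10343, 13463, 15543, 16585, 18665, 20761, 28073, 31271, 34391, 36471,
    37513, 39593, 42697, 52025],
    [521, 1545, 2567, 4567, 5577, 8201, 8217, 11366, 14487, 15526, 17591, 18649, 20729, 23866,
    24921, 25977, 31289, 34409, 35449, 36506, 38567, 40646, 44791, 46855, 48918],
    [535, 2585, 3607, 5606, 6617, 9241, 9258, 11337, 12377, 13430, 14473, 19671, 21751, 23847,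
    24902, 27017, 29239, 30278, 32345, 33383, 38586, 40665, 43769, 45833, 49958],
    [1574, 2601, 3625, 6647, 7657, 10281, 10297, 13401, 15497, 19655, 21735, 22807, 28057, 30295,
    33399, 37561, 39641, 42729, 50999],
    [569, 1591, 2617, 3639, 4631, 6665, 8682, 9671, 11271, 11287, 11302, 14423, 15482, 17543,
    21721, 22777, 23814, 24871, 27001, 30311, 32377, 33430, 38617, 40682, 41719, 43783, 48938],
    [582, 1610, 3655, 5655, 9687, 12311, 12327, 14407, 16503, 19623, 23801, 25929, 26985, 29287,
    32391, 35511, 40697, 45849, 47913],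
    [599, 3673, 5670, 7705, 9722, 10711, 13335, 13350, 13366, 15431, 16473, 18569, 19607, 21687,
    23785, 24858, 28041, 29303, 30346, 33449, 34486, 36567, 39673, 42761, 49978],
    [1641, 3687, 4678, 5687, 8729, 9735, 11737, 12745, 14345, 14362, 14378, 17481, 18554, 21674,
    23769, 24823, 25897, 26969, 29334, 32423, 35543, 38647, 40713, 43798, 46886],
    [633, 1655, 3705, 4695, 7737, 8746, 10759, 11766, 13769, 15369, 15385, 15402, 15418, 18519,
    20615, 21657, 22713, 23754, 24809, 28025, 30377, 33482, 34519, 36582, 37623, 39687, 48950],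
    [646, 1674, 2695, 3721, 5721, 7751, 12793, 13783, 16409, 16425, 16441, 18505, 19561, 23735,
    25881, 28007, 29351, 31415, 36601, 42775, 47929],
    [666, 3735, 4711, 8761, 11785, 14791, 17415, 17431, 17447, 20599, 22695, 24791, 25865, 26937,
    32455, 35559, 38663, 41753, 44841],
    [1705, 2727, 3753, 4742, 5753, 7783, 8791, 13831, 14838, 15833, 16839, 18439, 18454, 18470,
    18486, 20551, 21606, 23703, 24761, 25833, 27991, 29382, 31447, 34551, 36617, 39706, 46902],
    [694, 2745, 6791, 9817, 10825, 12841, 13849, 16871, 19479, 19494, 19511, 21575, 23689, 26903,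
    27975, 29399, 33529, 42791, 45879],
    [714, 2759, 3785, 4775, 7831, 8823, 15881, 17913, 18889, 20489, 20505, 20521, 20537, 22633,
    24729, 25801, 27959, 31463, 34567, 37655, 44857],
    [1751, 2777, 4790, 6823, 9849, 10857, 11863, 13881, 14886, 15895, 18922, 19913, 21513, 21530,
    21548, 21562, 22601, 23641, 24711, 26855, 27943, 29414, 30455, 33545, 39722, 43834],
    [746, 1766, 2793, 4823, 6855, 10905, 11895, 15927, 17961, 20967, 21959, 22535, 22551, 22566,
    22583, 24663, 26823, 27911, 30471, 37671, 41783],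
    [759, 1785, 5847, 8886, 9897, 11914, 12919, 13927, 14935, 15942, 16953, 18969, 19975, 21975,
    23559, 23573, 23588, 23606, 24647, 25737, 26807, 27897, 29447, 33562, 36646, 40762],
    [777, 4855, 5862, 8919, 9930, 11945, 13974, 14969, 15975, 18009, 18999, 21015, 22025, 23001,
    24009, 24586, 24603, 24620, 24634, 25689, 26775, 27865, 30486, 34602, 38710],
    [1818, 2839, 5895, 8951, 12999, 15015, 17047, 18055, 19047, 21063, 24071, 25047, 25607, 25622,
    25638, 25655, 26727, 27817, 31527, 35641],
    [2857, 3879, 6935, 9991, 12023, 13031, 15063, 18103, 20121, 22121, 23113, 24121, 25113, 26089,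
    26633, 26650, 26667, 26681, 27769, 32567],
    [3897, 7975, 11031, 14087, 16119, 17129, 19161, 20169, 21177, 22185, 23177, 24183, 25175,
    26151, 27127, 27655, 27670, 27685, 27702]]

/-- Decoding of an entry of one of the tables. -/
def decode (n : ℕ) : ℕ × ℤ := (n / 16, (n % 16 : ℕ) - 8)

/-- The matrix of the `i`-th basis vector. -/
def mat (i : ℕ) : Comb := (matTable.getD i []).map decode

/-- The functional dual to the `i`-th basis vector. -/
def dual (i : ℕ) : Comb := (dualTable.getD i []).map decode

/-- The bracket of two basis vectors. -/
def sc (i j : ℕ) : Comb :=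
  (scTable.getD i []).foldr
    (fun n l => cond ((n / 1024).beq j) (decode (n % 1024) :: l) l) []

theorem mat_eq_nil {i : ℕ} (hi : 52 ≤ i) : mat i = [] := by
  have : matTable.length = 52 := by decide +kernel
  simp [mat, List.getElem?_eq_none (this.trans_le hi)]

theorem sc_eq_nil_left {i : ℕ} (hi : 52 ≤ i) (j : ℕ) : sc i j = [] := by
  have : scTable.length = 52 := by decide +kernel
  simp [sc, List.getElem?_eq_none (this.trans_le hi)]

theorem sc_eq_nil_right (i : ℕ) {j : ℕ} (hj : 52 ≤ j) : sc i j = [] := by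
  have h : ∀ l ∈ scTable, ∀ n ∈ l, n / 1024 < 52 := by decide +kernel
  have aux : ∀ l : List ℕ, (∀ n ∈ l, n / 1024 < 52) → l.foldr
      (fun n l => cond ((n / 1024).beq j) (decode (n % 1024) :: l) l) [] = [] := by
    intro l hl
    induction l with
    | nil => rfl
    | cons n l ih =>
      have hn : (n / 1024).beq j = false := by
        have := hl n (by simp)
        rw [← Bool.not_eq_true, Nat.beq_eq]
        omega
      rw [List.foldr_cons, hn, cond_false, ih fun m hm => hl m (by simp [hm])]
  refine aux _ ?_
  by_cases hi : i < scTable.length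
  · rw [List.getD_eq_getElem _ _ hi]
    exact h _ (List.getElem_mem hi)
  · rw [List.getD_eq_default _ _ (not_lt.1 hi)]
    simp

/-- Quadruples `(k, a, b, p)` such that the bracket of `a` and `b` is `p` times `k`. -/
def wordTable : List (ℕ × ℕ × ℕ × ℕ) := [
   (8, 4, 5, 1), (9, 5, 6, 1), (10, 6, 7, 1), (11, 4, 9, 1), (12, 5, 9, 2), (13, 5, 10, 1),
   (14, 4, 12, 1), (15, 4, 13, 1), (16, 7, 12, 1), (17, 4, 14, 2), (18, 4, 16, 1),
   (19, 6, 16, 1), (20, 7, 17, 1), (21, 4, 19, 1), (22, 6, 20, 1), (23, 5, 21, 1),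
   (24, 4, 23, 1), (25, 5, 24, 2), (26, 6, 25, 1), (27, 7, 26, 1), (32, 28, 29, 1),
   (33, 29, 30, 1), (34, 30, 31, 1), (35, 28, 33, 1), (36, 29, 33, 2), (37, 29, 34, 1),
   (38, 28, 36, 1), (39, 28, 37, 1), (40, 31, 36, 1), (41, 28, 38, 2), (42, 28, 40, 1),
   (43, 30, 40, 1), (44, 31, 41, 1), (45, 28, 43, 1), (46, 30, 44, 1), (47, 29, 45, 1),
   (48, 28, 47, 1), (49, 29, 48, 2), (50, 30, 49, 1), (51, 31, 50, 1), (0, 4, 28, 1),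
   (1, 5, 29, 1), (2, 6, 30, 1), (3, 7, 31, 1)]

theorem mat_lie_check : ([4, 5, 6, 7, 28, 29, 30, 31].all fun i => (List.range 52).all fun j =>
    Comb.eqv (Comb.lie elemLie (mat i) (mat j))
      ((sc i j).flatMap fun p => Comb.smul p.2 (mat p.1))) = true := by
  decide +kernel

theorem word_check : (wordTable.all fun w => (List.range 52).all fun j =>
    Comb.eqv (sc w.2.1 w.2.2.1) [(w.1, w.2.2.2)] &&
    Comb.eqv (Comb.smul w.2.2.2 (sc w.1 j)) (Comb.lie sc [(w.2.1, 1)] (sc w.2.2.1 j) ++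
      Comb.lie sc [(w.2.2.1, -1)] (sc w.2.1 j))) = true := by
  decide +kernel

theorem dual_check : ((List.range 52).all fun i => (List.range 52).all fun j =>
    decide ((dual i).foldr (fun p a => p.2 * Comb.coeff (mat j) p.1 + a) 0 =
      cond (i.beq j) 1 0)) = true := by
  decide +kernel

end F4

namespace F4

/-- The endomorphisms of `ℕ →₀ ℂ` given by the matrices `mat i`. -/
noncomputable def rep (i : ℕ) : Gl := ev elem (mat i)

theorem ev_singleton {M : Type*} [AddCommGroup M] (x : ℕ → M) (k : ℕ) (a : ℤ) :
    ev x [(k, a)] = a • x k := by simp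

theorem ev_flatMap {M : Type*} [AddCommGroup M] (x : ℕ → M) (m : ℕ → Comb) (l : Comb) :
    ev x (l.flatMap fun p => Comb.smul p.2 (m p.1)) = ev (fun i => ev x (m i)) l := by
  induction l with
  | nil => rfl
  | cons p l ih => rw [List.flatMap_cons, ev_append, ev_smul, ih, ev_cons]

theorem lie_ev {L : Type*} [LieRing L] {x : ℕ → L} {br : ℕ → ℕ → Comb} {i : ℕ}
    (h : ∀ j, ⁅x i, x j⁆ = ev x (br i j)) (a : ℤ) (m : Comb) :
    ⁅a • x i, ev x m⁆ = ev x (Comb.lie br [(i, a)] m) := by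
  have : Comb.lie br [(i, a)] m = m.flatMap fun q => Comb.smul (a * q.2) (br i q.1) := by
    simp [Comb.lie]
  rw [this]
  induction m with
  | nil => simp
  | cons q m ih =>
    rw [List.flatMap_cons, ev_append, ev_smul, ← ih (by simp [Comb.lie]), ev_cons, lie_add, ← h,
      mul_smul, zsmul_lie, zsmul_lie, lie_zsmul]

/-- The symbols that can be reached from `g` by means of the words in a list. -/
def reach : List (ℕ × ℕ × ℕ × ℕ) → List ℕ → List ℕ
  | [], g => g
  | w :: l, g => reach l (if w.2.1 ∈ g ∧ w.2.2.1 ∈ g ∧ w.2.2.2 ≠ 0 then w.1 :: g else g)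

theorem of_mem_reach {P : ℕ → Prop} (l : List (ℕ × ℕ × ℕ × ℕ)) (g : List ℕ)
    (hl : ∀ w ∈ l, P w.2.1 → P w.2.2.1 → w.2.2.2 ≠ 0 → P w.1) (hg : ∀ i ∈ g, P i) :
    ∀ i ∈ reach l g, P i := by
  induction l generalizing g with
  | nil => exact hg
  | cons w l ih =>
    refine ih _ (fun w hw => hl w (by simp [hw])) ?_
    split_ifs with h
    · intro i hi
      rcases List.mem_cons.1 hi with rfl | hi
      · exact hl w (by simp) (hg _ h.1) (hg _ h.2.1) h.2.2
      · exact hg i hi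
    · exact hg

theorem lie_eq_sc_of_generators {L : Type*} [LieRing L] [LieAlgebra ℂ L] {x : ℕ → L}
    (h : ∀ i ∈ [4, 5, 6, 7, 28, 29, 30, 31], ∀ j < 52, ⁅x i, x j⁆ = ev x (sc i j))
    (hx : ∀ i, 52 ≤ i → x i = 0) (i j : ℕ) : ⁅x i, x j⁆ = ev x (sc i j) := by
  let P : ℕ → Prop := fun i => ∀ j, ⁅x i, x j⁆ = ev x (sc i j)
  have hgen : ∀ i ∈ [4, 5, 6, 7, 28, 29, 30, 31], P i := by
    intro i hi j
    by_cases hj : j < 52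
    · exact h i hi j hj
    · rw [hx j (by omega), lie_zero, sc_eq_nil_right i (by omega), ev_nil]
  have hword : ∀ w ∈ wordTable, P w.2.1 → P w.2.2.1 → w.2.2.2 ≠ 0 → P w.1 := by
    intro w hw ha hb hp j
    by_cases hj : j < 52
    · have hc := word_check
      simp only [List.all_eq_true, List.mem_range, Bool.and_eq_true] at hc
      obtain ⟨h1, h2⟩ := hc w hw j hj
      have h1 := ev_eq_of_eqv x h1
      have h2 := ev_eq_of_eqv x h2
      rw [← ha, ev_singleton] at h1
      rw [ev_smul, ev_append, ← lie_ev ha, ← lie_ev hb, one_smul, neg_smul, one_smul, neg_lie,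
        ← ha, ← hb, ← sub_eq_add_neg, ← lie_lie, h1, zsmul_lie, ← sub_eq_zero, ← smul_sub] at h2
      rw [← Int.cast_smul_eq_zsmul ℂ] at h2
      rcases smul_eq_zero.1 h2 with h3 | h3
      · exact absurd h3 (by exact_mod_cast hp)
      · exact (sub_eq_zero.1 h3).symm
    · rw [hx j (by omega), lie_zero, sc_eq_nil_right _ (by omega), ev_nil]
  by_cases hi : i < 52
  · have hmem : ∀ i < 52, i ∈ reach wordTable [4, 5, 6, 7, 28, 29, 30, 31] := by decide +kernel
    exact of_mem_reach wordTable _ hword hgen i (hmem i hi) j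
  · rw [hx i (by omega), zero_lie, sc_eq_nil_left (by omega), ev_nil]

theorem rep_eq_zero {i : ℕ} (hi : 52 ≤ i) : rep i = 0 := by
  rw [rep, mat_eq_nil hi, ev_nil]

theorem rep_lie (i j : ℕ) : ⁅rep i, rep j⁆ = ev rep (sc i j) := by
  refine lie_eq_sc_of_generators (fun i hi j hj => ?_) (fun i hi => rep_eq_zero hi) i j
  have hc := mat_lie_check
  simp only [List.all_eq_true, List.mem_range] at hc
  rw [rep, rep, ev_lie elem_lie, ev_eq_of_eqv elem (hc i hi j hj), ev_flatMap]
  rfl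

/-- The functional dual to `rep i`. -/
noncomputable def coord (l : Comb) : Module.Dual ℂ Gl :=
  (l.map fun p => p.2 • entry p.1).sum

theorem coord_rep (l : Comb) (j : ℕ) : coord l (rep j) =
    ((l.foldr (fun p a => p.2 * Comb.coeff (mat j) p.1 + a) 0 : ℤ) : ℂ) := by
  rw [coord]
  induction l with
  | nil => simp
  | cons p l ih =>
    rw [List.map_cons, List.sum_cons, LinearMap.add_apply, ih, List.foldr_cons]
    push_cast
    rw [LinearMap.smul_apply, rep, entry_ev, zsmul_eq_mul]

theorem coord_dual_rep {i j : ℕ} (hi : i < 52) (hj : j < 52) :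
    coord (dual i) (rep j) = if i = j then 1 else 0 := by
  have hc := dual_check
  rw [List.all_eq_true] at hc
  have hc := hc i (List.mem_range.2 hi)
  rw [List.all_eq_true] at hc
  have hc := of_decide_eq_true (hc j (List.mem_range.2 hj))
  rw [coord_rep, hc]
  rcases hb : i.beq j with _ | _
  · rw [if_neg (Nat.ne_of_beq_eq_false hb)]; exact Int.cast_zero
  · rw [if_pos (Nat.eq_of_beq_eq_true hb)]; exact Int.cast_one

theorem linearIndependent_rep : LinearIndependent ℂ (fun i : Fin 52 => rep i) := by
  refine LinearIndependent.of_pairwise_dual_eq_zero_one _ (fun i : Fin 52 => coord (dual i))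
    ?_ ?_
  · intro i j hij
    exact (coord_dual_rep i.2 j.2).trans (if_neg fun h => hij (Fin.ext h))
  · intro i
    exact (coord_dual_rep i.2 i.2).trans (if_pos rfl)

/-- A sequence whose first `52` terms form a Chevalley basis of type `F₄`. -/
structure IsF4Basis {L : Type*} [LieRing L] [LieAlgebra ℂ L] (b : ℕ → L) : Prop where
  lie : ∀ i j, ⁅b i, b j⁆ = ev b (sc i j)
  eq_zero : ∀ i, 52 ≤ i → b i = 0
  linearIndependent : LinearIndependent ℂ (fun i : Fin 52 => b i)
  span_eq_top : Submodule.span ℂ (Set.range fun i : Fin 52 => b i) = ⊤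

theorem isF4Basis_of_hom {L : Type*} [LieRing L] [LieAlgebra ℂ L] {b : ℕ → L}
    (ρ : L →ₗ⁅ℂ⁆ Gl) (hρ : ∀ i < 52, ρ (b i) = rep i)
    (hb : ∀ i, 52 ≤ i → b i = 0)
    (hspan : Submodule.span ℂ (Set.range fun i : Fin 52 => b i) = ⊤) : IsF4Basis b := by
  have hρ' : ∀ i, ρ (b i) = rep i := by
    intro i
    by_cases hi : i < 52
    · exact hρ i hi
    · rw [hb i (by omega), rep_eq_zero (by omega), map_zero]
  have hinj : Function.Injective ρ := by
    rw [injective_iff_map_eq_zero]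
    intro x hx
    have hmem : x ∈ Submodule.span ℂ (Set.range fun i : Fin 52 => b i) := hspan ▸ trivial
    obtain ⟨c, rfl⟩ := (Submodule.mem_span_range_iff_exists_fun ℂ).1 hmem
    have h0 : ∑ i : Fin 52, c i • rep i = 0 := by
      rw [← hx, map_sum]
      exact Finset.sum_congr rfl fun i _ => by rw [map_smul, hρ']
    have := Fintype.linearIndependent_iff.1 linearIndependent_rep c h0
    exact Finset.sum_eq_zero fun i _ => by rw [this i, zero_smul]
  refine ⟨fun i j => hinj ?_, hb, ?_, hspan⟩
  · rw [LieHom.map_lie, hρ', hρ', rep_lie, map_ev]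
    simp only [hρ']
  · refine LinearIndependent.of_comp (ρ : L →ₗ[ℂ] Gl) ?_
    have : (ρ : L →ₗ[ℂ] Gl) ∘ (fun i : Fin 52 => b i) =
        fun i : Fin 52 => rep i := by
      funext i
      exact hρ' i
    rw [this]
    exact linearIndependent_rep

end F4

namespace F4

section PosWord

variable {L : Type*} [LieRing L] [LieAlgebra ℂ L]

/-- The root vectors of a positive system, as words in the generators. -/
noncomputable def posWord (x : ℕ → L) (n : ℕ) : L :=
  let b4 := ⁅x 0, x 1⁆
  let b5 := ⁅x 1, x 2⁆
  let b6 := ⁅x 2, x 3⁆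
  let b7 := ⁅x 0, b5⁆
  let b8 := (2⁻¹ : ℂ) • ⁅x 1, b5⁆
  let b9 := ⁅x 1, b6⁆
  let b10 := ⁅x 0, b8⁆
  let b11 := ⁅x 0, b9⁆
  let b12 := ⁅x 3, b8⁆
  let b13 := (2⁻¹ : ℂ) • ⁅x 0, b10⁆
  let b14 := ⁅x 0, b12⁆
  let b15 := ⁅x 2, b12⁆
  let b16 := ⁅x 3, b13⁆
  let b17 := ⁅x 0, b15⁆
  let b18 := ⁅x 2, b16⁆
  let b19 := ⁅x 1, b17⁆
  let b20 := ⁅x 0, b19⁆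
  let b21 := (2⁻¹ : ℂ) • ⁅x 1, b20⁆
  let b22 := ⁅x 2, b21⁆
  let b23 := ⁅x 3, b22⁆
  [x 0, x 1, x 2, x 3, b4, b5, b6, b7, b8, b9, b10, b11, b12, b13,
    b14, b15, b16, b17, b18, b19, b20, b21, b22, b23].getD n 0

theorem map_posWord {L' : Type*} [LieRing L'] [LieAlgebra ℂ L'] (ρ : L →ₗ⁅ℂ⁆ L') (x : ℕ → L)
    (n : ℕ) (hn : n < 24) : ρ (posWord x n) = posWord (fun i => ρ (x i)) n := by
  interval_cases n <;>
    simp only [posWord, List.getD_cons_zero, List.getD_cons_succ, LieHom.map_lie, map_smul]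

theorem posWord_eq_zero (x : ℕ → L) (n : ℕ) (hn : 24 ≤ n) : posWord x n = 0 :=
  List.getD_eq_default _ _ hn

theorem PosSystem.eq_posWord {b : ℕ → L} (hb : PosSystem b) (n : ℕ) (hn : n < 24) :
    b n = posWord b n := by
  have h4 := hb.h0_1.trans (one_smul ℂ _)
  have h5 := hb.h1_2.trans (one_smul ℂ _)
  have h6 := hb.h2_3.trans (one_smul ℂ _)
  have h7 := hb.h0_5.trans (one_smul ℂ _)
  have h8 : (2⁻¹ : ℂ) • ⁅b 1, b 5⁆ = b 8 := by
    rw [hb.h1_5, smul_smul, inv_mul_cancel₀ two_ne_zero, one_smul]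
  have h9 := hb.h1_6.trans (one_smul ℂ _)
  have h10 := hb.h0_8.trans (one_smul ℂ _)
  have h11 := hb.h0_9.trans (one_smul ℂ _)
  have h12 := hb.h3_8.trans (one_smul ℂ _)
  have h13 : (2⁻¹ : ℂ) • ⁅b 0, b 10⁆ = b 13 := by
    rw [hb.h0_10, smul_smul, inv_mul_cancel₀ two_ne_zero, one_smul]
  have h14 := hb.h0_12.trans (one_smul ℂ _)
  have h15 := hb.h2_12.trans (one_smul ℂ _)
  have h16 := hb.h3_13.trans (one_smul ℂ _)
  have h17 := hb.h0_15.trans (one_smul ℂ _)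
  have h18 := hb.h2_16.trans (one_smul ℂ _)
  have h19 := hb.h1_17.trans (one_smul ℂ _)
  have h20 := hb.h0_19.trans (one_smul ℂ _)
  have h21 : (2⁻¹ : ℂ) • ⁅b 1, b 20⁆ = b 21 := by
    rw [hb.h1_20, smul_smul, inv_mul_cancel₀ two_ne_zero, one_smul]
  have h22 := hb.h2_21.trans (one_smul ℂ _)
  have h23 := hb.h3_22.trans (one_smul ℂ _)
  interval_cases n <;>
    simp only [posWord, List.getD_cons_zero, List.getD_cons_succ, h4, h5, h6, h7, h8, h9, h10, h11, h12, h13,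
      h14, h15, h16, h17, h18, h19, h20, h21, h22, h23]

theorem posSystem_posWord {x : ℕ → L} (s01 : ⁅x 0, ⁅x 0, x 1⁆⁆ = 0)
    (s02 : ⁅x 0, x 2⁆ = 0)
    (s03 : ⁅x 0, x 3⁆ = 0)
    (s10 : ⁅x 1, ⁅x 1, x 0⁆⁆ = 0)
    (s12 : ⁅x 1, ⁅x 1, ⁅x 1, x 2⁆⁆⁆ = 0)
    (s13 : ⁅x 1, x 3⁆ = 0)
    (s21 : ⁅x 2, ⁅x 2, x 1⁆⁆ = 0)
    (s23 : ⁅x 2, ⁅x 2, x 3⁆⁆ = 0)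
    (s32 : ⁅x 3, ⁅x 3, x 2⁆⁆ = 0) : PosSystem (posWord x) := by
  constructor
  case s01 => exact s01
  case s02 => exact s02
  case s03 => exact s03
  case s10 => exact s10
  case s12 => exact s12
  case s13 => exact s13
  case s21 => exact s21
  case s23 => exact s23
  case s32 => exact s32
  case h1_5 => exact (smul_inv_smul₀ two_ne_zero _).symm
  case h0_10 => exact (smul_inv_smul₀ two_ne_zero _).symm
  case h1_20 => exact (smul_inv_smul₀ two_ne_zero _).symm
  all_goals exact (one_smul ℂ _).symm

theorem lie_eq_smul {b : ℕ → L} (h : ∀ i j, ⁅b i, b j⁆ = ev b (sc i j)) {i j : ℕ} (k : ℕ) (n : ℤ)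
    (hc : Comb.eqv (sc i j) [(k, n)] = true) : ⁅b i, b j⁆ = (n : ℂ) • b k := by
  rw [h, ev_eq_of_eqv b hc, ev_singleton, Int.cast_smul_eq_zsmul]

omit [LieAlgebra ℂ L] in
theorem lie_eq_zero {b : ℕ → L} (h : ∀ i j, ⁅b i, b j⁆ = ev b (sc i j)) {i j : ℕ}
    (hc : Comb.isZero (sc i j) = true) : ⁅b i, b j⁆ = 0 := by
  rw [h, ev_eq_zero_of_isZero b hc]

theorem posSystem_of_lie {b : ℕ → L} (h : ∀ i j, ⁅b i, b j⁆ = ev b (sc i j)) :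
    PosSystem (fun k => b (4 + k)) := by
  have key : ∀ {i j : ℕ} (k : ℕ) (n : ℤ), Comb.eqv (sc i j) [(k, n)] = true →
      ⁅b i, b j⁆ = (n : ℂ) • b k := lie_eq_smul h
  have key0 : ∀ {i j : ℕ}, Comb.isZero (sc i j) = true → ⁅b i, b j⁆ = 0 := lie_eq_zero h
  constructor
  case s01 =>
    simp only [Nat.reduceAdd]
    rw [key (i := 4) (j := 5) 8 (1) (by decide +kernel), lie_smul, key0 (i := 4) (j := 8) (by decide +kernel), smul_zero]
  case s02 => exact key0 (i := 4) (j := 6) (by decide +kernel)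
  case s03 => exact key0 (i := 4) (j := 7) (by decide +kernel)
  case s10 =>
    simp only [Nat.reduceAdd]
    rw [key (i := 5) (j := 4) 8 (-1) (by decide +kernel), lie_smul, key0 (i := 5) (j := 8) (by decide +kernel), smul_zero]
  case s12 =>
    simp only [Nat.reduceAdd]
    rw [key (i := 5) (j := 6) 9 (1) (by decide +kernel), lie_smul, key (i := 5) (j := 9) 12 2 (by decide +kernel), lie_smul, lie_smul, key0 (i := 5) (j := 12) (by decide +kernel), smul_zero, smul_zero]
  case s13 => exact key0 (i := 5) (j := 7) (by decide +kernel)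
  case s21 =>
    simp only [Nat.reduceAdd]
    rw [key (i := 6) (j := 5) 9 (-1) (by decide +kernel), lie_smul, key0 (i := 6) (j := 9) (by decide +kernel), smul_zero]
  case s23 =>
    simp only [Nat.reduceAdd]
    rw [key (i := 6) (j := 7) 10 (1) (by decide +kernel), lie_smul, key0 (i := 6) (j := 10) (by decide +kernel), smul_zero]
  case s32 =>
    simp only [Nat.reduceAdd]
    rw [key (i := 7) (j := 6) 10 (-1) (by decide +kernel), lie_smul, key0 (i := 7) (j := 10) (by decide +kernel), smul_zero]
  case h0_1 => simpa using key (i := 4) (j := 5) 8 1 (by decide +kernel)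
  case h1_2 => simpa using key (i := 5) (j := 6) 9 1 (by decide +kernel)
  case h2_3 => simpa using key (i := 6) (j := 7) 10 1 (by decide +kernel)
  case h0_5 => simpa using key (i := 4) (j := 9) 11 1 (by decide +kernel)
  case h1_5 => simpa using key (i := 5) (j := 9) 12 2 (by decide +kernel)
  case h1_6 => simpa using key (i := 5) (j := 10) 13 1 (by decide +kernel)
  case h0_8 => simpa using key (i := 4) (j := 12) 14 1 (by decide +kernel)
  case h0_9 => simpa using key (i := 4) (j := 13) 15 1 (by decide +kernel)
  case h3_8 => simpa using key (i := 7) (j := 12) 16 1 (by decide +kernel)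
  case h0_10 => simpa using key (i := 4) (j := 14) 17 2 (by decide +kernel)
  case h0_12 => simpa using key (i := 4) (j := 16) 18 1 (by decide +kernel)
  case h2_12 => simpa using key (i := 6) (j := 16) 19 1 (by decide +kernel)
  case h3_13 => simpa using key (i := 7) (j := 17) 20 1 (by decide +kernel)
  case h0_15 => simpa using key (i := 4) (j := 19) 21 1 (by decide +kernel)
  case h2_16 => simpa using key (i := 6) (j := 20) 22 1 (by decide +kernel)
  case h1_17 => simpa using key (i := 5) (j := 21) 23 1 (by decide +kernel)
  case h0_19 => simpa using key (i := 4) (j := 23) 24 1 (by decide +kernel)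
  case h1_20 => simpa using key (i := 5) (j := 24) 25 2 (by decide +kernel)
  case h2_21 => simpa using key (i := 6) (j := 25) 26 1 (by decide +kernel)
  case h3_22 => simpa using key (i := 7) (j := 26) 27 1 (by decide +kernel)

theorem negSystem_of_lie {b : ℕ → L} (h : ∀ i j, ⁅b i, b j⁆ = ev b (sc i j)) :
    PosSystem (fun k => b (28 + k)) := by
  have key : ∀ {i j : ℕ} (k : ℕ) (n : ℤ), Comb.eqv (sc i j) [(k, n)] = true →
      ⁅b i, b j⁆ = (n : ℂ) • b k := lie_eq_smul h
  have key0 : ∀ {i j : ℕ}, Comb.isZero (sc i j) = true → ⁅b i, b j⁆ = 0 := lie_eq_zero h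
  constructor
  case s01 =>
    simp only [Nat.reduceAdd]
    rw [key (i := 28) (j := 29) 32 (1) (by decide +kernel), lie_smul, key0 (i := 28) (j := 32) (by decide +kernel), smul_zero]
  case s02 => exact key0 (i := 28) (j := 30) (by decide +kernel)
  case s03 => exact key0 (i := 28) (j := 31) (by decide +kernel)
  case s10 =>
    simp only [Nat.reduceAdd]
    rw [key (i := 29) (j := 28) 32 (-1) (by decide +kernel), lie_smul, key0 (i := 29) (j := 32) (by decide +kernel), smul_zero]
  case s12 =>
    simp only [Nat.reduceAdd]
    rw [key (i := 29) (j := 30) 33 (1) (by decide +kernel), lie_smul, key (i := 29) (j := 33) 36 2 (by decide +kernel), lie_smul, lie_smul, key0 (i := 29) (j := 36) (by decide +kernel), smul_zero, smul_zero]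
  case s13 => exact key0 (i := 29) (j := 31) (by decide +kernel)
  case s21 =>
    simp only [Nat.reduceAdd]
    rw [key (i := 30) (j := 29) 33 (-1) (by decide +kernel), lie_smul, key0 (i := 30) (j := 33) (by decide +kernel), smul_zero]
  case s23 =>
    simp only [Nat.reduceAdd]
    rw [key (i := 30) (j := 31) 34 (1) (by decide +kernel), lie_smul, key0 (i := 30) (j := 34) (by decide +kernel), smul_zero]
  case s32 =>
    simp only [Nat.reduceAdd]
    rw [key (i := 31) (j := 30) 34 (-1) (by decide +kernel), lie_smul, key0 (i := 31) (j := 34) (by decide +kernel), smul_zero]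
  case h0_1 => simpa using key (i := 28) (j := 29) 32 1 (by decide +kernel)
  case h1_2 => simpa using key (i := 29) (j := 30) 33 1 (by decide +kernel)
  case h2_3 => simpa using key (i := 30) (j := 31) 34 1 (by decide +kernel)
  case h0_5 => simpa using key (i := 28) (j := 33) 35 1 (by decide +kernel)
  case h1_5 => simpa using key (i := 29) (j := 33) 36 2 (by decide +kernel)
  case h1_6 => simpa using key (i := 29) (j := 34) 37 1 (by decide +kernel)
  case h0_8 => simpa using key (i := 28) (j := 36) 38 1 (by decide +kernel)
  case h0_9 => simpa using key (i := 28) (j := 37) 39 1 (by decide +kernel)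
  case h3_8 => simpa using key (i := 31) (j := 36) 40 1 (by decide +kernel)
  case h0_10 => simpa using key (i := 28) (j := 38) 41 2 (by decide +kernel)
  case h0_12 => simpa using key (i := 28) (j := 40) 42 1 (by decide +kernel)
  case h2_12 => simpa using key (i := 30) (j := 40) 43 1 (by decide +kernel)
  case h3_13 => simpa using key (i := 31) (j := 41) 44 1 (by decide +kernel)
  case h0_15 => simpa using key (i := 28) (j := 43) 45 1 (by decide +kernel)
  case h2_16 => simpa using key (i := 30) (j := 44) 46 1 (by decide +kernel)
  case h1_17 => simpa using key (i := 29) (j := 45) 47 1 (by decide +kernel)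
  case h0_19 => simpa using key (i := 28) (j := 47) 48 1 (by decide +kernel)
  case h1_20 => simpa using key (i := 29) (j := 48) 49 2 (by decide +kernel)
  case h2_21 => simpa using key (i := 30) (j := 49) 50 1 (by decide +kernel)
  case h3_22 => simpa using key (i := 31) (j := 50) 51 1 (by decide +kernel)

end PosWord

end F4

namespace F4

open CartanMatrix Relations

/-- The quotient map from the free Lie algebra to the Lie algebra of type `F₄`. -/
noncomputable def toF4 : FreeLieAlgebra ℂ (Generators (Fin 4)) →ₗ⁅ℂ⁆ LieAlgebra.f₄ ℂ where
  toFun := LieSubmodule.Quotient.mk (N := toIdeal ℂ CartanMatrix.F₄)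
  map_add' _ _ := rfl
  map_smul' _ _ := rfl
  map_lie' := rfl

theorem toF4_surjective : Function.Surjective toF4 := Quot.mk_surjective

theorem toF4_eq_zero {x : FreeLieAlgebra ℂ (Generators (Fin 4))}
    (hx : x ∈ toSet ℂ CartanMatrix.F₄) : toF4 x = 0 :=
  LieSubmodule.Quotient.mk_eq_zero'.2 (LieSubmodule.subset_lieSpan hx)

/-- A Lie algebra homomorphism on the Lie algebra of type `F₄` given on generators. -/
theorem exists_hom {L : Type*} [LieRing L] [LieAlgebra ℂ L] (x : Generators (Fin 4) → L)
    (h : ∀ r ∈ toSet ℂ CartanMatrix.F₄, FreeLieAlgebra.lift ℂ x r = 0) :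
    ∃ ρ : LieAlgebra.f₄ ℂ →ₗ⁅ℂ⁆ L, ∀ g, ρ (toF4 (FreeLieAlgebra.of ℂ g)) = x g := by
  have hle : toIdeal ℂ CartanMatrix.F₄ ≤ (FreeLieAlgebra.lift ℂ x).ker := by
    rw [toIdeal, LieSubmodule.lieSpan_le]
    exact fun r hr => LieHom.mem_ker.2 (h r hr)
  let φ : LieAlgebra.f₄ ℂ →ₗ[ℂ] L := Submodule.liftQ (toIdeal ℂ CartanMatrix.F₄).toSubmodule
    (FreeLieAlgebra.lift ℂ x : FreeLieAlgebra ℂ _ →ₗ[ℂ] L) fun r hr =>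
      LinearMap.mem_ker.2 (LieHom.mem_ker.1 (hle hr))
  have hφ : ∀ y, φ (toF4 y) = FreeLieAlgebra.lift ℂ x y := fun y => rfl
  refine ⟨{ φ with map_lie' := ?_ }, fun g => ?_⟩
  · intro y z
    obtain ⟨y, rfl⟩ := toF4_surjective y
    obtain ⟨z, rfl⟩ := toF4_surjective z
    change φ ⁅toF4 y, toF4 z⁆ = ⁅φ (toF4 y), φ (toF4 z)⁆
    rw [← LieHom.map_lie, hφ, hφ, hφ, LieHom.map_lie]
  · exact (hφ _).trans (FreeLieAlgebra.lift_of_apply _ _)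

theorem generators_induction {W : LieSubalgebra ℂ (LieAlgebra.f₄ ℂ)}
    (h : ∀ g, toF4 (FreeLieAlgebra.of ℂ g) ∈ W) : W = ⊤ := by
  rw [eq_top_iff]
  intro y _
  obtain ⟨y, rfl⟩ := toF4_surjective y
  let F := FreeLieAlgebra.lift ℂ fun g => (⟨_, h g⟩ : W)
  have : W.incl.comp F = toF4 := by
    refine FreeLieAlgebra.hom_ext fun g => ?_
    rw [LieHom.comp_apply, FreeLieAlgebra.lift_of_apply]
    rfl
  rw [← this]
  exact (F y).2

/-- The generators `H i`. -/
noncomputable def genH (i : ℕ) : LieAlgebra.f₄ ℂ :=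
  if h : i < 4 then toF4 (FreeLieAlgebra.of ℂ (.H ⟨i, h⟩)) else 0

/-- The generators `E i`. -/
noncomputable def genE (i : ℕ) : LieAlgebra.f₄ ℂ :=
  if h : i < 4 then toF4 (FreeLieAlgebra.of ℂ (.E ⟨i, h⟩)) else 0

/-- The generators `F i`. -/
noncomputable def genF (i : ℕ) : LieAlgebra.f₄ ℂ :=
  if h : i < 4 then toF4 (FreeLieAlgebra.of ℂ (.F ⟨i, h⟩)) else 0

theorem genH_fin (i : Fin 4) : toF4 (FreeLieAlgebra.of ℂ (.H i)) = genH i := by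
  rw [genH, dif_pos i.2]

theorem genE_fin (i : Fin 4) : toF4 (FreeLieAlgebra.of ℂ (.E i)) = genE i := by
  rw [genE, dif_pos i.2]

theorem genF_fin (i : Fin 4) : toF4 (FreeLieAlgebra.of ℂ (.F i)) = genF i := by
  rw [genF, dif_pos i.2]

theorem genE_lie_genF (i j : Fin 4) :
    ⁅genE i, genF j⁆ = if i = j then genH i else 0 := by
  have h : toF4 (EF ℂ (i, j)) = 0 := toF4_eq_zero (by simp [toSet])
  simp only [EF, Function.uncurry_apply_pair, Function.comp_apply] at h
  split_ifs at h ⊢ with hij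
  · rw [map_sub, LieHom.map_lie, genE_fin, genF_fin, genH_fin, sub_eq_zero, hij] at h
    rw [hij, h]
  · rw [LieHom.map_lie, genE_fin, genF_fin] at h
    exact h

theorem genH_lie_genE (i j : Fin 4) : ⁅genH i, genE j⁆ = CartanMatrix.F₄ i j • genE j := by
  have h : toF4 (HE ℂ CartanMatrix.F₄ (i, j)) = 0 := toF4_eq_zero (by simp [toSet])
  simp only [HE, Function.uncurry_apply_pair, Function.comp_apply] at h
  rwa [map_sub, LieHom.map_lie, map_zsmul, genH_fin, genE_fin, sub_eq_zero] at h

theorem genH_lie_genF (i j : Fin 4) : ⁅genH i, genF j⁆ = (-CartanMatrix.F₄ i j) • genF j := by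
  have h : toF4 (HF ℂ CartanMatrix.F₄ (i, j)) = 0 := toF4_eq_zero (by simp [toSet])
  simp only [HF, Function.uncurry_apply_pair, Function.comp_apply] at h
  rwa [map_add, LieHom.map_lie, map_zsmul, genH_fin, genF_fin, add_eq_zero_iff_eq_neg,
    ← neg_smul] at h

theorem map_ad_pow {L L' : Type*} [LieRing L] [LieAlgebra ℂ L] [LieRing L'] [LieAlgebra ℂ L']
    (φ : L →ₗ⁅ℂ⁆ L') (x y : L) (n : ℕ) :
    φ ((LieAlgebra.ad ℂ L x ^ n) y) = (LieAlgebra.ad ℂ L' (φ x) ^ n) (φ y) := by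
  induction n with
  | zero => rfl
  | succ n ih => rw [pow_succ', pow_succ', Module.End.mul_apply, Module.End.mul_apply,
      LieAlgebra.ad_apply, LieAlgebra.ad_apply, LieHom.map_lie, ih]

theorem ad_genE_pow (i j : Fin 4) :
    (LieAlgebra.ad ℂ _ (genE i) ^ (-CartanMatrix.F₄ i j).toNat) ⁅genE i, genE j⁆ = 0 := by
  have h : toF4 (adE ℂ CartanMatrix.F₄ (i, j)) = 0 := toF4_eq_zero (by simp [toSet])
  simp only [adE, Function.uncurry_apply_pair, Function.comp_apply] at h
  rwa [map_ad_pow, LieHom.map_lie, genE_fin, genE_fin] at h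

theorem ad_genF_pow (i j : Fin 4) :
    (LieAlgebra.ad ℂ _ (genF i) ^ (-CartanMatrix.F₄ i j).toNat) ⁅genF i, genF j⁆ = 0 := by
  have h : toF4 (adF ℂ CartanMatrix.F₄ (i, j)) = 0 := toF4_eq_zero (by simp [toSet])
  simp only [adF, Function.uncurry_apply_pair, Function.comp_apply] at h
  rwa [map_ad_pow, LieHom.map_lie, genF_fin, genF_fin] at h

theorem posSystem_of_ad_pow {L : Type*} [LieRing L] [LieAlgebra ℂ L] {x : ℕ → L}
    (h : ∀ i j : Fin 4,
      (LieAlgebra.ad ℂ _ (x i) ^ (-CartanMatrix.F₄ i j).toNat) ⁅x i, x j⁆ = 0) :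
    PosSystem (posWord x) := by
  refine posSystem_posWord ?_ ?_ ?_ ?_ ?_ ?_ ?_ ?_ ?_
  · simpa [CartanMatrix.F₄] using h 0 1
  · simpa [CartanMatrix.F₄] using h 0 2
  · simpa [CartanMatrix.F₄] using h 0 3
  · simpa [CartanMatrix.F₄] using h 1 0
  · simpa [CartanMatrix.F₄, pow_succ] using h 1 2
  · simpa [CartanMatrix.F₄] using h 1 3
  · simpa [CartanMatrix.F₄] using h 2 1
  · simpa [CartanMatrix.F₄] using h 2 3
  · simpa [CartanMatrix.F₄] using h 3 2

/-- The standard basis of the Lie algebra of type `F₄`. -/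
noncomputable def basis (n : ℕ) : LieAlgebra.f₄ ℂ :=
  if n < 4 then genH n else if n < 28 then posWord genE (n - 4) else posWord genF (n - 28)

theorem span_basis : Submodule.span ℂ (Set.range fun i : Fin 52 => basis i) = ⊤ := by
  have he := posSystem_of_ad_pow ad_genE_pow
  have hf := posSystem_of_ad_pow ad_genF_pow
  have hx : ∀ x : ℕ → LieAlgebra.f₄ ℂ, ∀ i < 4, posWord x i = x i := by
    intro x i hi
    interval_cases i <;> rfl
  set H := Submodule.span ℂ (genH '' Set.Iio 4) with hH
  set N := Submodule.span ℂ (posWord genF '' Set.Iio 24) with hN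
  set N' := Submodule.span ℂ (posWord genE '' Set.Iio 24) with hN'
  have hef : ∀ i < 4, ∀ j < 4, ⁅posWord genE i, posWord genF j⁆ ∈ H := by
    intro i hi j hj
    rw [hx _ i hi, hx _ j hj, genE_lie_genF ⟨i, hi⟩ ⟨j, hj⟩]
    split_ifs
    · exact Submodule.subset_span ⟨i, hi, rfl⟩
    · exact H.zero_mem
  have hhe : ∀ i < 4, ∀ j < 4, ⁅genH i, posWord genE j⁆ ∈ Submodule.span ℂ {posWord genE j} := by
    intro i hi j hj
    rw [hx _ j hj, genH_lie_genE ⟨i, hi⟩ ⟨j, hj⟩]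
    exact zsmul_mem (Submodule.mem_span_singleton_self _) _
  have hhf : ∀ i < 4, ∀ j < 4, ⁅genH i, posWord genF j⁆ ∈ Submodule.span ℂ {posWord genF j} := by
    intro i hi j hj
    rw [hx _ j hj, genH_lie_genF ⟨i, hi⟩ ⟨j, hj⟩]
    exact zsmul_mem (Submodule.mem_span_singleton_self _) _
  have hE : ∀ i : Fin 4, ∀ w ∈ H ⊔ N ⊔ N', ⁅genE i, w⁆ ∈ H ⊔ N ⊔ N' := by
    intro i w hw
    rw [← hx genE i i.2]
    exact he.lie_span_mem hf hH hN hN' rfl hef hhf hhe i i.2 hw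
  have hF : ∀ i : Fin 4, ∀ w ∈ H ⊔ N ⊔ N', ⁅genF i, w⁆ ∈ H ⊔ N ⊔ N' := by
    intro i w hw
    rw [← hx genF i i.2]
    have hc : H ⊔ N ⊔ N' = H ⊔ N' ⊔ N := sup_right_comm _ _ _
    rw [hc] at hw ⊢
    refine hf.lie_span_mem he hH hN' hN rfl (fun i hi j hj => ?_) hhe hhf i i.2 hw
    rw [← lie_skew]
    exact H.neg_mem (hef j hj i hi)
  let W : LieSubalgebra ℂ (LieAlgebra.f₄ ℂ) :=
    { carrier := {x | ∀ w ∈ H ⊔ N ⊔ N', ⁅x, w⁆ ∈ H ⊔ N ⊔ N'}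
      add_mem' := fun ha hb w hw => by rw [add_lie]; exact add_mem (ha w hw) (hb w hw)
      zero_mem' := fun w _ => by rw [zero_lie]; exact zero_mem _
      smul_mem' := fun c x hx w hw => by rw [smul_lie]; exact Submodule.smul_mem _ _ (hx w hw)
      lie_mem' := fun ha hb w hw => by
        rw [lie_lie]; exact sub_mem (ha _ (hb w hw)) (hb _ (ha w hw)) }
  have hHmem : ∀ i : Fin 4, genH i ∈ W := by
    intro i
    have := genE_lie_genF i i
    rw [if_pos rfl] at this
    rw [← this]
    exact W.lie_mem (hE i) (hF i)
  have hW : W = ⊤ := generators_induction fun g => by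
    cases g with
    | H i => rw [genH_fin]; exact hHmem i
    | E i => rw [genE_fin]; exact hE i
    | F i => rw [genF_fin]; exact hF i
  let W' : LieSubalgebra ℂ (LieAlgebra.f₄ ℂ) :=
    { H ⊔ N ⊔ N' with
      lie_mem' := fun {a b} _ hb => by
        have : a ∈ W := by rw [hW]; trivial
        exact this b hb }
  have hW' : W' = ⊤ := generators_induction fun g => by
    cases g with
    | H i =>
      rw [genH_fin]
      exact Submodule.mem_sup_left (Submodule.mem_sup_left (Submodule.subset_span ⟨i, i.2, rfl⟩))
    | E i =>
      rw [genE_fin, ← hx genE i i.2]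
      exact Submodule.mem_sup_right (Submodule.subset_span
        ⟨i, by have := i.2; simp only [Set.mem_Iio]; omega, rfl⟩)
    | F i =>
      rw [genF_fin, ← hx genF i i.2]
      exact Submodule.mem_sup_left (Submodule.mem_sup_right (Submodule.subset_span
        ⟨i, by have := i.2; simp only [Set.mem_Iio]; omega, rfl⟩))
  have htop : H ⊔ N ⊔ N' = ⊤ := by
    rw [eq_top_iff]
    intro y _
    have : y ∈ W' := by rw [hW']; trivial
    exact this
  rw [eq_top_iff, ← htop]
  refine sup_le (sup_le ?_ ?_) ?_
  · rw [hH, Submodule.span_le]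
    rintro _ ⟨i, hi, rfl⟩
    have hi : i < 4 := hi
    exact Submodule.subset_span ⟨⟨i, by omega⟩, if_pos hi⟩
  · rw [hN, Submodule.span_le]
    rintro _ ⟨i, hi, rfl⟩
    have hi : i < 24 := hi
    refine Submodule.subset_span ⟨⟨28 + i, by omega⟩, ?_⟩
    simp only [basis]
    rw [if_neg (by omega), if_neg (by omega), Nat.add_sub_cancel_left]
  · rw [hN', Submodule.span_le]
    rintro _ ⟨i, hi, rfl⟩
    have hi : i < 24 := hi
    refine Submodule.subset_span ⟨⟨4 + i, by omega⟩, ?_⟩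
    have h1 : 4 + i < 28 := by omega
    simp [basis, h1]

theorem rep_ad_pow : ∀ i j : Fin 4, ∀ s ∈ [4, 28],
    (LieAlgebra.ad ℂ Gl (rep (s + i)) ^ (-CartanMatrix.F₄ i j).toNat)
      ⁅rep (s + i), rep (s + j)⁆ = 0 := by
  have key : ∀ x n (l : Comb), (LieAlgebra.ad ℂ Gl (rep x) ^ n) (ev rep l) =
      ev rep ((Comb.lie sc [(x, 1)])^[n] l) := by
    intro x n l
    induction n with
    | zero => rfl
    | succ n ih =>
      rw [pow_succ', Module.End.mul_apply, ih, LieAlgebra.ad_apply, Function.iterate_succ_apply',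
        ← ev_lie rep_lie, ev_singleton, one_smul]
  have hc : ∀ i j : Fin 4, ∀ s ∈ [4, 28], Comb.isZero
      ((Comb.lie sc [(s + i, 1)])^[(-CartanMatrix.F₄ i j).toNat] (sc (s + i) (s + j))) = true := by
    decide +kernel
  intro i j s hs
  rw [rep_lie, key, ev_eq_zero_of_isZero _ (hc i j s hs)]

theorem isF4Basis_basis : IsF4Basis basis := by
  have hEF : ∀ i j : Fin 4, Comb.eqv (sc (4 + i) (28 + j)) (if i = j then [(i, 1)] else []) := by
    decide +kernel
  have hHE : ∀ i j : Fin 4, Comb.eqv (sc i (4 + j)) [(4 + j, CartanMatrix.F₄ i j)] := by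
    decide +kernel
  have hHF : ∀ i j : Fin 4, Comb.eqv (sc i (28 + j)) [(28 + j, -CartanMatrix.F₄ i j)] := by
    decide +kernel
  have hHH : ∀ i j : Fin 4, Comb.isZero (sc i j) := by
    decide +kernel
  obtain ⟨ρ, hρ⟩ := exists_hom (L := Gl) (fun g => match g with
      | .H i => rep i
      | .E i => rep (4 + i)
      | .F i => rep (28 + i)) (by
    rintro r (((((⟨⟨i, j⟩, rfl⟩ | ⟨⟨i, j⟩, rfl⟩) | ⟨⟨i, j⟩, rfl⟩) | ⟨⟨i, j⟩, rfl⟩) | ⟨⟨i, j⟩, rfl⟩) |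
      ⟨⟨i, j⟩, rfl⟩)
    · simp only [HH, Function.uncurry_apply_pair, Function.comp_apply, LieHom.map_lie,
        FreeLieAlgebra.lift_of_apply]
      rw [rep_lie, ev_eq_zero_of_isZero _ (hHH i j)]
    · simp only [EF, Function.uncurry_apply_pair, Function.comp_apply]
      have h := hEF i j
      split_ifs at h ⊢ with hij
      · simp only [map_sub, LieHom.map_lie, FreeLieAlgebra.lift_of_apply]
        subst hij
        rw [rep_lie, ev_eq_of_eqv _ h, ev_singleton, one_smul, sub_self]
      · simp only [LieHom.map_lie, FreeLieAlgebra.lift_of_apply]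
        rw [rep_lie, ev_eq_of_eqv _ h, ev_nil]
    · simp only [HE, Function.uncurry_apply_pair, Function.comp_apply, LieHom.map_lie,
        FreeLieAlgebra.lift_of_apply, map_sub, map_zsmul]
      rw [rep_lie, ev_eq_of_eqv _ (hHE i j), ev_singleton, sub_self]
    · simp only [HF, Function.uncurry_apply_pair, Function.comp_apply, LieHom.map_lie,
        FreeLieAlgebra.lift_of_apply, map_add, map_zsmul]
      rw [rep_lie, ev_eq_of_eqv _ (hHF i j), ev_singleton, neg_smul, neg_add_cancel]
    · simp only [adE, Function.uncurry_apply_pair, Function.comp_apply]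
      simp only [map_ad_pow, LieHom.map_lie, FreeLieAlgebra.lift_of_apply]
      exact rep_ad_pow i j 4 (by simp)
    · simp only [adF, Function.uncurry_apply_pair, Function.comp_apply]
      simp only [map_ad_pow, LieHom.map_lie, FreeLieAlgebra.lift_of_apply]
      exact rep_ad_pow i j 28 (by simp))
  have hpw : ∀ (x : ℕ → LieAlgebra.f₄ ℂ) (s : ℕ) (_ : ∀ i : Fin 4, ρ (x i) = rep (s + i))
      (_ : PosSystem fun k => rep (s + k)) (n : ℕ), n < 24 → ρ (posWord x n) = rep (s + n) := by
    intro x s hx hs n hn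
    rw [map_posWord ρ x n hn]
    refine Eq.trans ?_ (hs.eq_posWord n hn).symm
    have hx' : ∀ i < 4, ρ (x i) = rep (s + i) := fun i hi => hx ⟨i, hi⟩
    interval_cases n <;> simp only [posWord, hx' 0 (by norm_num), hx' 1 (by norm_num),
      hx' 2 (by norm_num), hx' 3 (by norm_num)]
  refine isF4Basis_of_hom ρ (fun i hi => ?_) (fun i hi => ?_) span_basis
  · by_cases h4 : i < 4
    · rw [basis, if_pos h4, genH, dif_pos h4, hρ]
    · by_cases h28 : i < 28
      · rw [basis, if_neg h4, if_pos h28, hpw genE 4 (fun i => by rw [← genE_fin, hρ])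
          (posSystem_of_lie rep_lie) (i - 4) (by omega)]
        congr 1; omega
      · rw [basis, if_neg h4, if_neg h28, hpw genF 28 (fun i => by rw [← genF_fin, hρ])
          (negSystem_of_lie rep_lie) (i - 28) (by omega)]
        congr 1; omega
  · rw [basis, if_neg (by omega), if_neg (by omega), posWord_eq_zero _ _ (by omega)]

end F4

namespace F4

section Trace

variable {V : Type*} [AddCommGroup V] [Module ℂ V]

theorem isNilpotent_commutator {A B : Module.End ℂ V} (hA : IsNilpotent A)
    (h : Commute A (A * B - B * A)) : IsNilpotent (A * B - B * A) := by
  set C := A * B - B * A with hC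
  let δ : Module.End ℂ (Module.End ℂ V) := LinearMap.mulLeft ℂ A - LinearMap.mulRight ℂ A
  have hδ : ∀ X, δ X = A * X - X * A := fun X => rfl
  have hδn : IsNilpotent δ := by
    have hc : Commute (LinearMap.mulLeft ℂ A) (LinearMap.mulRight ℂ A) :=
      LinearMap.commute_mulLeft_right A A
    refine hc.isNilpotent_sub ?_ ?_
    · rw [LinearMap.isNilpotent_mulLeft_iff]; exact hA
    · rw [LinearMap.isNilpotent_mulRight_iff]; exact hA
  have hCA : A * C = C * A := h
  have step : ∀ (n : ℕ) (X : Module.End ℂ V),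
      (δ ^ (n + 1)) (B * X) = B * (δ ^ (n + 1)) X + ((n : ℂ) + 1) • (C * (δ ^ n) X) := by
    intro n X
    induction n with
    | zero =>
      simp only [zero_add, pow_one, hδ, pow_zero, Module.End.one_apply, hC, Nat.cast_zero, one_smul]
      noncomm_ring
    | succ n ih =>
      rw [pow_succ' δ (n + 1), Module.End.mul_apply, ih, map_add, map_smul, Module.End.mul_apply]
      have h1 : δ (B * (δ ^ (n + 1)) X) = B * δ ((δ ^ (n + 1)) X) + C * (δ ^ (n + 1)) X := by
        rw [hδ, hδ, hC]; noncomm_ring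
      have h2 : δ (C * (δ ^ n) X) = C * (δ ^ (n + 1)) X := by
        rw [pow_succ', Module.End.mul_apply, hδ, hδ, ← mul_assoc, hCA]; noncomm_ring
      rw [h1, h2]
      push_cast
      module
  have main : ∀ m : ℕ, (δ ^ m) (B ^ m) = (m.factorial : ℂ) • C ^ m ∧ (δ ^ (m + 1)) (B ^ m) = 0 := by
    intro m
    induction m with
    | zero => simp [hδ]
    | succ m ih =>
      rw [pow_succ' B, step, step, ih.1, ih.2, pow_succ' δ (m + 1), Module.End.mul_apply, ih.2]
      refine ⟨?_, by simp⟩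
      rw [mul_zero, zero_add, Algebra.mul_smul_comm, smul_smul, ← pow_succ', Nat.factorial_succ]
      push_cast; rfl
  obtain ⟨n, hn⟩ := hδn
  refine ⟨n, ?_⟩
  have := (main n).1
  rw [hn, LinearMap.zero_apply, eq_comm, smul_eq_zero] at this
  exact this.resolve_left (Nat.cast_ne_zero.2 n.factorial_ne_zero)

theorem trace_mul_eq_zero [FiniteDimensional ℂ V] {A B : Module.End ℂ V} (hA : IsNilpotent A)
    (h : Commute A (A * B - B * A)) : LinearMap.trace ℂ V (A * B) = 0 := by
  have hCn := isNilpotent_commutator hA h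
  set C := A * B - B * A with hC
  have hcomm : ∀ k : ℕ, A ^ (k + 1) * B = B * A ^ (k + 1) + ((k : ℂ) + 1) • (C * A ^ k) := by
    intro k
    induction k with
    | zero => simp [hC]
    | succ k ih =>
      have h3 : A * (C * A ^ k) = C * A ^ (k + 1) := by rw [← mul_assoc, h.eq, mul_assoc, pow_succ']
      have h4 : A * (B * A ^ (k + 1)) = B * A ^ (k + 2) + C * A ^ (k + 1) := by
        rw [hC, pow_succ' A (k + 1)]; noncomm_ring
      rw [pow_succ' A (k + 1), mul_assoc, ih, mul_add, Algebra.mul_smul_comm, h3, h4,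
        ← pow_succ' A (k + 1)]
      push_cast
      module
  rw [Module.End.trace_eq_sum_roots_charpoly_of_splits (IsAlgClosed.splits _)]
  refine Multiset.sum_eq_zero fun μ hμ => ?_
  have hev : Module.End.HasEigenvalue (A * B) μ :=
    (Module.End.hasEigenvalue_iff_isRoot_charpoly _ _).2 (Polynomial.isRoot_of_mem_roots hμ)
  obtain ⟨v, hv⟩ := hev.exists_hasEigenvector
  by_contra hμ0
  obtain ⟨n, hn⟩ := hA
  have hex : ∃ k, (A ^ k) v = 0 := ⟨n, by rw [hn]; rfl⟩
  classical
  have hk := Nat.find_spec hex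
  obtain ⟨k, hk'⟩ : ∃ k, Nat.find hex = k + 1 := by
    refine Nat.exists_eq_succ_of_ne_zero fun h0 => hv.2 ?_
    simpa [h0] using hk
  have hmin : (A ^ k) v ≠ 0 := Nat.find_min hex (by omega)
  rw [hk'] at hk
  have h5 := congrArg (fun T : Module.End ℂ V => T v) (hcomm k)
  have h6 : (A ^ (k + 1) * B) v = μ • (A ^ k) v := by
    rw [pow_succ, mul_assoc, Module.End.mul_apply, hv.apply_eq_smul, map_smul]
  simp only [LinearMap.add_apply, LinearMap.smul_apply, Module.End.mul_apply B, hk, map_zero, h6,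
    zero_add, Module.End.mul_apply C] at h5
  have hk1 : (k : ℂ) + 1 ≠ 0 := by exact_mod_cast k.succ_ne_zero
  have h7 : C ((A ^ k) v) = (((k : ℂ) + 1)⁻¹ * μ) • (A ^ k) v := by
    rw [mul_smul, h5, smul_smul, inv_mul_cancel₀ hk1, one_smul]
  have h8 : Module.End.HasEigenvalue C (((k : ℂ) + 1)⁻¹ * μ) :=
    Module.End.hasEigenvalue_of_hasEigenvector ⟨Module.End.mem_eigenspace_iff.2 h7, hmin⟩
  have h9 := h8.isNilpotent_of_isNilpotent hCn
  rw [isNilpotent_iff_eq_zero] at h9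
  exact (mul_ne_zero (inv_ne_zero hk1) hμ0) h9

end Trace

section Projections

variable {V : Type*} [AddCommGroup V] [Module ℂ V]

theorem aeval_apply_mem {S : Module.End ℂ V} {W : Submodule ℂ V} (hW : ∀ x ∈ W, S x ∈ W)
    (p : Polynomial ℂ) {x : V} (hx : x ∈ W) : Polynomial.aeval S p x ∈ W := by
  induction p using Polynomial.induction_on' with
  | add p q hp hq => rw [map_add]; exact W.add_mem hp hq
  | monomial n a =>
    rw [Polynomial.aeval_monomial, Module.End.mul_apply, Module.algebraMap_end_apply]
    refine W.smul_mem _ ?_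
    induction n with
    | zero => exact hx
    | succ n ih => rw [pow_succ', Module.End.mul_apply]; exact hW _ ih

theorem aeval_apply_eq_smul {S : Module.End ℂ V} {x : V} {μ : ℂ} (hx : S x = μ • x)
    (p : Polynomial ℂ) : Polynomial.aeval S p x = p.eval μ • x := by
  rcases eq_or_ne x 0 with rfl | h
  · simp
  · exact Module.End.aeval_apply_of_hasEigenvector ⟨Module.End.mem_eigenspace_iff.2 hx, h⟩

theorem exists_eigenvalue_bound [FiniteDimensional ℂ V] (S : Module.End ℂ V) :
    ∃ N : ℕ, ∀ i : ℤ, N < i.natAbs → ∀ x, S x = (i : ℂ) • x → x = 0 := by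
  have hfin : {μ : ℂ | S.eigenspace μ ≠ ⊥}.Finite :=
    WellFoundedGT.finite_ne_bot_of_iSupIndep S.eigenspaces_iSupIndep
  have hfin' : {i : ℤ | S.eigenspace (i : ℂ) ≠ ⊥}.Finite :=
    hfin.preimage (f := fun i : ℤ => (i : ℂ)) Int.cast_injective.injOn
  obtain ⟨N, hN⟩ := (hfin'.image Int.natAbs).bddAbove
  refine ⟨N, fun i hi x hx => ?_⟩
  by_contra h0
  have : i.natAbs ≤ N := hN ⟨i, fun hb => h0 ?_, rfl⟩
  · omega
  · exact (Submodule.eq_bot_iff _).1 hb x (Module.End.mem_eigenspace_iff.2 hx)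

/-- Projections onto the eigenspaces of an endomorphism with integral eigenvalues. -/
theorem exists_proj [FiniteDimensional ℂ V] {S : Module.End ℂ V}
    (hS : ⨆ i : ℤ, S.eigenspace (i : ℂ) = ⊤) :
    ∃ (N : ℕ) (π : ℤ → Module.End ℂ V), (∀ i x, S (π i x) = (i : ℂ) • π i x) ∧
      (∀ (i j : ℤ) x, S x = (j : ℂ) • x → π i x = if j = i then x else 0) ∧
      (∀ x, ∑ i ∈ Finset.Icc (-(N : ℤ)) N, π i x = x) ∧
      (∀ W : Submodule ℂ V, (∀ x ∈ W, S x ∈ W) → ∀ i, ∀ x ∈ W, π i x ∈ W) ∧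
      (∀ i : ℤ, N < i.natAbs → ∀ x, S x = (i : ℂ) • x → x = 0) := by
  obtain ⟨N, hN⟩ := exists_eigenvalue_bound S
  let J : Finset ℤ := Finset.Icc (-(N : ℤ)) N
  have hJ : Set.InjOn (fun j : ℤ => (j : ℂ)) J := Int.cast_injective.injOn
  let π : ℤ → Module.End ℂ V := fun i =>
    Polynomial.aeval S (Lagrange.basis J (fun j : ℤ => (j : ℂ)) i)
  have h2 : ∀ (i j : ℤ) x, S x = (j : ℂ) • x → π i x = if j = i then x else 0 := by
    intro i j x hx
    by_cases hj : j ∈ J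
    · rw [aeval_apply_eq_smul hx]
      split_ifs with hji
      · subst hji
        rw [Lagrange.eval_basis_self hJ hj, one_smul]
      · rw [Lagrange.eval_basis_of_ne (v := fun j : ℤ => (j : ℂ)) (Ne.symm hji) hj, zero_smul]
    · have : x = 0 := hN j (by simp only [J, Finset.mem_Icc] at hj; omega) x hx
      simp [this]
  refine ⟨N, π, ?_, h2, ?_, ?_, hN⟩
  · intro i x
    have hx : x ∈ ⨆ i : ℤ, S.eigenspace (i : ℂ) := hS ▸ Submodule.mem_top
    induction hx using Submodule.iSup_induction' with
    | mem j x hx =>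
      rw [Module.End.mem_eigenspace_iff] at hx
      rw [h2 i j x hx]
      split_ifs with hji
      · rw [hx, hji]
      · simp
    | zero => simp
    | add x y _ _ hx hy => simp only [map_add, smul_add, hx, hy]
  · intro x
    have := Lagrange.sum_basis hJ ⟨0, by simp [J]⟩
    have h3 := congrArg (fun p => Polynomial.aeval S p x) this
    simpa only [map_sum, LinearMap.sum_apply, map_one, Module.End.one_apply] using h3
  · exact fun W hW i x hx => aeval_apply_mem hW _ hx

end Projections

end F4

namespace F4

open LieAlgebra

theorem killingForm_lie_left {L : Type*} [LieRing L] [LieAlgebra ℂ L] (x y z : L) :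
    killingForm ℂ L ⁅x, y⁆ z = -killingForm ℂ L y ⁅x, z⁆ := by
  rw [← lie_skew, map_neg, LinearMap.neg_apply, neg_inj]
  exact LieModule.traceForm_apply_lie_apply ℂ L L y x z

variable {L : Type*} [LieRing L] [LieAlgebra ℂ L] [FiniteDimensional ℂ L] [IsKilling ℂ L]

theorem mem_range_of_adjoint {T T' : Module.End ℂ L}
    (hT : ∀ x y, killingForm ℂ L (T x) y = killingForm ℂ L x (T' y)) {v : L}
    (hv : ∀ w, T' w = 0 → killingForm ℂ L v w = 0) : v ∈ LinearMap.range T := by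
  have hrefl : (killingForm ℂ L).IsRefl := (LieModule.traceForm_isSymm ℂ L L).isRefl
  rw [← LinearMap.BilinForm.orthogonal_orthogonal (IsKilling.killingForm_nondegenerate ℂ L) hrefl
    (LinearMap.range T), LinearMap.BilinForm.mem_orthogonal_iff]
  intro w hw
  rw [LinearMap.BilinForm.mem_orthogonal_iff] at hw
  refine hrefl _ _ (hv w ?_)
  refine (IsKilling.killingForm_nondegenerate ℂ L).2 _ fun x => ?_
  rw [← hT]
  exact hw _ ⟨x, rfl⟩

theorem exists_lie_lie_eq {e : L} (he : IsNilpotent (ad ℂ L e)) : ∃ x : L, ⁅e, ⁅e, x⁆⁆ = e := by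
  have h := mem_range_of_adjoint (T := ad ℂ L e * ad ℂ L e) (T' := ad ℂ L e * ad ℂ L e) (v := e)
    (fun x y => by
      simp only [Module.End.mul_apply, ad_apply, killingForm_lie_left, neg_neg])
    (fun w hw => by
      rw [killingForm_apply_apply]
      refine trace_mul_eq_zero he ?_
      have h1 : ∀ u v : L, ad ℂ L u * ad ℂ L v - ad ℂ L v * ad ℂ L u = ad ℂ L ⁅u, v⁆ :=
        fun u v => LinearMap.ext fun x => (lie_lie u v x).symm
      have h2 : ⁅e, ⁅e, w⁆⁆ = 0 := hw
      rw [h1]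
      refine sub_eq_zero.1 ?_
      rw [h1, h2, map_zero])
  obtain ⟨x, hx⟩ := h
  exact ⟨x, hx⟩

/-- The semisimple part of `ad h` is inner. -/
theorem exists_semisimple_part (h : L) :
    ∃ s : L, ∀ (μ : ℂ) (x : L), x ∈ (ad ℂ L h).maxGenEigenspace μ ↔ ⁅s, x⁆ = μ • x := by
  obtain ⟨N, -, S, hS₀, hN, hS, hSN⟩ := (ad ℂ L h).exists_isNilpotent_isSemisimple
  replace hS₀ : Commute (ad ℂ L h) S := Algebra.commute_of_mem_adjoin_self hS₀
  rw [eq_sub_of_add_eq hSN.symm] at hN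
  have aux {μ : ℂ} {y : L} (hy : y ∈ (ad ℂ L h).maxGenEigenspace μ) : S y = μ • y := by
    rw [Module.End.maxGenEigenspace_eq] at hy
    rw [Module.End.apply_eq_of_mem_of_comm_of_isFinitelySemisimple_of_isNil hy hS₀
      hS.isFinitelySemisimple hN]
  have hder (y z : L) (α β : ℂ) (hy : y ∈ (ad ℂ L h).maxGenEigenspace α)
      (hz : z ∈ (ad ℂ L h).maxGenEigenspace β) : S ⁅y, z⁆ = ⁅S y, z⁆ + ⁅y, S z⁆ := by
    have hyz : ⁅y, z⁆ ∈ (ad ℂ L h).maxGenEigenspace (α + β) :=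
      LieModule.lie_mem_maxGenEigenspace_toEnd hy hz
    rw [aux hy, aux hz, aux hyz, smul_lie, lie_smul, ← add_smul]
  have htop : ⨆ μ : ℂ, (ad ℂ L h).maxGenEigenspace μ = ⊤ :=
    Module.End.iSup_maxGenEigenspace_eq_top _
  replace hder (y z : L) : S ⁅y, z⁆ = ⁅S y, z⁆ + ⁅y, S z⁆ := by
    have hy : y ∈ ⨆ μ : ℂ, (ad ℂ L h).maxGenEigenspace μ := htop ▸ Submodule.mem_top
    have hz : z ∈ ⨆ μ : ℂ, (ad ℂ L h).maxGenEigenspace μ := htop ▸ Submodule.mem_top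
    induction hy using Submodule.iSup_induction' with
    | mem α y hy =>
      induction hz using Submodule.iSup_induction' with
      | mem β z hz => exact hder y z α β hy hz
      | zero => simp
      | add _ _ _ _ h h' => simp only [lie_add, map_add, h, h']; abel
    | zero => simp
    | add _ _ _ _ h h' => simp only [add_lie, map_add, h, h']; abel
  let D : LieDerivation ℂ L L :=
    { S with
      leibniz' := fun y z => by
        change S ⁅y, z⁆ = ⁅y, S z⁆ - ⁅z, S y⁆
        rw [hder, ← lie_skew (S y) z]; abel }
  obtain ⟨s, hs⟩ := LieDerivation.IsKilling.exists_eq_ad D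
  refine ⟨s, fun μ x => ?_⟩
  have hsx : ⁅s, x⁆ = D x := by rw [← hs, LieDerivation.ad_apply_apply]
  rw [hsx]
  refine ⟨aux, fun hx => ?_⟩
  change S x = μ • x at hx
  obtain ⟨k, hk⟩ := hN
  rw [Module.End.mem_maxGenEigenspace]
  have hc : Commute S (ad ℂ L h - S) := hS₀.symm.sub_right (Commute.refl S)
  have hpow : ∀ j : ℕ, ((ad ℂ L h - μ • 1) ^ j) x = ((ad ℂ L h - S) ^ j) x := by
    intro j
    induction j with
    | zero => rfl
    | succ j ih =>
      have h1 : S (((ad ℂ L h - S) ^ j) x) = μ • ((ad ℂ L h - S) ^ j) x := by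
        rw [← Module.End.mul_apply, (hc.pow_right j).eq, Module.End.mul_apply, hx, map_smul]
      rw [pow_succ', Module.End.mul_apply, ih, pow_succ' (ad ℂ L h - S), Module.End.mul_apply,
        LinearMap.sub_apply, LinearMap.sub_apply, h1]
      rfl
  exact ⟨k, by rw [hpow, hk, LinearMap.zero_apply]⟩

end F4

namespace F4

open LieAlgebra

section Raising

variable {V : Type*} [AddCommGroup V] [Module ℂ V] {A F H : Module.End ℂ V}

theorem pow_mul_lowering (hAF : A * F - F * A = H) (hHA : H * A - A * H = 2 * A) (i : ℕ) :
    A ^ (i + 1) * F = F * A ^ (i + 1) + ((i : ℂ) + 1) • (H * A ^ i)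
      - ((i : ℂ) * (i + 1)) • A ^ i := by
  induction i with
  | zero => simp [← hAF]
  | succ i ih =>
    have h1 : A * (F * A ^ (i + 1)) = F * A ^ (i + 2) + H * A ^ (i + 1) := by
      rw [← hAF, pow_succ' A (i + 1)]; noncomm_ring
    have h2 : A * (H * A ^ i) = H * A ^ (i + 1) - (2 : ℂ) • A ^ (i + 1) := by
      have h3 : A * H = H * A - 2 * A := by rw [← hHA]; abel
      rw [← mul_assoc, h3, pow_succ', sub_mul, mul_assoc, mul_assoc, two_smul, two_mul]
    rw [pow_succ' A (i + 1), mul_assoc, ih, mul_sub, mul_add, Algebra.mul_smul_comm,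
      Algebra.mul_smul_comm, h1, h2, ← pow_succ' A i, ← pow_succ' A (i + 1)]
    push_cast
    module

theorem eq_zero_of_mem_maxGenEigenspace (hA : IsNilpotent A) (hAF : A * F - F * A = H)
    (hHA : H * A - A * H = 2 * A) {μ : ℂ} (hμ : ∀ i : ℕ, μ ≠ i) {z : V} (hz : A z = 0)
    (hz' : z ∈ H.maxGenEigenspace μ) : z = 0 := by
  obtain ⟨N, hN⟩ := hA
  have main : ∀ k i : ℕ, i + k = N → ∀ z ∈ H.maxGenEigenspace μ, A z = 0 → (∃ w, z = (A ^ i) w) →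
      z = 0 := by
    intro k
    induction k with
    | zero =>
      rintro i rfl z - - ⟨w, rfl⟩
      rw [add_zero] at hN
      rw [hN, LinearMap.zero_apply]
    | succ k ih =>
      rintro i hi z hz hAz ⟨w, rfl⟩
      have h1 := congrArg (fun T : Module.End ℂ V => T w) (pow_mul_lowering hAF hHA i)
      have h2 : (A ^ (i + 1)) w = 0 := by rw [pow_succ', Module.End.mul_apply, hAz]
      simp only [Module.End.mul_apply, LinearMap.sub_apply, LinearMap.add_apply,
        LinearMap.smul_apply, h2, map_zero, zero_add] at h1
      have hi1 : (i : ℂ) + 1 ≠ 0 := by exact_mod_cast i.succ_ne_zero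
      have h3 : H ((A ^ i) w) - (i : ℂ) • (A ^ i) w =
          (A ^ (i + 1)) (((i : ℂ) + 1)⁻¹ • F w) := by
        rw [map_smul, h1, smul_sub, smul_smul, smul_smul, inv_mul_cancel₀ hi1, one_smul,
          mul_comm (i : ℂ), inv_mul_cancel_left₀ hi1]
      have h4 : H ((A ^ i) w) - (i : ℂ) • (A ^ i) w = 0 := by
        refine ih (i + 1) (by omega) _ ?_ ?_ ⟨_, h3⟩
        · exact Submodule.sub_mem _ (Module.End.mapsTo_maxGenEigenspace_of_comm rfl μ hz)
            (Submodule.smul_mem _ _ hz)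
        · have h5 := congrArg (fun T : Module.End ℂ V => T ((A ^ i) w)) hHA
          simp only [LinearMap.sub_apply, Module.End.mul_apply, hAz, map_zero, zero_sub] at h5
          rw [map_sub, map_smul, hAz, smul_zero, sub_zero, ← neg_eq_zero, h5]
      have h5 : (A ^ i) w ∈ H.maxGenEigenspace (i : ℂ) :=
        Module.End.eigenspace_le_maxGenEigenspace
          (Module.End.mem_eigenspace_iff.2 (sub_eq_zero.1 h4))
      exact Submodule.disjoint_def.1 (Module.End.disjoint_genEigenspace H (hμ i) ⊤ ⊤) _ hz h5
  exact main N 0 (by omega) z hz' hz ⟨z, rfl⟩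

theorem exists_int_eq_of_hasEigenvalue (hA : IsNilpotent A) (hAF : A * F - F * A = H)
    (hHA : H * A - A * H = 2 * A) {μ : ℂ} (hμ : H.HasEigenvalue μ) : ∃ i : ℤ, μ = i := by
  obtain ⟨v, hv⟩ := hμ.exists_hasEigenvector
  obtain ⟨n, hn⟩ := id hA
  have hex : ∃ k, (A ^ k) v = 0 := ⟨n, by rw [hn]; rfl⟩
  classical
  have hk := Nat.find_spec hex
  obtain ⟨k, hk'⟩ : ∃ k, Nat.find hex = k + 1 := by
    refine Nat.exists_eq_succ_of_ne_zero fun h0 => hv.2 ?_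
    simpa [h0] using hk
  have hmin : (A ^ k) v ≠ 0 := Nat.find_min hex (by omega)
  rw [hk'] at hk
  have heig : ∀ k : ℕ, H ((A ^ k) v) = (μ + 2 * k) • (A ^ k) v := by
    intro k
    induction k with
    | zero => simpa using hv.apply_eq_smul
    | succ k ih =>
      have h5 := congrArg (fun T : Module.End ℂ V => T ((A ^ k) v)) hHA
      simp only [LinearMap.sub_apply, Module.End.mul_apply, ih, map_smul, two_mul,
        LinearMap.add_apply] at h5
      rw [pow_succ', Module.End.mul_apply, eq_add_of_sub_eq h5]
      push_cast
      module
  by_contra hne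
  push Not at hne
  refine hmin (eq_zero_of_mem_maxGenEigenspace hA hAF hHA (μ := μ + 2 * k) (fun i hi => ?_) ?_ ?_)
  · refine hne (i - 2 * k) ?_
    push_cast
    rw [← hi]; ring
  · rw [← Module.End.mul_apply, ← pow_succ', hk]
  · exact Module.End.eigenspace_le_maxGenEigenspace (Module.End.mem_eigenspace_iff.2 (heig k))

end Raising

variable {L : Type*} [LieRing L] [LieAlgebra ℂ L] [FiniteDimensional ℂ L] [IsKilling ℂ L]

/-- Every nilpotent element has degree two for some even-type grading. -/
theorem exists_grading {e : L} (he : IsNilpotent (ad ℂ L e)) :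
    ∃ s : L, ⁅s, e⁆ = (2 : ℂ) • e ∧ ⨆ i : ℤ, (ad ℂ L s).eigenspace (i : ℂ) = ⊤ ∧
      (∀ (z : L) (n : ℤ), n < 0 → ⁅s, z⁆ = (n : ℂ) • z → ⁅e, z⁆ = 0 → z = 0) ∧
      (∀ (z : L) (n : ℤ), -1 ≤ n → ⁅s, z⁆ = ((n + 2 : ℤ) : ℂ) • z →
        ∃ y : L, ⁅s, y⁆ = (n : ℂ) • y ∧ ⁅e, y⁆ = z) := by
  obtain ⟨x, hx⟩ := exists_lie_lie_eq he
  set f : L := (-2 : ℂ) • x with hf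
  set h : L := ⁅e, f⁆ with hh
  have hhe : ⁅h, e⁆ = (2 : ℂ) • e := by
    rw [hh, hf, lie_smul, smul_lie, ← lie_skew, hx]; module
  obtain ⟨s, hs⟩ := exists_semisimple_part h
  have hAF : ad ℂ L e * ad ℂ L f - ad ℂ L f * ad ℂ L e = ad ℂ L h :=
    LinearMap.ext fun x => (lie_lie e f x).symm
  have hHA : ad ℂ L h * ad ℂ L e - ad ℂ L e * ad ℂ L h = 2 * ad ℂ L e := by
    have : ad ℂ L h * ad ℂ L e - ad ℂ L e * ad ℂ L h = ad ℂ L ⁅h, e⁆ :=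
      LinearMap.ext fun x => (lie_lie h e x).symm
    rw [this, hhe, map_smul, two_smul, two_mul]
  have hse : ⁅s, e⁆ = (2 : ℂ) • e := (hs 2 e).1 (Module.End.eigenspace_le_maxGenEigenspace
    (Module.End.mem_eigenspace_iff.2 hhe))
  have htop : ⨆ i : ℤ, (ad ℂ L s).eigenspace (i : ℂ) = ⊤ := by
    rw [eq_top_iff, ← Module.End.iSup_maxGenEigenspace_eq_top (ad ℂ L h)]
    refine iSup_le fun μ => ?_
    by_cases hb : (ad ℂ L h).maxGenEigenspace μ = ⊥
    · rw [hb]; exact bot_le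
    · have hb' : (ad ℂ L h).HasUnifEigenvalue μ ⊤ := hb
      obtain ⟨i, rfl⟩ := exists_int_eq_of_hasEigenvalue he hAF hHA (hb'.lt zero_lt_one)
      exact le_iSup_of_le i fun x hx => Module.End.mem_eigenspace_iff.2 ((hs _ x).1 hx)
  obtain ⟨N, π, hπ1, hπ2, hπ3, hπ4, hN⟩ := exists_proj htop
  have hinj : ∀ (z : L) (n : ℤ), n < 0 → ⁅s, z⁆ = (n : ℂ) • z → ⁅e, z⁆ = 0 → z = 0 := by
    intro z n hn hz hez
    refine eq_zero_of_mem_maxGenEigenspace he hAF hHA (μ := n) (fun i hi => ?_) hez ?_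
    · have : n = (i : ℤ) := by exact_mod_cast hi
      omega
    · exact (hs _ _).2 hz
  refine ⟨s, hse, htop, hinj, fun z n hn hz => ?_⟩
  have hkill : ∀ (x y : L) (i j : ℤ), ⁅s, x⁆ = (i : ℂ) • x → ⁅s, y⁆ = (j : ℂ) • y → i + j ≠ 0 →
      killingForm ℂ L x y = 0 := by
    intro x y i j hx hy hij
    have h1 := killingForm_lie_left s x y
    rw [hx, hy, map_smul, map_smul, LinearMap.smul_apply, smul_eq_mul, smul_eq_mul] at h1
    have h2 : ((i + j : ℤ) : ℂ) * killingForm ℂ L x y = 0 := by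
      push_cast; linear_combination h1
    exact (mul_eq_zero.1 h2).resolve_left (Int.cast_ne_zero.2 hij)
  have hlie : ∀ (w : L) (i : ℤ), ⁅s, w⁆ = (i : ℂ) • w → ⁅s, ⁅e, w⁆⁆ = ((i + 2 : ℤ) : ℂ) • ⁅e, w⁆ := by
    intro w i hw
    rw [leibniz_lie, hse, hw, smul_lie, lie_smul]
    push_cast; module
  have hz' : z ∈ LinearMap.range (ad ℂ L e) := by
    refine mem_range_of_adjoint (T' := -ad ℂ L e) (fun x y => ?_) fun w hw => ?_
    · rw [ad_apply, killingForm_lie_left, LinearMap.neg_apply, map_neg, ad_apply]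
    · have hw' : ⁅e, w⁆ = 0 := neg_eq_zero.1 hw
      have hker : ∀ x ∈ LinearMap.ker (ad ℂ L e), ad ℂ L s x ∈ LinearMap.ker (ad ℂ L e) := by
        intro x hx
        have hx' : ⁅e, x⁆ = 0 := hx
        change ⁅e, ⁅s, x⁆⁆ = 0
        rw [leibniz_lie, ← lie_skew e s, hse, hx', neg_lie, smul_lie, hx']
        simp
      rw [← hπ3 w, map_sum]
      refine Finset.sum_eq_zero fun i _ => ?_
      by_cases hi : n + 2 + i = 0
      · have : π i w = 0 := hinj _ i (by omega) (hπ1 i w) (hπ4 _ hker i w hw')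
        rw [this, map_zero]
      · exact hkill z _ (n + 2) i hz (hπ1 i w) hi
  obtain ⟨y, hy⟩ := hz'
  refine ⟨π n y, hπ1 n y, ?_⟩
  have hcomm : ∀ y : L, ⁅e, π n y⁆ = π (n + 2) ⁅e, y⁆ := by
    intro y
    have hx : y ∈ ⨆ i : ℤ, (ad ℂ L s).eigenspace (i : ℂ) := htop ▸ Submodule.mem_top
    induction hx using Submodule.iSup_induction' with
    | mem j x hx =>
      rw [Module.End.mem_eigenspace_iff] at hx
      rw [hπ2 n j x hx, hπ2 (n + 2) (j + 2) _ (hlie x j hx)]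
      by_cases hj : j = n <;> simp [hj]
    | zero => simp
    | add x y _ _ hx hy => simp only [map_add, lie_add, hx, hy]
  rw [hcomm, ← ad_apply ℂ, hy, hπ2 (n + 2) (n + 2) z hz, if_pos rfl]

end F4

namespace F4

open LieAlgebra

variable {L : Type*} [LieRing L] [LieAlgebra ℂ L]

/-- A complex Lie algebra is a rational one. -/
noncomputable abbrev ratLieAlgebra (L : Type*) [LieRing L] [LieAlgebra ℂ L] : LieAlgebra ℚ L where
  toModule := Module.compHom L (algebraMap ℚ ℂ)
  lie_smul q x y := lie_smul (algebraMap ℚ ℂ q) x y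

theorem toLinearMap_derivation_ad (u : L) :
    (LieDerivation.ad ℂ L u).toLinearMap = ad ℂ L u :=
  LinearMap.ext fun x => LieDerivation.ad_apply_apply ℂ L u x

/-- The automorphism `exp (ad u)`. -/
noncomputable def adExp (u : L) (hu : IsNilpotent (ad ℂ L u)) : L ≃ₗ⁅ℂ⁆ L :=
  letI := ratLieAlgebra L
  LieDerivation.exp (LieDerivation.ad ℂ L u)
    ((toLinearMap_derivation_ad u).symm ▸ hu)

theorem adExp_apply (u : L) (hu : IsNilpotent (ad ℂ L u)) (x : L) :
    letI := ratLieAlgebra L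
    adExp u hu x = IsNilpotent.exp (ad ℂ L u) x := by
  let := ratLieAlgebra L
  rw [← toLinearMap_derivation_ad]
  rfl

theorem adExp_symm_apply (u : L) (hu : IsNilpotent (ad ℂ L u)) (x : L) :
    letI := ratLieAlgebra L
    (adExp u hu).symm x = IsNilpotent.exp (-ad ℂ L u) x := by
  let := ratLieAlgebra L
  rw [← toLinearMap_derivation_ad]
  rfl

section adExp

variable {u : L} (hu : IsNilpotent (ad ℂ L u))

theorem adExp_eq_sum {x : L} {k : ℕ} (hk : ((ad ℂ L u) ^ k) x = 0) :
    adExp u hu x = ∑ i ∈ Finset.range k, ((i.factorial : ℂ)⁻¹) • ((ad ℂ L u) ^ i) x := by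
  let := ratLieAlgebra L
  have h := IsNilpotent.exp_smul_eq_sum (a := ad ℂ L u) (m := x) (k := k) hk hu
  refine (adExp_apply u hu x).trans (Eq.trans h (Finset.sum_congr rfl fun i _ => ?_))
  rw [← Rat.cast_smul_eq_qsmul ℂ]
  push_cast
  rfl

theorem adExp_apply_eq_self {x : L} (h : ⁅u, x⁆ = 0) : adExp u hu x = x := by
  rw [adExp_eq_sum hu (k := 1) (by simpa using h)]
  simp

theorem adExp_apply_eq_add {x : L} (h : ⁅u, ⁅u, x⁆⁆ = 0) : adExp u hu x = x + ⁅u, x⁆ := by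
  rw [adExp_eq_sum hu (k := 2) (by simpa [pow_succ] using h)]
  simp [Finset.sum_range_succ]

theorem adExp_apply_eq_add_add {x : L} (h : ⁅u, ⁅u, ⁅u, x⁆⁆⁆ = 0) :
    adExp u hu x = x + ⁅u, x⁆ + (2⁻¹ : ℂ) • ⁅u, ⁅u, x⁆⁆ := by
  rw [adExp_eq_sum hu (k := 3) (by simpa [pow_succ] using h)]
  simp [Finset.sum_range_succ, pow_succ]

theorem adExp_sub_sub_mem {W : Submodule ℂ L} (hW : ∀ w ∈ W, ⁅u, w⁆ ∈ W) {x : L}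
    (hx : ⁅u, ⁅u, x⁆⁆ ∈ W) : adExp u hu x - x - ⁅u, x⁆ ∈ W := by
  obtain ⟨n, hn⟩ := id hu
  have hk : ((ad ℂ L u) ^ (n + 2)) x = 0 := by rw [pow_add, hn, zero_mul, LinearMap.zero_apply]
  have hmem : ∀ i : ℕ, ((ad ℂ L u) ^ (i + 2)) x ∈ W := by
    intro i
    induction i with
    | zero => simpa [pow_succ] using hx
    | succ i ih => rw [add_right_comm, pow_succ', Module.End.mul_apply]; exact hW _ ih
  have h1 : adExp u hu x - x - ⁅u, x⁆ =
      ∑ i ∈ Finset.range n, (((i + 2).factorial : ℂ)⁻¹) • ((ad ℂ L u) ^ (i + 2)) x := by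
    rw [adExp_eq_sum hu hk, Finset.sum_range_succ', Finset.sum_range_succ']
    simp only [zero_add, Nat.factorial, pow_zero, pow_one, Module.End.one_apply, ad_apply]
    push_cast
    module
  rw [h1]
  exact W.sum_mem fun i _ => W.smul_mem _ (hmem i)

theorem adExp_sub_mem {W : Submodule ℂ L} (hW : ∀ w ∈ W, ⁅u, w⁆ ∈ W) {x : L}
    (hx : ⁅u, x⁆ ∈ W) : adExp u hu x - x ∈ W := by
  simpa using W.add_mem (adExp_sub_sub_mem hu hW (hW _ hx)) hx

theorem adExp_mem {W : Submodule ℂ L} (hW : ∀ w ∈ W, ⁅u, w⁆ ∈ W) {x : L}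
    (hx : x ∈ W) : adExp u hu x ∈ W := by
  simpa using W.add_mem (adExp_sub_mem hu hW (hW _ hx)) hx

end adExp

theorem isNilpotent_ad_smul {u : L} (hu : IsNilpotent (ad ℂ L u)) (t : ℂ) :
    IsNilpotent (ad ℂ L (t • u)) := by
  rw [map_smul]; exact IsNilpotent.smul hu t

theorem isNilpotent_ad_neg {u : L} (hu : IsNilpotent (ad ℂ L u)) : IsNilpotent (ad ℂ L (-u)) := by
  rw [map_neg]; exact IsNilpotent.neg hu

theorem adExp_symm {u : L} (hu : IsNilpotent (ad ℂ L u)) :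
    (adExp u hu).symm = adExp (-u) (isNilpotent_ad_neg hu) := by
  ext x
  rw [adExp_symm_apply, adExp_apply, map_neg]

/-- Automorphisms behaving like products of exponentials of elements of `K`. -/
structure Inner (K : Submodule ℂ L) (φ : L ≃ₗ⁅ℂ⁆ L) : Prop where
  mem_iff : ∀ W : Submodule ℂ L, (∀ k ∈ K, ∀ w ∈ W, ⁅k, w⁆ ∈ W) → ∀ w, φ w ∈ W ↔ w ∈ W
  fix : ∀ z, (∀ k ∈ K, ⁅k, z⁆ = 0) → φ z = z

namespace Inner

variable {K K' : Submodule ℂ L} {φ ψ : L ≃ₗ⁅ℂ⁆ L}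

theorem refl : Inner K (LieEquiv.refl : L ≃ₗ⁅ℂ⁆ L) := ⟨fun _ _ _ => Iff.rfl, fun _ _ => rfl⟩

theorem symm (h : Inner K φ) : Inner K φ.symm := by
  refine ⟨fun W hW w => ?_, fun z hz => ?_⟩
  · rw [← h.mem_iff W hW, LieEquiv.apply_symm_apply]
  · conv_lhs => rw [← h.fix z hz]
    exact φ.symm_apply_apply z

theorem trans (h : Inner K φ) (h' : Inner K ψ) : Inner K (φ.trans ψ) := by
  refine ⟨fun W hW w => ?_, fun z hz => ?_⟩
  · rw [LieEquiv.trans_apply, h'.mem_iff W hW, h.mem_iff W hW]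
  · rw [LieEquiv.trans_apply, h.fix z hz, h'.fix z hz]

theorem mono (h : Inner K φ) (hK : K ≤ K') : Inner K' φ :=
  ⟨fun W hW => h.mem_iff W fun k hk => hW k (hK hk), fun z hz => h.fix z fun k hk => hz k (hK hk)⟩

theorem adExp {u : L} (hu : IsNilpotent (ad ℂ L u)) (hK : u ∈ K) : Inner K (adExp u hu) := by
  refine ⟨fun W hW w => ⟨fun h => ?_, fun h => adExp_mem hu (hW u hK) h⟩,
    fun z hz => adExp_apply_eq_self hu (hz u hK)⟩
  have := adExp_mem (isNilpotent_ad_neg hu) (hW _ (K.neg_mem hK)) h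
  rwa [← adExp_symm hu, LieEquiv.symm_apply_apply] at this

end Inner

end F4

namespace F4

open LieAlgebra

variable {L : Type*} [LieRing L] [LieAlgebra ℂ L]

theorem isNilpotent_ad_of_lie_eq_smul [FiniteDimensional ℂ L] {h x : L} {μ : ℂ} (hμ : μ ≠ 0)
    (hx : ⁅h, x⁆ = μ • x) : IsNilpotent (ad ℂ L x) := by
  set X := ad ℂ L x with hX
  set H := ad ℂ L h with hH
  let δ : Module.End ℂ (Module.End ℂ L) := LinearMap.mulLeft ℂ H - LinearMap.mulRight ℂ H
  have hδ : ∀ Y, δ Y = H * Y - Y * H := fun Y => rfl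
  have h0 : H * X - X * H = μ • X := by
    rw [hX, ← map_smul, ← hx]
    exact LinearMap.ext fun z => (lie_lie h x z).symm
  have hk : ∀ k : ℕ, δ (X ^ k) = ((k : ℂ) * μ) • X ^ k := by
    intro k
    induction k with
    | zero => simp [hδ]
    | succ k ih =>
      have h1 : δ (X ^ k * X) = δ (X ^ k) * X + X ^ k * (H * X - X * H) := by
        simp only [hδ]; noncomm_ring
      rw [pow_succ, h1, ih, h0, Algebra.mul_smul_comm, Algebra.smul_mul_assoc]
      push_cast
      module
  by_contra hn
  have hev : ∀ k : ℕ, δ.HasEigenvalue ((k : ℂ) * μ) := fun k =>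
    Module.End.hasEigenvalue_of_hasEigenvector
      ⟨Module.End.mem_eigenspace_iff.2 (hk k), fun h => hn ⟨k, h⟩⟩
  refine Set.infinite_of_injective_forall_mem (f := fun k : ℕ => (k : ℂ) * μ) ?_ hev
    (Module.End.finite_hasEigenvalue δ)
  intro a b hab
  exact Nat.cast_injective (mul_right_cancel₀ hμ hab)

theorem killingForm_eq_zero_of_lie {h x y : L} {a b : ℂ} (hab : a + b ≠ 0) (hx : ⁅h, x⁆ = a • x)
    (hy : ⁅h, y⁆ = b • y) : killingForm ℂ L x y = 0 := by
  have := killingForm_lie_left h x y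
  rw [hx, hy] at this
  simp only [map_smul, LinearMap.smul_apply, smul_eq_mul] at this
  refine (mul_eq_zero.1 (?_ : (a + b) * _ = 0)).resolve_left hab
  linear_combination this

theorem lie_lie_eq_smul {h u v : L} {a b : ℂ} (ha : ⁅h, u⁆ = a • u) (hb : ⁅h, v⁆ = b • v) (c : ℂ)
    (hc : a + b = c) : ⁅h, ⁅u, v⁆⁆ = c • ⁅u, v⁆ := by
  rw [leibniz_lie, ha, hb, lie_smul, smul_lie, ← hc]; module

/-- An `sl₂`-triple in `K` whose neutral element grades `K` as for a long highest root. -/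
structure Triple (K : Submodule ℂ L) (e h f : L) : Prop where
  e_mem : e ∈ K
  h_mem : h ∈ K
  f_mem : f ∈ K
  lie_mem : ∀ x ∈ K, ∀ y ∈ K, ⁅x, y⁆ ∈ K
  he : ⁅h, e⁆ = (2 : ℂ) • e
  hf : ⁅h, f⁆ = (-2 : ℂ) • f
  ef : ⁅e, f⁆ = h
  dec : ∀ x ∈ K, ∃ (c d : ℂ) (x₁ x₀ y₁ : L), x₁ ∈ K ∧ x₀ ∈ K ∧ y₁ ∈ K ∧
    ⁅h, x₁⁆ = x₁ ∧ ⁅h, x₀⁆ = 0 ∧ ⁅h, y₁⁆ = -y₁ ∧ x = c • e + x₁ + x₀ + y₁ + d • f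
  cent : ∀ x ∈ K, ⁅h, x⁆ = 0 → ∃ (a : ℂ) (z : L), x = a • h + z ∧ ⁅z, e⁆ = 0 ∧ ⁅z, f⁆ = 0
  kappa : killingForm ℂ L e f ≠ 0

theorem eq_zero_of_five {h x₂ x₁ x₀ y₁ y₂ : L} (h₂ : ⁅h, x₂⁆ = (2 : ℂ) • x₂) (h₁ : ⁅h, x₁⁆ = x₁)
    (h₀ : ⁅h, x₀⁆ = 0) (k₁ : ⁅h, y₁⁆ = -y₁) (k₂ : ⁅h, y₂⁆ = (-2 : ℂ) • y₂)
    (hs : x₂ + x₁ + x₀ + y₁ + y₂ = 0) : x₂ = 0 ∧ x₁ = 0 ∧ x₀ = 0 ∧ y₁ = 0 ∧ y₂ = 0 := by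
  have e₁ := congrArg (fun x => ⁅h, x⁆) hs
  simp only [lie_add, lie_zero, h₂, h₁, h₀, k₁, k₂] at e₁
  have e₂ := congrArg (fun x => ⁅h, x⁆) e₁
  simp only [lie_add, lie_smul, lie_neg, lie_zero, h₂, h₁, k₁, k₂] at e₂
  have e₃ := congrArg (fun x => ⁅h, x⁆) e₂
  simp only [lie_add, lie_smul, lie_neg, lie_zero, h₂, h₁, k₁, k₂] at e₃
  have e₄ := congrArg (fun x => ⁅h, x⁆) e₃
  simp only [lie_add, lie_smul, lie_neg, lie_zero, h₂, h₁, k₁, k₂] at e₄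
  refine ⟨?_, ?_, ?_, ?_, ?_⟩
  · linear_combination (norm := module) (1 / 24 : ℂ) • (e₄ - e₂) + (1 / 12 : ℂ) • (e₃ - e₁)
  · linear_combination (norm := module) (1 / 6 : ℂ) • ((4 : ℂ) • e₂ - e₄) + (1 / 6 : ℂ) • ((4 : ℂ) • e₁ - e₃)
  · linear_combination (norm := module) hs + (1 / 4 : ℂ) • e₄ - (5 / 4 : ℂ) • e₂
  · linear_combination (norm := module) (1 / 6 : ℂ) • ((4 : ℂ) • e₂ - e₄) - (1 / 6 : ℂ) • ((4 : ℂ) • e₁ - e₃)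
  · linear_combination (norm := module) (1 / 24 : ℂ) • (e₄ - e₂) - (1 / 12 : ℂ) • (e₃ - e₁)

/-- `x` is extremal with respect to `K`. -/
def Extremal (K : Submodule ℂ L) (x : L) : Prop := ∀ y ∈ K, ∃ c : ℂ, ⁅x, ⁅x, y⁆⁆ = c • x

theorem Extremal.map {K : Submodule ℂ L} {x : L} (hx : Extremal K x) {φ : L ≃ₗ⁅ℂ⁆ L}
    (hK : ∀ w, φ w ∈ K ↔ w ∈ K) : Extremal K (φ x) := by
  intro y hy
  obtain ⟨c, hc⟩ := hx (φ.symm y) (by rwa [← hK, LieEquiv.apply_symm_apply])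
  refine ⟨c, ?_⟩
  have := congrArg φ hc
  rwa [LieEquiv.map_lie, LieEquiv.map_lie, LieEquiv.apply_symm_apply, map_smul] at this

namespace Triple

variable {K : Submodule ℂ L} {e h f : L} (T : Triple K e h f)
include T

theorem symm : Triple K f (-h) e where
  e_mem := T.f_mem
  h_mem := K.neg_mem T.h_mem
  f_mem := T.e_mem
  lie_mem := T.lie_mem
  he := by rw [neg_lie, T.hf]; module
  hf := by rw [neg_lie, T.he]; module
  ef := by rw [← lie_skew, T.ef]
  dec x hx := by
    obtain ⟨c, d, x₁, x₀, y₁, m₁, m₀, n₁, h₁, h₀, k₁, rfl⟩ := T.dec x hx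
    exact ⟨d, c, y₁, x₀, x₁, n₁, m₀, m₁, by rw [neg_lie, k₁, neg_neg], by rw [neg_lie, h₀, neg_zero],
      by rw [neg_lie, h₁], by abel⟩
  cent x hx h0 := by
    obtain ⟨a, z, hz, h1, h2⟩ := T.cent x hx (by rwa [neg_lie, neg_eq_zero] at h0)
    exact ⟨-a, z, by rw [hz]; module, h2, h1⟩
  kappa := by rw [LieModule.traceForm_comm]; exact T.kappa

theorem mem_iff {φ : L ≃ₗ⁅ℂ⁆ L} (hφ : Inner K φ) (w : L) : φ w ∈ K ↔ w ∈ K :=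
  hφ.mem_iff K T.lie_mem w

/-- An `h`-eigenvector in `K` outside the degrees `-2, …, 2` vanishes, and in degrees `±2` it is a
multiple of `e` or `f`. -/
theorem exists_of_lie_eq_smul {x : L} (hx : x ∈ K) {μ : ℂ} (h1 : μ ≠ 1) (h0 : μ ≠ 0) (h1' : μ ≠ -1)
    (hμ : ⁅h, x⁆ = μ • x) : ∃ c d : ℂ, x = c • e + d • f ∧ ((2 - μ) * c) • e = 0 ∧
      ((2 + μ) * d) • f = 0 := by
  obtain ⟨c, d, x₁, x₀, y₁, m₁, m₀, n₁, h₁, h₀, k₁, rfl⟩ := T.dec x hx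
  simp only [lie_add, lie_smul, T.he, T.hf, h₁, h₀, k₁] at hμ
  obtain ⟨r₂, r₁, r₀, s₁, s₂⟩ := eq_zero_of_five (h := h) (x₂ := ((2 - μ) * c) • e)
    (x₁ := (1 - μ) • x₁) (x₀ := (-μ) • x₀) (y₁ := (-1 - μ) • y₁) (y₂ := ((-2 - μ) * d) • f)
    (by rw [lie_smul, T.he]; module) (by rw [lie_smul, h₁]) (by rw [lie_smul, h₀, smul_zero])
    (by rw [lie_smul, k₁]; module) (by rw [lie_smul, T.hf]; module)
    (by linear_combination (norm := module) hμ)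
  refine ⟨c, d, ?_, r₂, by linear_combination (norm := module) -s₂⟩
  rw [(smul_eq_zero.1 r₁).resolve_left (sub_ne_zero.2 h1.symm),
    (smul_eq_zero.1 r₀).resolve_left (neg_ne_zero.2 h0),
    (smul_eq_zero.1 s₁).resolve_left (sub_ne_zero.2 h1'.symm)]
  abel

theorem e_ne_zero : e ≠ 0 := by
  rintro rfl
  exact T.kappa (by simp)

theorem f_ne_zero : f ≠ 0 := by
  rintro rfl
  exact T.kappa (by simp)

theorem eq_zero_of_lie_eq_neg_three {x : L} (hx : x ∈ K) (hμ : ⁅h, x⁆ = (-3 : ℂ) • x) : x = 0 := by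
  obtain ⟨c, d, rfl, hc, hd⟩ := T.exists_of_lie_eq_smul hx (by norm_num) (by norm_num) (by norm_num) hμ
  rw [smul_eq_zero, or_iff_left T.e_ne_zero] at hc
  rw [smul_eq_zero, or_iff_left T.f_ne_zero] at hd
  norm_num at hc hd
  simp [hc, hd]

theorem exists_eq_smul_f {x : L} (hx : x ∈ K) (hμ : ⁅h, x⁆ = (-2 : ℂ) • x) : ∃ d : ℂ, x = d • f := by
  obtain ⟨c, d, rfl, hc, hd⟩ := T.exists_of_lie_eq_smul hx (by norm_num) (by norm_num) (by norm_num) hμ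
  rw [smul_eq_zero, or_iff_left T.e_ne_zero] at hc
  norm_num at hc
  exact ⟨d, by simp [hc]⟩

theorem lie_f_of_neg_one {y₁ : L} (n₁ : y₁ ∈ K) (k₁ : ⁅h, y₁⁆ = -y₁) : ⁅f, y₁⁆ = 0 :=
  T.eq_zero_of_lie_eq_neg_three (T.lie_mem f T.f_mem _ n₁)
    (lie_lie_eq_smul T.hf (b := -1) (by rw [k₁]; module) _ (by norm_num))

theorem extremal_f : Extremal K f := by
  intro y hy
  obtain ⟨c, d, x₁, x₀, y₁, m₁, m₀, n₁, h₁, h₀, k₁, rfl⟩ := T.dec y hy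
  have hy₁ := T.lie_f_of_neg_one n₁ k₁
  have hx₁ : ⁅f, ⁅f, x₁⁆⁆ = 0 := by
    refine T.lie_f_of_neg_one (T.lie_mem f T.f_mem _ m₁) ?_
    rw [lie_lie_eq_smul T.hf (b := 1) (by rw [h₁, one_smul]) (-1) (by norm_num), neg_one_smul]
  obtain ⟨a, ha⟩ := T.exists_eq_smul_f (T.lie_mem f T.f_mem _ m₀)
    (lie_lie_eq_smul T.hf (b := 0) (by rw [h₀, zero_smul]) (-2) (by norm_num))
  have hfe : ⁅f, e⁆ = -h := by rw [← lie_skew, T.ef]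
  have hfh : ⁅f, h⁆ = (2 : ℂ) • f := by rw [← lie_skew, T.hf]; module
  refine ⟨-2 * c, ?_⟩
  simp only [lie_add, lie_smul, hy₁, hx₁, ha, lie_self, hfe, hfh, lie_neg, smul_zero, add_zero]
  module

/-- The elements of `K` of negative degree, or of degree at most zero. -/
def lower (K : Submodule ℂ L) (h : L) : Submodule ℂ L :=
  Submodule.span ℂ {w | w ∈ K ∧ (⁅h, w⁆ = 0 ∨ ⁅h, w⁆ = -w ∨ ⁅h, w⁆ = (-2 : ℂ) • w)}

theorem exists_of_mem_lower {w : L} (hw : w ∈ lower K h) : ∃ (d : ℂ) (x₀ y₁ : L), x₀ ∈ K ∧ y₁ ∈ K ∧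
    ⁅h, x₀⁆ = 0 ∧ ⁅h, y₁⁆ = -y₁ ∧ w = x₀ + y₁ + d • f := by
  induction hw using Submodule.span_induction with
  | mem w hw =>
    obtain ⟨hK, h0 | h0 | h0⟩ := hw
    · exact ⟨0, w, 0, hK, K.zero_mem, h0, by simp, by simp⟩
    · exact ⟨0, 0, w, K.zero_mem, hK, by simp, h0, by simp⟩
    · obtain ⟨d, rfl⟩ := T.exists_eq_smul_f hK h0
      exact ⟨d, 0, 0, K.zero_mem, K.zero_mem, by simp, by simp, by simp⟩
  | zero => exact ⟨0, 0, 0, K.zero_mem, K.zero_mem, by simp, by simp, by simp⟩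
  | add x y _ _ hx hy =>
    obtain ⟨d, x₀, y₁, m₀, n₁, h₀, k₁, rfl⟩ := hx
    obtain ⟨d', x₀', y₁', m₀', n₁', h₀', k₁', rfl⟩ := hy
    exact ⟨d + d', x₀ + x₀', y₁ + y₁', K.add_mem m₀ m₀', K.add_mem n₁ n₁',
      by rw [lie_add, h₀, h₀', add_zero], by rw [lie_add, k₁, k₁']; abel, by module⟩
  | smul a x _ hx =>
    obtain ⟨d, x₀, y₁, m₀, n₁, h₀, k₁, rfl⟩ := hx
    exact ⟨a * d, a • x₀, a • y₁, K.smul_mem a m₀, K.smul_mem a n₁,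
      by rw [lie_smul, h₀, smul_zero], by rw [lie_smul, k₁, smul_neg], by module⟩

theorem lie_mem_lower {u : L} (hu : u ∈ K) (hu' : ⁅h, u⁆ = -u) {w : L} (hw : w ∈ lower K h) :
    ⁅u, w⁆ ∈ lower K h := by
  have hu'' : ⁅h, u⁆ = (-1 : ℂ) • u := by rw [hu', neg_one_smul]
  induction hw using Submodule.span_induction with
  | mem w hw =>
    obtain ⟨hK, h0⟩ := hw
    have hm := T.lie_mem u hu w hK
    obtain h0 | h0 | h0 := h0
    · refine Submodule.subset_span ⟨hm, Or.inr (Or.inl ?_)⟩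
      rw [lie_lie_eq_smul hu'' (b := 0) (by rw [h0, zero_smul]) (-1) (by norm_num), neg_one_smul]
    · refine Submodule.subset_span ⟨hm, Or.inr (Or.inr ?_)⟩
      rw [lie_lie_eq_smul hu'' (b := -1) (by rw [h0, neg_one_smul]) (-2) (by norm_num)]
    · rw [T.eq_zero_of_lie_eq_neg_three hm (lie_lie_eq_smul hu'' h0 (-3) (by norm_num))]
      exact Submodule.zero_mem _
  | zero => simp
  | add x y _ _ hx hy => rw [lie_add]; exact Submodule.add_mem _ hx hy
  | smul _ x _ hx => rw [lie_smul]; exact Submodule.smul_mem _ _ hx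

theorem eq_smul_e_of_extremal {c d : ℂ} {z y₁ : L} (hc : c ≠ 0) (hz : ⁅z, e⁆ = 0)
    (hz' : ⁅z, f⁆ = 0) (n₁ : y₁ ∈ K) (k₁ : ⁅h, y₁⁆ = -y₁)
    (hx : Extremal K (c • e + z + y₁ + d • f)) : c • e + z + y₁ + d • f = c • e := by
  obtain ⟨l, hl⟩ := hx f T.f_mem
  have hzh : ⁅z, h⁆ = 0 := by rw [← T.ef, leibniz_lie, hz, hz', zero_lie, lie_zero, add_zero]
  have hzh' : ⁅h, z⁆ = 0 := by rw [← lie_skew, hzh, neg_zero]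
  have hyf : ⁅y₁, f⁆ = 0 := by rw [← lie_skew, T.lie_f_of_neg_one n₁ k₁, neg_zero]
  have hyh : ⁅y₁, h⁆ = y₁ := by rw [← lie_skew, k₁, neg_neg]
  have heh : ⁅e, h⁆ = (-2 : ℂ) • e := by rw [← lie_skew, T.he]; module
  have hfh : ⁅f, h⁆ = (2 : ℂ) • f := by rw [← lie_skew, T.hf]; module
  simp only [add_lie, smul_lie, lie_smul, T.ef, hz', hyf, lie_self, smul_zero, add_zero, heh, hzh,
    hyh, hfh] at hl
  obtain ⟨r₂, -, r₀, s₁, s₂⟩ := eq_zero_of_five (h := h) (x₂ := (c * (-2 * c - l)) • e)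
    (x₁ := 0) (x₀ := (-l) • z) (y₁ := (c - l) • y₁) (y₂ := ((2 * c - l) * d) • f)
    (by rw [lie_smul, T.he]; module) (by simp) (by rw [lie_smul, hzh', smul_zero])
    (by rw [lie_smul, k₁]; module) (by rw [lie_smul, T.hf]; module)
    (by linear_combination (norm := module) hl)
  rw [smul_eq_zero, or_iff_left T.e_ne_zero, mul_eq_zero, or_iff_right hc, sub_eq_zero] at r₂
  subst r₂
  rw [smul_eq_zero, or_iff_right (by simpa using hc)] at r₀
  rw [smul_eq_zero, or_iff_right (by ring_nf; simpa using hc)] at s₁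
  rw [smul_eq_zero, or_iff_left T.f_ne_zero, mul_eq_zero, or_iff_right (by ring_nf; simpa using hc)]
    at s₂
  simp [r₀, s₁, s₂]

theorem nil_e [FiniteDimensional ℂ L] : IsNilpotent (ad ℂ L e) :=
  isNilpotent_ad_of_lie_eq_smul two_ne_zero T.he

theorem nil_f [FiniteDimensional ℂ L] : IsNilpotent (ad ℂ L f) := T.symm.nil_e

/-- An extremal element pairing nontrivially with `f` is conjugate to a multiple of `e`. -/
theorem exists_inner_eq_smul [FiniteDimensional ℂ L] {x : L} (hxK : x ∈ K) (hx : Extremal K x)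
    (hxf : killingForm ℂ L x f ≠ 0) :
    ∃ (φ : L ≃ₗ⁅ℂ⁆ L) (c : ℂ), Inner K φ ∧ φ f = f ∧ c ≠ 0 ∧ φ x = c • e := by
  obtain ⟨c, d, x₁, x₀, y₁, m₁, m₀, n₁, h₁, h₀, k₁, rfl⟩ := T.dec x hxK
  have hc : c ≠ 0 := by
    rintro rfl
    refine hxf ?_
    simp only [map_add, map_smul, LinearMap.add_apply, LinearMap.smul_apply]
    rw [killingForm_eq_zero_of_lie (x := x₁) (a := 1) (by norm_num) (by rw [h₁, one_smul]) T.hf,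
      killingForm_eq_zero_of_lie (x := x₀) (a := 0) (by norm_num) (by rw [h₀, zero_smul]) T.hf,
      killingForm_eq_zero_of_lie (x := y₁) (a := -1) (by norm_num) (by rw [k₁, neg_one_smul]) T.hf,
      killingForm_eq_zero_of_lie (x := f) (by norm_num) T.hf T.hf]
    simp
  set u : L := c⁻¹ • ⁅f, x₁⁆ with hu
  have huK : u ∈ K := K.smul_mem _ (T.lie_mem f T.f_mem _ m₁)
  have hud : ⁅h, u⁆ = -u := by
    rw [hu, lie_smul, lie_lie_eq_smul T.hf (b := 1) (by rw [h₁, one_smul]) (-1) (by norm_num)]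
    module
  have hun : IsNilpotent (ad ℂ L u) :=
    isNilpotent_ad_of_lie_eq_smul (μ := -1) (by norm_num) (by rw [hud, neg_one_smul])
  have hux : c • ⁅u, e⁆ = -x₁ := by
    have h1 : ⁅x₁, e⁆ = 0 := by
      have := T.symm.lie_f_of_neg_one m₁ (by rw [neg_lie, h₁])
      rw [← lie_skew, this, neg_zero]
    have h2 : ⁅f, e⁆ = -h := by rw [← lie_skew, T.ef]
    have h3 : ⁅x₁, h⁆ = -x₁ := by rw [← lie_skew, h₁]
    rw [hu, smul_lie, smul_smul, mul_inv_cancel₀ hc, one_smul, lie_lie, h1, h2, lie_zero, lie_neg,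
      h3]
    abel
  have huf : ⁅u, f⁆ = 0 := by rw [← lie_skew, T.lie_f_of_neg_one huK hud, neg_zero]
  have hW : ∀ w ∈ lower K h, ⁅u, w⁆ ∈ lower K h := fun w hw => T.lie_mem_lower huK hud hw
  have hux₁ : ⁅u, x₁⁆ ∈ lower K h := by
    refine Submodule.subset_span ⟨T.lie_mem u huK _ m₁, Or.inl ?_⟩
    rw [leibniz_lie, hud, h₁, neg_lie, neg_add_cancel]
  have huc : ⁅u, c • e⁆ = -x₁ := by rw [lie_smul, hux]
  have hrest : x₀ + y₁ + d • f ∈ lower K h := by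
    refine Submodule.add_mem _ (Submodule.add_mem _ ?_ ?_) (Submodule.smul_mem _ d ?_)
    · exact Submodule.subset_span ⟨m₀, Or.inl h₀⟩
    · exact Submodule.subset_span ⟨n₁, Or.inr (Or.inl k₁)⟩
    · exact Submodule.subset_span ⟨T.f_mem, Or.inr (Or.inr T.hf)⟩
  have hin := Inner.adExp hun huK
  have hmem : F4.adExp u hun (c • e + x₁ + x₀ + y₁ + d • f) - c • e ∈ lower K h := by
    have h1 := adExp_sub_sub_mem hun hW (x := c • e)
      (by rw [huc, lie_neg]; exact Submodule.neg_mem _ hux₁)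
    have h2 := adExp_sub_mem hun hW hux₁
    have h3 := adExp_mem hun hW hrest
    have h4 := Submodule.add_mem _ (Submodule.add_mem _ h1 h2) h3
    rw [huc] at h4
    convert! h4 using 1
    simp only [map_add]
    abel
  obtain ⟨d', w₀, w₁, p₀, p₁, q₀, q₁, hw⟩ := T.exists_of_mem_lower hmem
  obtain ⟨a, z, rfl, hze, hzf⟩ := T.cent w₀ p₀ q₀
  rw [sub_eq_iff_eq_add] at hw
  obtain ⟨t, rfl⟩ : ∃ t, a = c * t := ⟨a / c, (mul_div_cancel₀ a hc).symm⟩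
  have htn := isNilpotent_ad_smul T.nil_f t
  have hin' := Inner.adExp htn (K.smul_mem t T.f_mem)
  have hfe : ⁅f, e⁆ = -h := by rw [← lie_skew, T.ef]
  have hfh : ⁅f, h⁆ = (2 : ℂ) • f := by rw [← lie_skew, T.hf]; module
  have v1 : F4.adExp _ htn e = e - t • h - (t * t) • f := by
    rw [adExp_apply_eq_add_add htn (by simp [hfe, hfh])]
    simp only [smul_lie, hfe, smul_neg, lie_neg, lie_smul, hfh]
    module
  have v2 : F4.adExp _ htn h = h + (2 * t) • f := by
    rw [adExp_apply_eq_add htn (by simp [hfh])]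
    simp only [smul_lie, hfh]
    module
  have v3 : F4.adExp _ htn z = z :=
    adExp_apply_eq_self htn (by rw [smul_lie, ← lie_skew, hzf, neg_zero, smul_zero])
  have v4 : F4.adExp _ htn w₁ = w₁ :=
    adExp_apply_eq_self htn (by rw [smul_lie, T.lie_f_of_neg_one p₁ q₁, smul_zero])
  have v5 : F4.adExp _ htn f = f := adExp_apply_eq_self htn (by simp)
  have hfin : F4.adExp _ htn (F4.adExp u hun (c • e + x₁ + x₀ + y₁ + d • f)) =
      c • e + z + w₁ + (d' + c * t * t) • f := by
    rw [hw]
    simp only [map_add, map_smul, v1, v2, v3, v4, v5]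
    module
  refine ⟨(F4.adExp u hun).trans (F4.adExp _ htn), c, hin.trans hin', ?_, hc, ?_⟩
  · rw [LieEquiv.trans_apply, adExp_apply_eq_self hun huf, v5]
  · rw [LieEquiv.trans_apply]
    have hext := (hx.map (T.mem_iff hin)).map (T.mem_iff hin')
    rw [hfin] at hext ⊢
    exact T.eq_smul_e_of_extremal hc hze hzf p₁ q₁ hext

end Triple

end F4

namespace F4

open LieAlgebra

variable {L : Type*} [LieRing L] [LieAlgebra ℂ L]

/-- `ad s` is diagonalizable with integer eigenvalues. -/
def IntDiag (s : L) : Prop := ⨆ i : ℤ, (ad ℂ L s).eigenspace (i : ℂ) = ⊤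

theorem IntDiag.neg {s : L} (hs : IntDiag s) : IntDiag (-s) := by
  rw [IntDiag, ← (Equiv.neg ℤ).iSup_comp, ← hs]
  refine iSup_congr fun i => ?_
  ext x
  simp only [Equiv.neg_apply, Module.End.mem_eigenspace_iff, ad_apply, neg_lie, Int.cast_neg,
    neg_smul, neg_inj]

theorem IntDiag.map {s : L} (hs : IntDiag s) (φ : L ≃ₗ⁅ℂ⁆ L) : IntDiag (φ s) := by
  rw [IntDiag, eq_top_iff]
  have h1 : (⊤ : Submodule ℂ L) = Submodule.map (φ : L →ₗ[ℂ] L) ⊤ := by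
    rw [Submodule.map_top, eq_comm, LinearMap.range_eq_top]
    exact φ.surjective
  rw [h1, ← hs, Submodule.map_iSup]
  refine iSup_mono fun i => ?_
  rintro _ ⟨x, hx, rfl⟩
  have hx' : ⁅s, x⁆ = (i : ℂ) • x := Module.End.mem_eigenspace_iff.1 hx
  rw [Module.End.mem_eigenspace_iff]
  change ⁅φ s, φ x⁆ = (i : ℂ) • φ x
  rw [← LieEquiv.map_lie, hx', map_smul]

/-- The integer eigenvalues of `ad s` on `K` are bounded by `M`. -/
def Bounded (K : Submodule ℂ L) (s : L) (M : ℤ) : Prop :=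
  ∀ (i : ℤ), ∀ x ∈ K, ⁅s, x⁆ = (i : ℂ) • x → x ≠ 0 → |i| ≤ M

theorem Bounded.neg {K : Submodule ℂ L} {s : L} {M : ℤ} (h : Bounded K s M) :
    Bounded K (-s) M := by
  intro i x hx hi
  rw [← abs_neg]
  refine h (-i) x hx ?_
  rw [neg_lie, neg_eq_iff_eq_neg] at hi
  rw [hi]; push_cast; module

theorem Bounded.map {K : Submodule ℂ L} {s : L} {M : ℤ} (h : Bounded K s M) {φ : L ≃ₗ⁅ℂ⁆ L}
    (hK : ∀ w, φ w ∈ K ↔ w ∈ K) : Bounded K (φ s) M := by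
  intro i x hx hi hx0
  refine h i (φ.symm x) (by rwa [← hK, LieEquiv.apply_symm_apply]) ?_ ?_
  · refine φ.injective ?_
    change φ _ = φ _
    rw [LieEquiv.map_lie, LieEquiv.apply_symm_apply, hi, map_smul, LieEquiv.apply_symm_apply]
  · rintro h0
    exact hx0 (by rw [← φ.apply_symm_apply x, h0, map_zero])

variable [FiniteDimensional ℂ L]

theorem exists_extremal_component {K : Submodule ℂ L} {s g : L} {M : ℤ}
    (hs : IntDiag s) (hsK : ∀ x ∈ K, ⁅s, x⁆ ∈ K) (hK : ∀ x ∈ K, ∀ y ∈ K, ⁅x, y⁆ ∈ K)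
    (hM : Bounded K s M) (hg : g ∈ K) (hext : Extremal K g) :
    ∃ x ∈ K, ⁅s, x⁆ = (M : ℂ) • x ∧ Extremal K x ∧
      ∀ v, ⁅s, v⁆ = (-M : ℂ) • v → killingForm ℂ L v x = killingForm ℂ L v g := by
  obtain ⟨N, π, h1, h2, h3, h4, h5⟩ := exists_proj hs
  have hdeg : ∀ (i : ℤ) (x : L), ⁅s, π i x⁆ = (i : ℂ) • π i x := h1
  replace h2 : ∀ (i j : ℤ) (x : L), ⁅s, x⁆ = (j : ℂ) • x → π i x = if j = i then x else 0 := h2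
  have hπK : ∀ i, ∀ x ∈ K, π i x ∈ K := h4 K hsK
  have hbig : ∀ i : ℤ, M < |i| → ∀ x ∈ K, ⁅s, x⁆ = (i : ℂ) • x → x = 0 := by
    intro i hi x hx hix
    by_contra h0
    exact absurd (hM i x hx hix h0) (not_le.2 hi)
  have hout : ∀ i : ℤ, i ∉ Finset.Icc (-(N : ℤ)) N → ∀ x, π i x = 0 := by
    intro i hi x
    refine h5 i ?_ _ (h1 i x)
    rw [Finset.mem_Icc] at hi
    omega
  refine ⟨π M g, hπK M g hg, hdeg M g, ?_, ?_⟩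
  · intro y hy
    have hlin : ∀ j : ℤ, ∃ c : ℂ, ⁅π M g, ⁅π M g, π j y⁆⁆ = c • π M g := by
      intro j
      set w := π j y with hw
      have hwK : w ∈ K := hπK j y hy
      have hwj : ⁅s, w⁆ = (j : ℂ) • w := hdeg j y
      by_cases hj : j = -M
      · obtain ⟨c, hc⟩ := hext w hwK
        refine ⟨c, ?_⟩
        have hterm : ∀ a b : ℤ, ⁅s, ⁅π a g, ⁅π b g, w⁆⁆⁆ =
            ((a + (b + j) : ℤ) : ℂ) • ⁅π a g, ⁅π b g, w⁆⁆ := fun a b =>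
          lie_lie_eq_smul (hdeg a g) (lie_lie_eq_smul (hdeg b g) hwj _ rfl) _ (by push_cast; ring)
        have hzero : ∀ a b : ℤ, (a ≠ M ∨ b ≠ M) → π M ⁅π a g, ⁅π b g, w⁆⁆ = 0 := by
          intro a b hab
          rw [h2 M _ _ (hterm a b)]
          split_ifs with heq
          · have : M < a ∨ M < b := by omega
            rcases this with h | h
            · rw [hbig a (lt_of_lt_of_le h (le_abs_self a)) _ (hπK a g hg) (hdeg a g), zero_lie]
            · rw [hbig b (lt_of_lt_of_le h (le_abs_self b)) _ (hπK b g hg) (hdeg b g), zero_lie,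
                lie_zero]
          · rfl
        have hsum : π M ⁅g, ⁅g, w⁆⁆ = ⁅π M g, ⁅π M g, w⁆⁆ := by
          conv_lhs => rw [← h3 g]
          simp only [sum_lie, lie_sum, map_sum]
          rw [Finset.sum_eq_single M, Finset.sum_eq_single M, h2 M _ _ (hterm M M),
            if_pos (by omega)]
          · exact fun b _ hb => hzero b M (Or.inl hb)
          · intro h; rw [hout M h]
          · exact fun b _ hb => Finset.sum_eq_zero fun a _ => hzero _ _ (by tauto)
          · intro h; rw [hout M h]; simp
        rw [← hsum, hc, map_smul]
      · refine ⟨0, ?_⟩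
        have hd : ⁅s, ⁅π M g, ⁅π M g, w⁆⁆⁆ = ((M + (M + j) : ℤ) : ℂ) • ⁅π M g, ⁅π M g, w⁆⁆ :=
          lie_lie_eq_smul (hdeg M g) (lie_lie_eq_smul (hdeg M g) hwj _ rfl) _ (by push_cast; ring)
        rw [zero_smul]
        rcases lt_or_gt_of_ne hj with hlt | hgt
        · rw [hbig j (by rw [lt_abs]; omega) w hwK hwj, lie_zero, lie_zero]
        · exact hbig _ (by rw [lt_abs]; omega) _
            (hK _ (hπK M g hg) _ (hK _ (hπK M g hg) _ hwK)) hd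
    choose c hc using hlin
    refine ⟨∑ j ∈ Finset.Icc (-(N : ℤ)) N, c j, ?_⟩
    conv_lhs => rw [← h3 y]
    simp only [lie_sum, hc, Finset.sum_smul]
  · intro v hv
    conv_rhs => rw [← h3 g, map_sum]
    rw [Finset.sum_eq_single M]
    · intro i _ hi
      refine killingForm_eq_zero_of_lie ?_ hv (hdeg i g)
      rw [neg_add_eq_sub, sub_ne_zero]
      exact_mod_cast hi
    · intro h; rw [hout M h]; simp

/-- The eigenvalues of `ad s` on `K` are bounded by one which occurs together with its negative. -/
theorem exists_bounded {K : Submodule ℂ L} {s : L} (hs : IntDiag s) (hsK : ∀ x ∈ K, ⁅s, x⁆ ∈ K)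
    (hκ : ∀ x ∈ K, (∀ y ∈ K, killingForm ℂ L x y = 0) → x = 0) (hK : ∃ x ∈ K, x ≠ 0) :
    ∃ M : ℤ, Bounded K s M ∧ ∃ v ∈ K, v ≠ 0 ∧ ⁅s, v⁆ = (-M : ℂ) • v := by
  classical
  obtain ⟨N, π, h1, h2, h3, h4, h5⟩ := exists_proj hs
  have hdeg : ∀ (i : ℤ) (x : L), ⁅s, π i x⁆ = (i : ℂ) • π i x := h1
  let J : Finset ℤ := (Finset.Icc (-(N : ℤ)) N).filter
    fun i => ∃ x ∈ K, x ≠ 0 ∧ ⁅s, x⁆ = (i : ℂ) • x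
  have hJ : ∀ i : ℤ, (∃ x ∈ K, x ≠ 0 ∧ ⁅s, x⁆ = (i : ℂ) • x) → i ∈ J := by
    intro i hi
    rw [Finset.mem_filter, Finset.mem_Icc]
    refine ⟨?_, hi⟩
    obtain ⟨x, -, hx0, hx⟩ := hi
    have : ¬ N < i.natAbs := fun h => hx0 (h5 i h x hx)
    omega
  have hJne : J.Nonempty := by
    obtain ⟨x, hx, hx0⟩ := hK
    by_contra hne
    rw [Finset.not_nonempty_iff_eq_empty] at hne
    refine hx0 ?_
    rw [← h3 x]
    refine Finset.sum_eq_zero fun i _ => ?_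
    by_contra hi
    have := hJ i ⟨π i x, h4 K hsK i x hx, hi, hdeg i x⟩
    simp [hne] at this
  obtain ⟨i, hiJ, hi⟩ := J.exists_max_image (fun i => |i|) hJne
  have hiJ' := hiJ
  obtain ⟨-, v, hvK, hv0, hv⟩ := Finset.mem_filter.1 hiJ'
  refine ⟨|i|, fun j x hx hjx hx0 => hi j (hJ j ⟨x, hx, hx0, hjx⟩), ?_⟩
  rcases abs_choice i with h | h
  · have : ∃ y ∈ K, killingForm ℂ L v y ≠ 0 := by
      by_contra hcon
      push Not at hcon
      exact hv0 (hκ v hvK hcon)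
    obtain ⟨y, hyK, hy⟩ := this
    rw [h]
    refine ⟨π (-i) y, h4 K hsK _ y hyK, ?_, by simpa using hdeg (-i) y⟩
    intro h0
    refine hy ?_
    rw [← h3 y, map_sum]
    refine Finset.sum_eq_zero fun j _ => ?_
    by_cases hj : j = -i
    · rw [hj, h0, map_zero]
    · refine killingForm_eq_zero_of_lie ?_ hv (hdeg j y)
      rw [add_comm, Ne, add_eq_zero_iff_eq_neg]
      exact_mod_cast hj
  · rw [h]
    exact ⟨v, hvK, hv0, by simpa using hv⟩

theorem Triple.exists_inner_step {K : Submodule ℂ L} {e h f s z : L} (T : Triple K e h f)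
    (hgen : ∀ W : Submodule ℂ L, (∀ φ, Inner K φ → φ f ∈ W) → K ≤ W)
    (hκ : ∀ x ∈ K, (∀ y ∈ K, killingForm ℂ L x y = 0) → x = 0)
    (hsz : s - z ∈ K) (hz : ∀ k ∈ K, ⁅k, z⁆ = 0) (hs : IntDiag s) :
    ∃ (φ : L ≃ₗ⁅ℂ⁆ L) (M : ℤ), Inner K φ ∧ ⁅φ s, e⁆ = (M : ℂ) • e ∧ ⁅φ s, f⁆ = (-M : ℂ) • f ∧
      Bounded K (φ s) M := by
  have hstab : ∀ φ, Inner K φ → ∀ x ∈ K, ⁅φ s, x⁆ ∈ K := by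
    intro φ hφ x hx
    have h1 : φ s = φ (s - z) + z := by rw [map_sub, hφ.fix z hz, sub_add_cancel]
    rw [h1, add_lie, ← lie_skew z x, hz x hx, neg_zero, add_zero]
    exact T.lie_mem _ ((T.mem_iff hφ _).2 hsz) x hx
  have hpair : ∀ v ∈ K, v ≠ 0 → ∃ φ, Inner K φ ∧ killingForm ℂ L v (φ f) ≠ 0 := by
    intro v hv hv0
    by_contra hcon
    push Not at hcon
    exact hv0 (hκ v hv fun y hy => hgen (LinearMap.ker (killingForm ℂ L v)) hcon hy)
  have hsK : ∀ x ∈ K, ⁅s, x⁆ ∈ K := hstab _ Inner.refl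
  obtain ⟨M, hM, v, hvK, hv0, hv⟩ := exists_bounded hs hsK hκ ⟨e, T.e_mem, T.e_ne_zero⟩
  obtain ⟨φ₁, hφ₁, hne₁⟩ := hpair v hvK hv0
  obtain ⟨x, hxK, hx, hxe, hxκ⟩ := exists_extremal_component hs hsK T.lie_mem hM
    ((T.mem_iff hφ₁ f).2 T.f_mem) (T.extremal_f.map (T.mem_iff hφ₁))
  have hx0 : x ≠ 0 := by
    rintro rfl
    exact hne₁ (by rw [← hxκ v hv, map_zero])
  obtain ⟨φ₂, hφ₂, hne₂⟩ := hpair x hxK hx0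
  have hne₃ : killingForm ℂ L (φ₂.symm x) f ≠ 0 := by
    rwa [← LieAlgebra.killingForm_of_equiv_apply φ₂, LieEquiv.apply_symm_apply]
  obtain ⟨φ₃, c, hφ₃, -, hc, hx3⟩ := T.exists_inner_eq_smul ((T.mem_iff hφ₂.symm x).2 hxK)
    (hxe.map (T.mem_iff hφ₂.symm)) hne₃
  have hΦ := hφ₂.symm.trans hφ₃
  set Φ := φ₂.symm.trans φ₃ with hΦdef
  have hΦx : Φ x = c • e := hx3
  have hse : ⁅Φ s, e⁆ = (M : ℂ) • e := by
    have h1 : e = c⁻¹ • Φ x := by rw [hΦx, inv_smul_smul₀ hc]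
    rw [h1, lie_smul, ← LieEquiv.map_lie, hx, map_smul, smul_comm]
  have hM' := hM.map (T.mem_iff hΦ)
  obtain ⟨y, hyK, hy, hye, hyκ⟩ := exists_extremal_component (hs.map Φ).neg
    (fun x hx => by rw [neg_lie]; exact K.neg_mem (hstab Φ hΦ x hx)) T.lie_mem hM'.neg T.f_mem
    T.extremal_f
  have hey : killingForm ℂ L y e ≠ 0 := by
    rw [LieModule.traceForm_comm]
    rw [hyκ e (by rw [neg_lie, hse, neg_smul])]
    exact T.kappa
  obtain ⟨ψ, d, hψ, hψe, hd, hψy⟩ := T.symm.exists_inner_eq_smul hyK hye hey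
  refine ⟨Φ.trans ψ, M, hΦ.trans hψ, ?_, ?_, hM'.map (T.mem_iff hψ)⟩
  · rw [LieEquiv.trans_apply]
    conv_lhs => rw [← hψe, ← LieEquiv.map_lie, hse, map_smul, hψe]
  · have h1 : f = d⁻¹ • ψ y := by rw [hψy, inv_smul_smul₀ hd]
    rw [neg_lie, neg_eq_iff_eq_neg] at hy
    rw [LieEquiv.trans_apply, h1, lie_smul, ← LieEquiv.map_lie, hy, map_neg, map_smul, neg_smul,
      smul_neg, smul_comm]

end F4

namespace F4

open LieAlgebra

/-- Coordinates of the positive roots with respect to the simple roots. -/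
def rootTable : List (List ℤ) := [
    [1, 0, 0, 0], [0, 1, 0, 0], [0, 0, 1, 0], [0, 0, 0, 1], [1, 1, 0, 0], [0, 1, 1, 0],
    [0, 0, 1, 1], [1, 1, 1, 0], [0, 2, 1, 0], [0, 1, 1, 1], [1, 2, 1, 0], [1, 1, 1, 1],
    [0, 2, 1, 1], [2, 2, 1, 0], [1, 2, 1, 1], [0, 2, 2, 1], [2, 2, 1, 1], [1, 2, 2, 1],
    [2, 2, 2, 1], [1, 3, 2, 1], [2, 3, 2, 1], [2, 4, 2, 1], [2, 4, 3, 1], [2, 4, 3, 2]]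

/-- The coordinate number `c` of the weight of the basis vector number `i`. -/
def wt (c i : ℕ) : ℤ :=
  cond (i.blt 4) 0 (cond (i.blt 28) ((rootTable.getD (i - 4) []).getD c 0)
    (-((rootTable.getD (i - 28) []).getD c 0)))

/-- The degree of the basis vector number `i` when the simple root number `c` has degree `a c`. -/
def dg {R : Type*} [Ring R] (a : ℕ → R) (i : ℕ) : R :=
  a 0 * (wt 0 i : R) + a 1 * (wt 1 i : R) + a 2 * (wt 2 i : R) + a 3 * (wt 3 i : R)

/-- The Cartan matrix of type `F₄`. -/
def cartan (c i : ℕ) : ℤ :=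
  (([[2, -1, 0, 0], [-1, 2, -2, 0], [0, -1, 2, -1], [0, 0, -1, 2]] : List (List ℤ)).getD c
    []).getD i 0

/-- The eigenvalue of the combination `l` of simple coroots on the basis vector number `i`. -/
def pairing (l : Comb) (i : ℕ) : ℤ := l.foldr (fun p a => p.2 * dg (cartan p.1) i + a) 0

theorem sc_cartan : ∀ c < 4, ∀ i < 52, Comb.eqv (sc c i) [(i, dg (cartan c) i)] = true := by
  decide +kernel

/-- The table of values of the Killing form. -/
def killTable : List ℤ := [36, 36, 18, 18, -36, -36, -18, 36, 18, 36, -36, -36, -18, 18, 36, 18, -18, -36, 18, 36, -36, 18, -18, 18]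

/-- The values of the Killing form on the basis. -/
def kill (i j : ℕ) : ℤ :=
  cond (i.blt 4) (cond (j.blt 4)
      ((([[72, -36, 0, 0], [-36, 72, -36, 0], [0, -36, 36, -18], [0, 0, -18, 36]] :
        List (List ℤ)).getD i []).getD j 0) 0)
    (cond (j.beq (i + 24)) (killTable.getD (i - 4) 0)
      (cond (j.blt 4) 0 (cond (i.beq (j + 24)) (killTable.getD (j - 4) 0) 0)))

theorem kill_weight : ∀ i < 52, ∀ j < 52,
    kill i j = (List.range 52).foldr (fun k a => Comb.coeff (Comb.lie sc [(i, 1)] (sc j k)) k + a) 0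
      ∨ kill i j = 0 ∧ ∃ c < 4, dg (cartan c) i + dg (cartan c) j ≠ 0 := by
  have h : ∀ i < 52, ∀ j < 52,
    (kill i j = 0 ∧ ∃ c < 4, dg (cartan c) i + dg (cartan c) j ≠ 0) ∨
    kill i j = (List.range 52).foldr (fun k a => Comb.coeff (Comb.lie sc [(i, 1)] (sc j k)) k + a) 0
      := by decide +kernel
  exact fun i hi j hj => (h i hi j hj).symm

variable {L : Type*} [LieRing L] [LieAlgebra ℂ L] {b : ℕ → L}

namespace IsF4Basis

variable (hb : IsF4Basis b)
include hb

theorem cartan_lie {c : ℕ} (hc : c < 4) (i : ℕ) : ⁅b c, b i⁆ = ((dg (cartan c) i : ℤ) : ℂ) • b i := by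
  by_cases hi : i < 52
  · exact lie_eq_smul hb.lie _ _ (sc_cartan c hc i hi)
  · rw [hb.eq_zero i (by omega), lie_zero, smul_zero]

theorem lie_pairing {l : Comb} (hl : ∀ p ∈ l, p.1 < 4) (i : ℕ) :
    ⁅ev b l, b i⁆ = (pairing l i : ℂ) • b i := by
  induction l with
  | nil => simp [pairing]
  | cons p l ih =>
    have h : pairing (p :: l) i = p.2 * dg (cartan p.1) i + pairing l i := rfl
    rw [h, ev_cons, add_lie, ih fun q hq => hl q (by simp [hq]), zsmul_lie,
      hb.cartan_lie (hl p (by simp))]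
    push_cast
    module

/-- The basis as a `Module.Basis`. -/
noncomputable def toBasis : Module.Basis (Fin 52) ℂ L :=
  Module.Basis.mk hb.linearIndependent hb.span_eq_top.ge

theorem toBasis_apply (i : Fin 52) : hb.toBasis i = b i := Module.Basis.mk_apply _ _ i

theorem finiteDimensional : FiniteDimensional ℂ L := Module.Finite.of_basis hb.toBasis

theorem ne_zero {i : ℕ} (hi : i < 52) : b i ≠ 0 := hb.linearIndependent.ne_zero ⟨i, hi⟩

theorem repr_ev (l : Comb) (k : Fin 52) : hb.toBasis.repr (ev b l) k = (Comb.coeff l k : ℂ) := by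
  induction l with
  | nil => simp [Comb.coeff]
  | cons p l ih =>
    rw [Comb.coeff_cons, ev_cons, map_add, Finsupp.add_apply, ih, ← Int.cast_smul_eq_zsmul ℂ,
      map_smul, Finsupp.smul_apply]
    push_cast
    congr 1
    by_cases hp : p.1 < 52
    · have := hb.toBasis_apply ⟨p.1, hp⟩
      rw [← this, Module.Basis.repr_self, Finsupp.single_apply]
      simp [Fin.ext_iff]
    · rw [hb.eq_zero _ (by omega), map_zero, if_neg (by omega)]
      simp

theorem killingForm_eq {i j : ℕ} (hi : i < 52) (hj : j < 52) :
    killingForm ℂ L (b i) (b j) = (kill i j : ℂ) := by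
  rcases kill_weight i hi j hj with h | ⟨h, c, hc, hne⟩
  · rw [LieModule.traceForm_apply_apply, LinearMap.trace_eq_matrix_trace ℂ hb.toBasis, Matrix.trace]
    have key : ∀ k : Fin 52, Matrix.diag (LinearMap.toMatrix hb.toBasis hb.toBasis
        ((LieModule.toEnd ℂ L L) (b i) ∘ₗ (LieModule.toEnd ℂ L L) (b j))) k =
        (Comb.coeff (Comb.lie sc [(i, 1)] (sc j k)) k : ℂ) := by
      intro k
      rw [Matrix.diag_apply, LinearMap.toMatrix_apply, LinearMap.comp_apply,
        LieModule.toEnd_apply_apply, LieModule.toEnd_apply_apply, toBasis_apply, hb.lie j,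
        ← hb.repr_ev, ← lie_ev (hb.lie i), one_smul]
    rw [Finset.sum_congr rfl fun k _ => key k,
      Fin.sum_univ_eq_sum_range (fun k => (Comb.coeff (Comb.lie sc [(i, 1)] (sc j k)) k : ℂ)), h]
    have aux : ∀ (f : ℕ → ℤ) (n : ℕ), ∑ k ∈ Finset.range n, (f k : ℂ) =
        (((List.range n).foldr (fun k a => f k + a) 0 : ℤ) : ℂ) := by
      intro f n
      rw [← Int.cast_sum]
      congr 1
      rw [← List.foldr_map, Finset.sum_eq_multiset_sum]
      rfl
    exact aux _ 52
  · rw [h, Int.cast_zero]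
    refine killingForm_eq_zero_of_lie ?_ (hb.cartan_lie hc i) (hb.cartan_lie hc j)
    exact_mod_cast hne

end IsF4Basis

end F4

namespace F4

open LieAlgebra

theorem ev_mem_of {R M : Type*} [Ring R] [AddCommGroup M] [Module R M] {x : ℕ → M}
    (W : Submodule R M) {l : Comb} (h : ∀ p ∈ l, p.2 = 0 ∨ x p.1 ∈ W) : ev x l ∈ W := by
  induction l with
  | nil => simp
  | cons p l ih =>
    rw [ev_cons]
    refine W.add_mem ?_ (ih fun q hq => h q (by simp [hq]))
    rcases h p (by simp) with h | h
    · rw [h, zero_smul]; exact W.zero_mem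
    · exact W.toAddSubgroup.zsmul_mem h _

/-- Successive adjunction of targets of moves whose source has been reached. -/
def grow (mv : List (ℕ × ℕ × ℕ)) (S : List ℕ) : List ℕ :=
  mv.foldl (fun S m => cond (S.elem m.2.1) (m.2.2 :: S) S) S

theorem of_mem_grow {P : ℕ → Prop} (mv : List (ℕ × ℕ × ℕ)) (S : List ℕ) (hS : ∀ i ∈ S, P i)
    (h : ∀ m ∈ mv, P m.2.1 → P m.2.2) : ∀ i ∈ grow mv S, P i := by
  induction mv generalizing S with
  | nil => exact hS
  | cons m mv ih =>
    refine ih _ ?_ fun q hq => h q (by simp [hq])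
    dsimp only
    rcases hm : S.elem m.2.1 with _ | _
    · exact hS
    · intro i hi
      rw [cond_true] at hi
      rcases List.mem_cons.1 hi with rfl | hi
      · exact h m (by simp) (hS _ (List.elem_iff.1 hm))
      · exact hS i hi

/-- The value of the Killing form at a basis vector and a formal combination. -/
def killEv (j : ℕ) (d : Comb) : ℤ := d.foldr (fun p a => p.2 * kill j p.1 + a) 0

/-- The combination `2 b_i - m h` for `h` given by `l` with `m` the eigenvalue of `b_i` on `b_j`. -/
def orth (l : Comb) (i j : ℕ) : Comb :=
  Comb.norm ((i, 2) :: Comb.smul (-Comb.coeff (sc i j) j) l)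

/-- Combinatorial data for a subalgebra spanned by the basis vectors in `I`, with highest and lowest
root vectors number `β` and `γ` and corresponding coroot `l`, such that `I'` spans the
centralizer of the highest root `sl₂`. -/
structure Link (I I' : List ℕ) (β γ : ℕ) (l : Comb) (D : ℕ → Comb) (mv : List (ℕ × ℕ × ℕ)) :
    Prop where
  lt : ∀ i ∈ I, i < 52
  beta_mem : β ∈ I
  gamma_mem : γ ∈ I
  coroot_mem : ∀ p ∈ l, p.1 ∈ I ∧ p.1 < 4
  closed : ∀ i ∈ I, ∀ j ∈ I, ∀ p ∈ sc i j, p.1 ∈ I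
  lie_eq : Comb.eqv (sc β γ) l = true
  kill_ne : kill β γ ≠ 0
  pairing_beta : pairing l β = 2
  pairing_gamma : pairing l γ = -2
  dec : ∀ i ∈ I, i = β ∨ i = γ ∨ pairing l i = 1 ∨ pairing l i = -1 ∨
    (pairing l i = 0 ∧ ∀ p ∈ orth l i β, p.2 = 0 ∨ p.1 ∈ I')
  sub : ∀ i ∈ I', i ∈ I
  comm : ∀ i ∈ I', Comb.isZero (sc i β) = true ∧ Comb.isZero (sc i γ) = true
  dual : ∀ i ∈ I, (∀ p ∈ D i, p.1 ∈ I) ∧ ∀ j ∈ I, (killEv j (D i) = 0 ↔ i ≠ j)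
  grow : ∀ i ∈ I, i ∈ grow mv [γ]
  move : ∀ m ∈ mv, m.1 ∈ I ∧ (∃ c < 4, dg (cartan c) m.1 ≠ 0) ∧
    Comb.isZero (Comb.lie sc [(m.1, 1)] (Comb.lie sc [(m.1, 1)] (sc m.1 m.2.1))) = true ∧
    ∃ n ∈ [1, 2, -1, -2], Comb.eqv (sc m.1 m.2.1) [(m.2.2, n)] = true

variable {L : Type*} [LieRing L] [LieAlgebra ℂ L] {b : ℕ → L}

/-- The span of the basis vectors with index in `I`. -/
def spanOf (b : ℕ → L) (I : List ℕ) : Submodule ℂ L := Submodule.span ℂ (b '' {i | i ∈ I})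

section spanOf

variable {I : List ℕ}

theorem mem_spanOf {i : ℕ} (hi : i ∈ I) : b i ∈ spanOf b I := Submodule.subset_span ⟨i, hi, rfl⟩

theorem spanOf_le {W : Submodule ℂ L} (h : ∀ i ∈ I, b i ∈ W) : spanOf b I ≤ W := by
  rw [spanOf, Submodule.span_le]
  rintro _ ⟨i, hi, rfl⟩
  exact h i hi

theorem IsF4Basis.killingForm_ev (hb : IsF4Basis b) {j : ℕ} (hj : j < 52) {d : Comb}
    (hd : ∀ p ∈ d, p.1 < 52) : killingForm ℂ L (b j) (ev b d) = (killEv j d : ℂ) := by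
  induction d with
  | nil => simp [killEv]
  | cons p d ih =>
    have h : killEv j (p :: d) = p.2 * kill j p.1 + killEv j d := rfl
    rw [h, ev_cons, map_add, ih fun q hq => hd q (by simp [hq]), ← Int.cast_smul_eq_zsmul ℂ,
      map_smul, hb.killingForm_eq hj (hd p (by simp))]
    push_cast
    rfl

theorem IsF4Basis.eq_zero_of_killingForm (hb : IsF4Basis b) {D : ℕ → Comb} (hI : ∀ i ∈ I, i < 52)
    (hD : ∀ i ∈ I, (∀ p ∈ D i, p.1 ∈ I) ∧ ∀ j ∈ I, (killEv j (D i) = 0 ↔ i ≠ j)) {x : L}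
    (hx : x ∈ spanOf b I) (h : ∀ y ∈ spanOf b I, killingForm ℂ L x y = 0) : x = 0 := by
  have hI' : {i | i ∈ I} = (I.toFinset : Set ℕ) := by ext; simp
  rw [spanOf, hI', Submodule.mem_span_image_finset_iff_exists_fun] at hx
  obtain ⟨c, rfl⟩ := hx
  refine Finset.sum_eq_zero fun i₀ _ => ?_
  obtain ⟨i, hi⟩ := i₀
  rw [List.mem_toFinset] at hi
  have h1 := h (ev b (D i)) (ev_mem _ _ fun p hp => mem_spanOf ((hD i hi).1 p hp))
  rw [map_sum, LinearMap.sum_apply, Finset.sum_eq_single ⟨i, List.mem_toFinset.2 hi⟩] at h1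
  · rw [map_smul, LinearMap.smul_apply, hb.killingForm_ev (hI i hi)
      fun p hp => hI _ ((hD i hi).1 p hp), smul_eq_mul, mul_eq_zero] at h1
    rcases h1 with h1 | h1
    · rw [h1, zero_smul]
    · exact absurd rfl (((hD i hi).2 i hi).1 (by exact_mod_cast h1))
  · rintro ⟨j, hj⟩ - hji
    rw [List.mem_toFinset] at hj
    rw [map_smul, LinearMap.smul_apply, hb.killingForm_ev (hI j hj)
      fun p hp => hI _ ((hD i hi).1 p hp), ((hD i hi).2 j hj).2 fun h => hji (Subtype.ext h.symm), Int.cast_zero, smul_zero]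
  · intro hi'
    exact absurd (Finset.mem_univ _) hi'

end spanOf

namespace Link

variable {I I' : List ℕ} {β γ : ℕ} {l : Comb} {D : ℕ → Comb} {mv : List (ℕ × ℕ × ℕ)}
  (hl : Link I I' β γ l D mv)
include hl

theorem le : spanOf b I' ≤ spanOf b I := spanOf_le fun i hi => mem_spanOf (hl.sub i hi)

theorem coroot_mem_spanOf : ev b l ∈ spanOf b I :=
  ev_mem _ _ fun p hp => mem_spanOf (hl.coroot_mem p hp).1

variable (hb : IsF4Basis b)
include hb

theorem lie_coroot (i : ℕ) : ⁅ev b l, b i⁆ = (pairing l i : ℂ) • b i :=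
  hb.lie_pairing (fun p hp => (hl.coroot_mem p hp).2) i

theorem lie_beta : ⁅ev b l, b β⁆ = (2 : ℂ) • b β := by
  rw [hl.lie_coroot hb, hl.pairing_beta]; norm_num

theorem lie_gamma : ⁅ev b l, b γ⁆ = (-2 : ℂ) • b γ := by
  rw [hl.lie_coroot hb, hl.pairing_gamma]; norm_num

theorem lie_beta_gamma : ⁅b β, b γ⁆ = ev b l := by
  rw [hb.lie, ev_eq_of_eqv b hl.lie_eq]

theorem lie_mem {x y : L} (hx : x ∈ spanOf b I) (hy : y ∈ spanOf b I) : ⁅x, y⁆ ∈ spanOf b I := by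
  refine lie_mem_of_span_left rfl ?_ hx
  rintro _ ⟨i, hi, rfl⟩
  refine lie_mem_of_span rfl ?_ hy
  rintro _ ⟨j, hj, rfl⟩
  rw [hb.lie]
  exact ev_mem _ _ fun p hp => mem_spanOf (hl.closed i hi j hj p hp)

theorem lie_eq_zero_of_mem {x : L} (hx : x ∈ spanOf b I') :
    ⁅x, b β⁆ = 0 ∧ ⁅x, b γ⁆ = 0 ∧ ⁅x, ev b l⁆ = 0 := by
  have h1 : ⁅x, b β⁆ = 0 := by
    have := lie_mem_of_span_left (W := ⊥) (x := b β) (y := x) rfl ?_ hx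
    · simpa using this
    · rintro _ ⟨i, hi, rfl⟩
      rw [hb.lie, ev_eq_zero_of_isZero b (hl.comm i hi).1]
      exact Submodule.zero_mem _
  have h2 : ⁅x, b γ⁆ = 0 := by
    have := lie_mem_of_span_left (W := ⊥) (x := b γ) (y := x) rfl ?_ hx
    · simpa using this
    · rintro _ ⟨i, hi, rfl⟩
      rw [hb.lie, ev_eq_zero_of_isZero b (hl.comm i hi).2]
      exact Submodule.zero_mem _
  refine ⟨h1, h2, ?_⟩
  rw [← hl.lie_beta_gamma hb, leibniz_lie, h1, h2, zero_lie, lie_zero, add_zero]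

theorem exists_decomposition {x : L} (hx : x ∈ spanOf b I) : ∃ (c a d : ℂ) (x₁ z y₁ : L),
    x₁ ∈ spanOf b I ∧ z ∈ spanOf b I' ∧ y₁ ∈ spanOf b I ∧ ⁅ev b l, x₁⁆ = x₁ ∧ ⁅ev b l, y₁⁆ = -y₁ ∧
      x = c • b β + x₁ + (a • ev b l + z) + y₁ + d • b γ := by
  induction hx using Submodule.span_induction with
  | mem x hx =>
    obtain ⟨i, hi, rfl⟩ := hx
    rcases hl.dec i hi with rfl | rfl | h | h | ⟨h, hz⟩
    · exact ⟨1, 0, 0, 0, 0, 0, zero_mem _, zero_mem _, zero_mem _, by simp, by simp, by module⟩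
    · exact ⟨0, 0, 1, 0, 0, 0, zero_mem _, zero_mem _, zero_mem _, by simp, by simp, by module⟩
    · refine ⟨0, 0, 0, b i, 0, 0, mem_spanOf hi, zero_mem _, zero_mem _, ?_, by simp, by module⟩
      rw [hl.lie_coroot hb, h, Int.cast_one, one_smul]
    · refine ⟨0, 0, 0, 0, 0, b i, zero_mem _, zero_mem _, mem_spanOf hi, by simp, ?_, by module⟩
      rw [hl.lie_coroot hb, h]; push_cast; module
    · have hm : ev b (orth l i β) ∈ spanOf b I' :=
        ev_mem_of _ fun p hp => (hz p hp).imp_right fun h => mem_spanOf h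
      refine ⟨0, (Comb.coeff (sc i β) β : ℂ) / 2, 0, 0, (2⁻¹ : ℂ) • ev b (orth l i β), 0, zero_mem _,
        Submodule.smul_mem _ _ hm, zero_mem _, by simp, by simp, ?_⟩
      rw [orth, ev_norm, ev_cons, ev_smul, neg_smul, ← Int.cast_smul_eq_zsmul ℂ,
        ← Int.cast_smul_eq_zsmul ℂ]
      push_cast
      module
  | zero =>
    exact ⟨0, 0, 0, 0, 0, 0, zero_mem _, zero_mem _, zero_mem _, by simp, by simp, by module⟩
  | add x y _ _ hx hy =>
    obtain ⟨c, a, d, x₁, z, y₁, h1, h2, h3, h4, h5, rfl⟩ := hx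
    obtain ⟨c', a', d', x₁', z', y₁', h1', h2', h3', h4', h5', rfl⟩ := hy
    refine ⟨c + c', a + a', d + d', x₁ + x₁', z + z', y₁ + y₁', add_mem h1 h1', add_mem h2 h2',
      add_mem h3 h3', by rw [lie_add, h4, h4'], by rw [lie_add, h5, h5']; module, by module⟩
  | smul r x _ hx =>
    obtain ⟨c, a, d, x₁, z, y₁, h1, h2, h3, h4, h5, rfl⟩ := hx
    exact ⟨r * c, r * a, r * d, r • x₁, r • z, r • y₁, Submodule.smul_mem _ _ h1,
      Submodule.smul_mem _ _ h2, Submodule.smul_mem _ _ h3, by rw [lie_smul, h4],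
      by rw [lie_smul, h5]; module, by module⟩

theorem exists_of_lie_eq_zero {x : L} (hx : x ∈ spanOf b I) (h : ⁅ev b l, x⁆ = 0) :
    ∃ (a : ℂ) (z : L), z ∈ spanOf b I' ∧ x = a • ev b l + z := by
  obtain ⟨c, a, d, x₁, z, y₁, -, h2, -, h4, h5, rfl⟩ := hl.exists_decomposition hb hx
  have hz : ⁅ev b l, z⁆ = 0 := by rw [← lie_skew, (hl.lie_eq_zero_of_mem hb h2).2.2, neg_zero]
  simp only [lie_add, lie_smul, hl.lie_beta hb, hl.lie_gamma hb, h4, h5, hz, lie_self] at h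
  have he : ⁅ev b l, c • b β⁆ = (2 : ℂ) • c • b β := by
    rw [lie_smul, hl.lie_beta hb]; module
  have hf : ⁅ev b l, d • b γ⁆ = (-2 : ℂ) • d • b γ := by
    rw [lie_smul, hl.lie_gamma hb]; module
  obtain ⟨e1, e2, -, e4, e5⟩ := eq_zero_of_five (h := ev b l) (x₂ := (2 : ℂ) • c • b β) (x₁ := x₁)
    (x₀ := 0) (y₁ := -y₁) (y₂ := (-2 : ℂ) • d • b γ) (by rw [lie_smul, he]) h4 (lie_zero _)
    (by rw [lie_neg, h5]) (by rw [lie_smul, hf]) (by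
      refine Eq.trans ?_ h; module)
  refine ⟨a, z, h2, ?_⟩
  have e1 := (smul_eq_zero.1 e1).resolve_left (by norm_num)
  have e5 := (smul_eq_zero.1 e5).resolve_left (by norm_num)
  rw [e1, e5, e2, neg_eq_zero.1 e4]
  module

theorem triple : Triple (spanOf b I) (b β) (ev b l) (b γ) where
  e_mem := mem_spanOf hl.beta_mem
  h_mem := hl.coroot_mem_spanOf
  f_mem := mem_spanOf hl.gamma_mem
  lie_mem _ hx _ hy := hl.lie_mem hb hx hy
  he := hl.lie_beta hb
  hf := hl.lie_gamma hb
  ef := hl.lie_beta_gamma hb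
  dec x hx := by
    obtain ⟨c, a, d, x₁, z, y₁, h1, h2, h3, h4, h5, rfl⟩ := hl.exists_decomposition hb hx
    refine ⟨c, d, x₁, a • ev b l + z, y₁, h1, add_mem (Submodule.smul_mem _ _
      hl.coroot_mem_spanOf) (hl.le h2), h3, h4, ?_, h5, rfl⟩
    rw [lie_add, lie_smul, lie_self, ← lie_skew, (hl.lie_eq_zero_of_mem hb h2).2.2]
    module
  cent x hx h := by
    obtain ⟨a, z, hz, rfl⟩ := hl.exists_of_lie_eq_zero hb hx h
    exact ⟨a, z, rfl, (hl.lie_eq_zero_of_mem hb hz).1, (hl.lie_eq_zero_of_mem hb hz).2.1⟩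
  kappa := by
    rw [hb.killingForm_eq (hl.lt _ hl.beta_mem) (hl.lt _ hl.gamma_mem)]
    exact_mod_cast hl.kill_ne

theorem mem_of_lie_eq_zero {x : L} (hx : x ∈ spanOf b I) (he : ⁅x, b β⁆ = 0) (hf : ⁅x, b γ⁆ = 0) :
    x ∈ spanOf b I' := by
  obtain ⟨a, z, hz, rfl⟩ := hl.exists_of_lie_eq_zero hb hx (by
    rw [← lie_skew, ← hl.lie_beta_gamma hb, leibniz_lie, he, hf, zero_lie, lie_zero, add_zero,
      neg_zero])
  rw [add_lie, (hl.lie_eq_zero_of_mem hb hz).1, add_zero, smul_lie, hl.lie_beta hb, smul_smul] at he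
  have h2 := (smul_eq_zero.1 he).resolve_right (hb.ne_zero (hl.lt _ hl.beta_mem))
  have h3 : a = 0 := by simpa using h2
  rwa [h3, zero_smul, zero_add]

theorem le_of_inner [FiniteDimensional ℂ L] (W : Submodule ℂ L)
    (hW : ∀ φ, Inner (spanOf b I) φ → φ (b γ) ∈ W) : spanOf b I ≤ W := by
  have key : ∀ i ∈ I, ∀ φ, Inner (spanOf b I) φ → φ (b i) ∈ W := by
    intro i hi
    refine of_mem_grow (P := fun i => ∀ φ, Inner (spanOf b I) φ → φ (b i) ∈ W) mv [γ] ?_ ?_ i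
      (hl.grow i hi)
    · intro j hj
      rw [List.mem_singleton.1 hj]
      exact hW
    · intro m hm h φ hφ
      obtain ⟨hu, ⟨c, hc, hne⟩, hz, n, hn, hs⟩ := hl.move m hm
      have hnil : IsNilpotent (ad ℂ L (b m.1)) :=
        isNilpotent_ad_of_lie_eq_smul (by exact_mod_cast hne) (hb.cartan_lie hc m.1)
      have h3 : ⁅b m.1, ⁅b m.1, ⁅b m.1, b m.2.1⁆⁆⁆ = 0 := by
        have := ev_eq_zero_of_isZero b hz
        rwa [← lie_ev (hb.lie _), ← lie_ev (hb.lie _), one_smul, ← hb.lie] at this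
      have h1 := h _ ((Inner.adExp hnil (mem_spanOf hu)).trans hφ)
      have h2 := h _ ((Inner.adExp (isNilpotent_ad_neg hnil)
        (Submodule.neg_mem _ (mem_spanOf hu))).trans hφ)
      rw [LieEquiv.trans_apply, adExp_apply_eq_add_add _ h3] at h1
      rw [LieEquiv.trans_apply, adExp_apply_eq_add_add _ (by
        simp only [neg_lie, lie_neg, neg_neg, h3, neg_zero])] at h2
      have h4 := W.smul_mem (2⁻¹ : ℂ) (W.sub_mem h1 h2)
      have hn0 : (n : ℂ) ≠ 0 := by
        have : n ≠ 0 := by rintro rfl; simp at hn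
        exact_mod_cast this
      have h5 : φ (b m.2.2) = (n : ℂ)⁻¹ • (2⁻¹ : ℂ) • (φ (b m.2.1 + ⁅b m.1, b m.2.1⁆ +
          (2⁻¹ : ℂ) • ⁅b m.1, ⁅b m.1, b m.2.1⁆⁆) - φ (b m.2.1 + ⁅-b m.1, b m.2.1⁆ +
          (2⁻¹ : ℂ) • ⁅-b m.1, ⁅-b m.1, b m.2.1⁆⁆)) := by
        rw [← map_sub, ← map_smul, ← map_smul, eq_comm]
        congr 1
        have : ⁅b m.1, b m.2.1⁆ = (n : ℂ) • b m.2.2 := lie_eq_smul hb.lie _ _ hs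
        simp only [neg_lie, lie_neg, neg_neg, this]
        rw [add_sub_add_right_eq_sub, add_sub_add_left_eq_sub, sub_neg_eq_add, ← two_smul ℂ,
          smul_smul, smul_smul, smul_smul]
        rw [inv_mul_cancel_right₀ two_ne_zero, inv_mul_cancel₀ hn0, one_smul]
      rw [h5]
      exact W.smul_mem _ h4
  exact spanOf_le fun i hi => key i hi LieEquiv.refl Inner.refl

theorem step [FiniteDimensional ℂ L] {s z : L} (hsz : s - z ∈ spanOf b I)
    (hz : ∀ k ∈ spanOf b I, ⁅k, z⁆ = 0) (hs : IntDiag s) : ∃ (φ : L ≃ₗ⁅ℂ⁆ L) (M : ℤ),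
      Inner (spanOf b I) φ ∧ φ s - (z + (M / 2 : ℂ) • ev b l) ∈ spanOf b I' ∧
      (∀ k ∈ spanOf b I', ⁅k, z + (M / 2 : ℂ) • ev b l⁆ = 0) ∧
      Bounded (spanOf b I) (φ s) M ∧ IntDiag (φ s) := by
  obtain ⟨φ, M, h1, h2, h3, h4⟩ := (hl.triple hb).exists_inner_step (hl.le_of_inner hb)
    (fun x hx => hb.eq_zero_of_killingForm hl.lt hl.dual hx) hsz hz hs
  have hze : ∀ k ∈ spanOf b I, ⁅z, k⁆ = 0 := fun k hk => by
    rw [← lie_skew, hz k hk, neg_zero]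
  refine ⟨φ, M, h1, hl.mem_of_lie_eq_zero hb ?_ ?_ ?_, ?_, h4, hs.map φ⟩
  · have h5 : φ s - (z + (M / 2 : ℂ) • ev b l) = φ (s - z) - (M / 2 : ℂ) • ev b l := by
      rw [map_sub, h1.fix z hz]; module
    rw [h5]
    exact sub_mem (((hl.triple hb).mem_iff h1 _).2 hsz)
      (Submodule.smul_mem _ _ hl.coroot_mem_spanOf)
  · rw [sub_lie, add_lie, h2, hze _ (mem_spanOf hl.beta_mem), smul_lie, hl.lie_beta hb]
    module
  · rw [sub_lie, add_lie, h3, hze _ (mem_spanOf hl.gamma_mem), smul_lie, hl.lie_gamma hb]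
    module
  · intro k hk
    rw [lie_add, lie_smul, hz k (hl.le hk), (hl.lie_eq_zero_of_mem hb hk).2.2]
    module

end Link

end F4

namespace F4

open LieAlgebra

/-- The formal combinations dual to the basis with respect to the Killing form, up to scaling, when
`D` is dual to the simple coroots. -/
def killDual (D : List Comb) (i : ℕ) : Comb :=
  cond (i.blt 4) (D.getD i []) (cond (i.blt 28) [(i + 24, 1)] [(i - 24, 1)])

/-- Raising moves generating the Lie algebra from the lowest root vector. -/
def moves : List (ℕ × ℕ × ℕ) := [
    (7, 51, 50), (6, 50, 49), (5, 49, 48), (4, 48, 47), (5, 48, 46), (5, 47, 45), (6, 46, 44), (4,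
    45, 43), (6, 45, 42), (7, 44, 41), (6, 43, 40), (5, 42, 39), (7, 42, 38), (5, 40, 37), (7, 40,
    36), (7, 39, 35), (5, 37, 34), (7, 37, 33), (6, 35, 32), (6, 34, 31), (7, 34, 30), (6, 33, 29),
    (5, 32, 28), (7, 31, 3), (6, 30, 2), (5, 29, 1), (4, 28, 0), (6, 3, 6), (7, 3, 7), (5, 2, 5),
    (4, 1, 4), (5, 6, 9), (7, 6, 10), (4, 5, 8), (4, 9, 11), (5, 9, 12), (7, 9, 13), (5, 11, 14),
    (7, 11, 15), (7, 12, 16), (4, 14, 17), (7, 14, 18), (6, 16, 19), (7, 17, 20), (6, 18, 21), (6,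
    20, 22), (5, 21, 23), (5, 22, 24), (5, 24, 25), (6, 25, 26), (7, 26, 27)]

theorem link_zero : Link (List.range 52)
    [0, 1, 2, 4, 5, 6, 8, 9, 11, 12, 14, 17, 28, 29, 30, 32, 33, 35, 36, 38, 41] 27 51
    [(0, 1), (1, 2), (2, 3), (3, 2)]
    (killDual [[(0, 2), (1, 3), (2, 4), (3, 2)], [(0, 3), (1, 6), (2, 8), (3, 4)], [(0, 2), (1, 4), (2, 6), (3, 3)], [(0, 1), (1, 2), (2, 3), (3, 2)]])
    moves := by
  constructor <;> decide +kernel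

theorem link_one : Link [0, 1, 2, 4, 5, 6, 8, 9, 11, 12, 14, 17, 28, 29, 30, 32, 33, 35, 36, 38, 41]
    [1, 2, 5, 6, 9, 12, 29, 30, 33, 36] 17 41
    [(0, 1), (1, 1), (2, 1)]
    (killDual [[(0, 1), (1, 1), (2, 1)], [(0, 1), (1, 2), (2, 2)], [(0, 1), (1, 2), (2, 3)], []])
    
    [(4, 41, 38), (4, 38, 36), (5, 38, 35), (5, 36, 33), (6, 35, 32), (5, 33, 30), (6, 33, 29), (5,
    32, 28), (6, 30, 2), (5, 29, 1), (4, 28, 0), (5, 2, 5), (6, 2, 6), (4, 1, 4), (4, 5, 8), (6, 5,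
    9), (6, 8, 11), (5, 9, 12), (5, 11, 14), (4, 14, 17)] := by
  constructor <;> decide +kernel

theorem link_two : Link [1, 2, 5, 6, 9, 12, 29, 30, 33, 36]
    [2, 6, 30] 12 36
    [(1, 1), (2, 1)]
    (killDual [[], [(1, 1), (2, 1)], [(1, 1), (2, 2)], []])
    
    [(5, 36, 33), (5, 33, 30), (6, 33, 29), (6, 30, 2), (5, 29, 1), (5, 2, 5), (6, 2, 6), (6, 5,
    9), (5, 9, 12)] := by
  constructor <;> decide +kernel

theorem link_three : Link [2, 6, 30]
    [] 6 30
    [(2, 1)]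
    (killDual [[], [], [(2, 1)], []])
    
    [(6, 30, 2), (6, 2, 6)] := by
  constructor <;> decide +kernel

variable {L : Type*} [LieRing L] [LieAlgebra ℂ L] {b : ℕ → L}

theorem IntDiag.exists_eq_intCast [FiniteDimensional ℂ L] {s x : L} (hs : IntDiag s) (hx : x ≠ 0)
    {μ : ℂ} (h : ⁅s, x⁆ = μ • x) : ∃ n : ℤ, μ = n := by
  obtain ⟨N, π, h1, -, h3, h4, -⟩ := exists_proj hs
  have h5 : ∃ i ∈ Finset.Icc (-(N : ℤ)) N, π i x ≠ 0 := by
    by_contra! hc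
    exact hx (by rw [← h3 x, Finset.sum_eq_zero hc])
  obtain ⟨i, -, hi⟩ := h5
  have h6 := h4 ((ad ℂ L s).eigenspace μ) (fun y hy => by
    rw [Module.End.mem_eigenspace_iff] at hy ⊢
    rw [hy, map_smul, hy]) i x (Module.End.mem_eigenspace_iff.2 h)
  rw [Module.End.mem_eigenspace_iff, h1, ← sub_eq_zero, ← sub_smul] at h6
  exact ⟨i, (sub_eq_zero.1 ((smul_eq_zero.1 h6).resolve_right hi)).symm⟩

namespace IsF4Basis

theorem map {L' : Type*} [LieRing L'] [LieAlgebra ℂ L'] (hb : IsF4Basis b) (φ : L ≃ₗ⁅ℂ⁆ L') :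
    IsF4Basis fun i => φ (b i) where
  lie i j := by rw [← LieEquiv.map_lie, hb.lie, map_ev]
  eq_zero i hi := by rw [hb.eq_zero i hi, map_zero]
  linearIndependent := hb.linearIndependent.map' (φ : L →ₗ[ℂ] L')
    (LinearMap.ker_eq_bot.2 φ.injective)
  span_eq_top := by
    have h : (Set.range fun i : Fin 52 => φ (b i)) =
        (φ : L →ₗ[ℂ] L') '' Set.range fun i : Fin 52 => b i := by
      rw [← Set.range_comp]; rfl
    rw [h, Submodule.span_image, hb.span_eq_top, Submodule.map_top, LinearMap.range_eq_top]
    exact φ.surjective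

theorem spanOf_range (hb : IsF4Basis b) : spanOf b (List.range 52) = ⊤ := by
  rw [eq_top_iff, ← hb.span_eq_top, Submodule.span_le]
  rintro _ ⟨i, rfl⟩
  exact mem_spanOf (List.mem_range.2 i.2)

theorem isKilling (hb : IsF4Basis b) : IsKilling ℂ L where
  killingCompl_top_eq_bot := by
    rw [eq_bot_iff]
    intro x hx
    rw [LieIdeal.mem_killingCompl] at hx
    rw [LieSubmodule.mem_bot]
    refine hb.eq_zero_of_killingForm link_zero.lt link_zero.dual (hb.spanOf_range ▸ trivial) ?_
    intro y _
    rw [LieModule.traceForm_comm]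
    exact hx y trivial

/-- Every semisimple element with integer eigenvalues is conjugate to a dominant element of the
standard Cartan subalgebra. -/
theorem exists_dominant (hb : IsF4Basis b) {s : L} (hs : IntDiag s) :
    ∃ b' : ℕ → L, IsF4Basis b' ∧ ∃ a : ℕ → ℤ, (∀ c < 4, 0 ≤ a c) ∧
      ∀ i, ⁅s, b' i⁆ = ((dg a i : ℤ) : ℂ) • b' i := by
  have := hb.finiteDimensional
  obtain ⟨φ₀, M₀, i₀, m₀, z₀, B₀, d₀⟩ := link_zero.step hb (s := s) (z := 0)
    (hb.spanOf_range ▸ trivial) (fun k _ => lie_zero k) hs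
  obtain ⟨φ₁, M₁, i₁, m₁, z₁, B₁, d₁⟩ := link_one.step hb m₀ z₀ d₀
  obtain ⟨φ₂, M₂, i₂, m₂, z₂, B₂, d₂⟩ := link_two.step hb m₁ z₁ d₁
  obtain ⟨φ₃, M₃, i₃, m₃, z₃, B₃, d₃⟩ := link_three.step hb m₂ z₂ d₂
  replace B₂ := B₂.map ((link_two.triple hb).mem_iff (i₃.mono link_two.le))
  replace B₁ := (B₁.map ((link_one.triple hb).mem_iff (i₂.mono link_one.le))).map
    ((link_one.triple hb).mem_iff (i₃.mono (link_two.le.trans link_one.le)))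
  replace B₀ := ((B₀.map ((link_zero.triple hb).mem_iff (i₁.mono link_zero.le))).map
    ((link_zero.triple hb).mem_iff (i₂.mono (link_one.le.trans link_zero.le)))).map
    ((link_zero.triple hb).mem_iff (i₃.mono (link_two.le.trans (link_one.le.trans link_zero.le))))
  have hnil : spanOf b [] = ⊥ := by simp [spanOf]
  rw [hnil, Submodule.mem_bot, sub_eq_zero] at m₃
  set Φ : L ≃ₗ⁅ℂ⁆ L := ((φ₀.trans φ₁).trans φ₂).trans φ₃ with hΦ
  have hΦs : Φ s = φ₃ (φ₂ (φ₁ (φ₀ s))) := rfl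
  rw [← hΦs] at B₀ B₁ B₂ B₃ d₃ m₃
  clear_value Φ
  clear hΦs hΦ z₀ z₁ z₂ z₃ m₀ m₁ m₂ i₀ i₁ i₂ i₃ d₀ d₁ d₂
  have hlie : ∀ i, ⁅Φ s, b i⁆ = ((M₀ / 2 : ℂ) * (pairing [(0, 1), (1, 2), (2, 3), (3, 2)] i : ℤ) +
      (M₁ / 2 : ℂ) * (pairing [(0, 1), (1, 1), (2, 1)] i : ℤ) +
      (M₂ / 2 : ℂ) * (pairing [(1, 1), (2, 1)] i : ℤ) + (M₃ / 2 : ℂ) * (pairing [(2, 1)] i : ℤ)) •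
        b i := by
    intro i
    rw [m₃, add_lie, add_lie, add_lie, add_lie, smul_lie, smul_lie, smul_lie, smul_lie,
      link_zero.lie_coroot hb, link_one.lie_coroot hb, link_two.lie_coroot hb,
      link_three.lie_coroot hb, zero_lie]
    module
  have hcoe : ∀ c : ℕ, ∃ n : ℤ, c < 4 → ⁅Φ s, b (4 + c)⁆ = (n : ℂ) • b (4 + c) := by
    intro c
    by_cases hc : c < 4
    · obtain ⟨n, hn⟩ := d₃.exists_eq_intCast (hb.ne_zero (i := 4 + c) (by omega)) (hlie (4 + c))
      exact ⟨n, fun _ => by rw [hlie, hn]⟩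
    · exact ⟨0, fun h => absurd h hc⟩
  choose a ha using hcoe
  have p₀ : ∀ i, pairing [(0, 1), (1, 2), (2, 3), (3, 2)] i = wt 3 i := by
    intro i; simp [pairing, dg, cartan]; ring
  have p₁ : ∀ i, pairing [(0, 1), (1, 1), (2, 1)] i = wt 0 i - wt 3 i := by
    intro i; simp [pairing, dg, cartan]; ring
  have p₂ : ∀ i, pairing [(1, 1), (2, 1)] i = -wt 0 i + wt 1 i - wt 3 i := by
    intro i; simp [pairing, dg, cartan]; ring
  have p₃ : ∀ i, pairing [(2, 1)] i = -wt 1 i + 2 * wt 2 i - wt 3 i := by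
    intro i; simp [pairing, dg, cartan]; ring
  simp only [p₀, p₁, p₂, p₃] at hlie
  have hw : ∀ c < 4, ∀ d < 4, wt d (4 + c) = if d = c then 1 else 0 := by decide +kernel
  have ha' : ∀ c < 4, _ := fun c hc => smul_left_injective ℂ (hb.ne_zero (i := 4 + c) (by omega))
    ((hlie (4 + c)).symm.trans (ha c hc))
  have a₀ := ha' 0 (by norm_num)
  have a₁ := ha' 1 (by norm_num)
  have a₂ := ha' 2 (by norm_num)
  have a₃ := ha' 3 (by norm_num)
  rw [hw 0 (by norm_num) 0 (by norm_num), hw 0 (by norm_num) 1 (by norm_num),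
    hw 0 (by norm_num) 2 (by norm_num), hw 0 (by norm_num) 3 (by norm_num)] at a₀
  rw [hw 1 (by norm_num) 0 (by norm_num), hw 1 (by norm_num) 1 (by norm_num),
    hw 1 (by norm_num) 2 (by norm_num), hw 1 (by norm_num) 3 (by norm_num)] at a₁
  rw [hw 2 (by norm_num) 0 (by norm_num), hw 2 (by norm_num) 1 (by norm_num),
    hw 2 (by norm_num) 2 (by norm_num), hw 2 (by norm_num) 3 (by norm_num)] at a₂
  rw [hw 3 (by norm_num) 0 (by norm_num), hw 3 (by norm_num) 1 (by norm_num),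
    hw 3 (by norm_num) 2 (by norm_num), hw 3 (by norm_num) 3 (by norm_num)] at a₃
  norm_num at a₀ a₁ a₂ a₃
  have hdg : ∀ i, ⁅Φ s, b i⁆ = ((dg a i : ℤ) : ℂ) • b i := by
    intro i
    rw [hlie]
    congr 1
    simp only [dg]
    push_cast
    rw [← a₀, ← a₁, ← a₂, ← a₃]
    ring
  have e₀ : 2 * a 0 = M₁ - M₂ := by
    have : (2 * a 0 : ℂ) = M₁ - M₂ := by rw [← a₀]; ring
    exact_mod_cast this
  have e₁ : 2 * a 1 = M₂ - M₃ := by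
    have : (2 * a 1 : ℂ) = M₂ - M₃ := by rw [← a₁]; ring
    exact_mod_cast this
  have e₂ : a 2 = M₃ := by
    have : (a 2 : ℂ) = M₃ := by rw [← a₂]
    exact_mod_cast this
  have e₃ : 2 * a 3 = M₀ - M₁ - M₂ - M₃ := by
    have : (2 * a 3 : ℂ) = M₀ - M₁ - M₂ - M₃ := by rw [← a₃]; ring
    exact_mod_cast this
  have b₀ := le_of_abs_le (B₀ _ _ (mem_spanOf (List.mem_range.2 (by norm_num))) (hdg 26)
    (hb.ne_zero (by norm_num)))
  have b₁ := le_of_abs_le (B₁ _ _ (mem_spanOf (by decide)) (hdg 14) (hb.ne_zero (by norm_num)))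
  have b₂ := le_of_abs_le (B₂ _ _ (mem_spanOf (by decide)) (hdg 9) (hb.ne_zero (by norm_num)))
  have b₃ := (abs_nonneg _).trans
    (B₃ _ _ (mem_spanOf (by decide)) (hdg 6) (hb.ne_zero (by norm_num)))
  have w₀ : dg a 26 = a 0 * 2 + a 1 * 4 + a 2 * 3 + a 3 * 1 := rfl
  have w₁ : dg a 14 = a 0 * 1 + a 1 * 2 + a 2 * 1 + a 3 * 0 := rfl
  have w₂ : dg a 9 = a 0 * 0 + a 1 * 1 + a 2 * 1 + a 3 * 0 := rfl
  rw [w₀] at b₀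
  rw [w₁] at b₁
  rw [w₂] at b₂
  refine ⟨_, hb.map Φ.symm, a, ?_, fun i => Φ.injective ?_⟩
  · intro c hc
    interval_cases c <;> omega
  · change Φ _ = Φ _
    rw [LieEquiv.map_lie, map_smul, LieEquiv.apply_symm_apply, hdg]

end IsF4Basis

end F4

namespace F4

open LieAlgebra

variable {L : Type*} [LieRing L] [LieAlgebra ℂ L] {b : ℕ → L}

theorem wt_add : ∀ i < 52, ∀ j < 52, ∀ p ∈ sc i j, p.1 < 52 ∧
    wt 0 p.1 = wt 0 i + wt 0 j ∧ wt 1 p.1 = wt 1 i + wt 1 j ∧ wt 2 p.1 = wt 2 i + wt 2 j ∧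
      wt 3 p.1 = wt 3 i + wt 3 j := by
  decide +kernel

theorem dg_add (a : ℕ → ℤ) {i j : ℕ} (hi : i < 52) (hj : j < 52) {p : ℕ × ℤ} (hp : p ∈ sc i j) :
    dg a p.1 = dg a i + dg a j := by
  obtain ⟨-, h₀, h₁, h₂, h₃⟩ := wt_add i hi j hj p hp
  simp only [dg, h₀, h₁, h₂, h₃]
  push_cast
  ring

/-- The indices of the basis vectors whose degree satisfies `P`. -/
def idx (a : ℕ → ℤ) (P : ℤ → Bool) : List ℕ := (List.range 52).filter fun i => P (dg a i)

theorem mem_idx {a : ℕ → ℤ} {P : ℤ → Bool} {i : ℕ} : i ∈ idx a P ↔ i < 52 ∧ P (dg a i) = true := by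
  simp [idx]

theorem dg_nonneg {a : ℕ → ℤ} (ha : ∀ c < 4, 0 ≤ a c) {i : ℕ} (hi : i < 28) : 0 ≤ dg a i := by
  have h : ∀ i < 28, ∀ c < 4, 0 ≤ wt c i := by decide +kernel
  have h₀ := mul_nonneg (ha 0 (by norm_num)) (h i hi 0 (by norm_num))
  have h₁ := mul_nonneg (ha 1 (by norm_num)) (h i hi 1 (by norm_num))
  have h₂ := mul_nonneg (ha 2 (by norm_num)) (h i hi 2 (by norm_num))
  have h₃ := mul_nonneg (ha 3 (by norm_num)) (h i hi 3 (by norm_num))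
  simp only [dg, Int.cast_id]
  positivity

theorem dg_nonpos {a : ℕ → ℤ} (ha : ∀ c < 4, 0 ≤ a c) {i : ℕ} (hi : i < 52) (hi' : 28 ≤ i) :
    dg a i ≤ 0 := by
  have h : ∀ i < 52, 28 ≤ i → ∀ c < 4, wt c i ≤ 0 := by decide +kernel
  have h₀ := mul_nonpos_of_nonneg_of_nonpos (ha 0 (by norm_num)) (h i hi hi' 0 (by norm_num))
  have h₁ := mul_nonpos_of_nonneg_of_nonpos (ha 1 (by norm_num)) (h i hi hi' 1 (by norm_num))
  have h₂ := mul_nonpos_of_nonneg_of_nonpos (ha 2 (by norm_num)) (h i hi hi' 2 (by norm_num))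
  have h₃ := mul_nonpos_of_nonneg_of_nonpos (ha 3 (by norm_num)) (h i hi hi' 3 (by norm_num))
  simp only [dg, Int.cast_id]
  linarith

namespace IsF4Basis

theorem sum_repr (hb : IsF4Basis b) (x : L) : ∑ i : Fin 52, hb.toBasis.repr x i • b i = x := by
  simpa only [hb.toBasis_apply] using hb.toBasis.sum_repr x

theorem mem_spanOf_idx (hb : IsF4Basis b) {s x : L} {a : ℕ → ℤ}
    (hs : ∀ i, ⁅s, b i⁆ = ((dg a i : ℤ) : ℂ) • b i) {n : ℤ} (hx : ⁅s, x⁆ = (n : ℂ) • x) :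
    x ∈ spanOf b (idx a fun m => m == n) := by
  have h : ∀ i : Fin 52, hb.toBasis.repr x i ≠ 0 → dg a i = n := by
    intro i hi
    have h₁ : hb.toBasis.repr ⁅s, x⁆ i = (dg a i : ℤ) * hb.toBasis.repr x i := by
      conv_lhs => rw [← hb.sum_repr x]
      rw [lie_sum]
      simp only [lie_smul, hs, map_sum, map_smul]
      simp only [← hb.toBasis_apply, Module.Basis.repr_self, Finsupp.smul_single, smul_eq_mul,
        Finsupp.finsetSum_apply, Finsupp.single_apply]
      simp [mul_comm]
    rw [hx, map_smul, Finsupp.smul_apply, smul_eq_mul] at h₁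
    exact_mod_cast (mul_right_cancel₀ hi h₁).symm
  rw [← hb.sum_repr x]
  refine Submodule.sum_mem _ fun i _ => ?_
  by_cases hi : hb.toBasis.repr x i = 0
  · rw [hi, zero_smul]
    exact Submodule.zero_mem _
  · exact Submodule.smul_mem _ _ (mem_spanOf (mem_idx.2 ⟨i.2, by simp [h i hi]⟩))

theorem lie_of_mem_spanOf_idx {s x : L} {a : ℕ → ℤ}
    (hs : ∀ i, ⁅s, b i⁆ = ((dg a i : ℤ) : ℂ) • b i) {n : ℤ}
    (hx : x ∈ spanOf b (idx a fun m => m == n)) : ⁅s, x⁆ = (n : ℂ) • x := by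
  have : spanOf b (idx a fun m => m == n) ≤ (ad ℂ L s).eigenspace (n : ℂ) := by
    refine spanOf_le fun i hi => ?_
    rw [Module.End.mem_eigenspace_iff, ad_apply, hs, eq_of_beq (mem_idx.1 hi).2]
  exact Module.End.mem_eigenspace_iff.1 (this hx)

theorem finrank_spanOf (hb : IsF4Basis b) {I : List ℕ} (hI : I.Nodup) (h : ∀ i ∈ I, i < 52) :
    Module.finrank ℂ (spanOf b I) = I.length := by
  have e : b '' {i | i ∈ I} = Set.range fun k : Fin I.length => b (I.get k) := by
    ext x
    constructor
    · rintro ⟨i, hi, rfl⟩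
      obtain ⟨k, rfl⟩ := List.get_of_mem hi
      exact ⟨k, rfl⟩
    · rintro ⟨k, rfl⟩
      exact ⟨_, I.get_mem k, rfl⟩
  have li : LinearIndependent ℂ fun k : Fin I.length => b (I.get k) :=
    hb.linearIndependent.comp (fun k : Fin I.length => (⟨I.get k, h _ (I.get_mem k)⟩ : Fin 52))
      fun k l hkl => (List.nodup_iff_injective_get.1 hI) (Fin.mk.inj hkl)
  rw [spanOf, e, finrank_span_eq_card li, Fintype.card_fin]

theorem finrank_spanOf_idx (hb : IsF4Basis b) (a : ℕ → ℤ) (P : ℤ → Bool) :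
    Module.finrank ℂ (spanOf b (idx a P)) = (idx a P).length :=
  hb.finrank_spanOf (List.nodup_range.filter _) fun _ hi => (mem_idx.1 hi).1

end IsF4Basis

/-- The labels of a diagram as a function. -/
def label (x₀ x₁ x₂ x₃ : ℕ) (c : ℕ) : ℤ := ([x₀, x₁, x₂, x₃].getD c 0 : ℕ)

/-- Numerical test for a diagram to belong to a nilpotent element with centralizer of dimension
`16`. -/
def diagram (x₀ x₁ x₂ x₃ : ℕ) : Bool :=
  (((idx (label x₀ x₁ x₂ x₃) fun m => decide (2 ≤ m)).length + 16).beq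
    (idx (label x₀ x₁ x₂ x₃) fun m => decide (0 ≤ m)).length) &&
  Nat.ble (idx (label x₀ x₁ x₂ x₃) fun m => m == 2 + 2).length
    (idx (label x₀ x₁ x₂ x₃) fun m => m == 2).length

/-- A dominant grading adapted to `e`, with the numerical consequences of `sl₂`-theory. -/
structure Adapted (b : ℕ → L) (s e : L) (a : ℕ → ℤ) : Prop where
  basis : IsF4Basis b
  nonneg : ∀ c < 4, 0 ≤ a c
  lie_b : ∀ i, ⁅s, b i⁆ = ((dg a i : ℤ) : ℂ) • b i
  lie_e : ⁅s, e⁆ = (2 : ℂ) • e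
  inj : ∀ (z : L) (n : ℤ), n < 0 → ⁅s, z⁆ = (n : ℂ) • z → ⁅e, z⁆ = 0 → z = 0
  surj : ∀ (z : L) (n : ℤ), -1 ≤ n → ⁅s, z⁆ = ((n + 2 : ℤ) : ℂ) • z →
    ∃ y, ⁅s, y⁆ = (n : ℂ) • y ∧ ⁅e, y⁆ = z

namespace Adapted

variable {s e : L} {a : ℕ → ℤ}

theorem mem_two (h : Adapted b s e a) : e ∈ spanOf b (idx a fun m => m == 2) :=
  h.basis.mem_spanOf_idx h.lie_b (by rw [h.lie_e]; norm_num)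

theorem le_two (h : Adapted b s e a) : ∀ c < 4, a c ≤ 2 := by
  have key : ∀ c < 4, ∀ j < 28, 4 ≤ j → j ≠ 4 + c → ∀ p ∈ sc j (28 + c), p.1 < 28 := by
    decide +kernel
  have hd : ∀ c < 4, dg a (4 + c) = a c ∧ dg a (28 + c) = -a c := by
    intro c hc
    have : ∀ c < 4, ∀ d < 4, wt d (4 + c) = (if d = c then 1 else 0) ∧
      wt d (28 + c) = if d = c then -1 else 0 := by decide +kernel
    simp only [dg, this c hc 0 (by norm_num), this c hc 1 (by norm_num), this c hc 2 (by norm_num),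
      this c hc 3 (by norm_num)]
    interval_cases c <;> simp
  intro c hc
  by_contra! hac
  refine h.basis.ne_zero (i := 28 + c) (by omega)
    (h.inj _ (-a c) (by omega) (by rw [h.lie_b, (hd c hc).2]) ?_)
  suffices spanOf b (idx a fun m => m == 2) ≤ LinearMap.ker (ad ℂ L (b (28 + c))) by
    have := this h.mem_two
    rw [LinearMap.mem_ker, ad_apply] at this
    rw [← lie_skew, this, neg_zero]
  refine spanOf_le fun j hj => ?_
  obtain ⟨hj, hj2⟩ := mem_idx.1 hj
  have hj2 : dg a j = 2 := eq_of_beq hj2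
  rw [LinearMap.mem_ker, ad_apply, ← lie_skew, h.basis.lie, neg_eq_zero]
  have h4 : 4 ≤ j := by
    by_contra! h4
    have : ∀ j < 4, ∀ c < 4, wt c j = 0 := by decide +kernel
    simp [dg, this j h4] at hj2
  have h28 : j < 28 := by
    by_contra! h28
    have := dg_nonpos h.nonneg hj h28
    omega
  have hjc : j ≠ 4 + c := by
    rintro rfl
    have := (hd c hc).1
    omega
  rcases hl : sc j (28 + c) with _ | ⟨p, l⟩
  · rfl
  · have hp : p ∈ sc j (28 + c) := by simp [hl]
    have h1 := dg_nonneg h.nonneg (key c hc j h28 h4 hjc p hp)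
    have h2 := dg_add a hj (by omega) hp
    have := (hd c hc).2
    omega

theorem length_le (h : Adapted b s e a) (n : ℤ) (hn : -1 ≤ n) :
    (idx a fun m => m == n + 2).length ≤ (idx a fun m => m == n).length := by
  have := h.basis.finiteDimensional
  rw [← h.basis.finrank_spanOf_idx, ← h.basis.finrank_spanOf_idx]
  refine le_trans (Submodule.finrank_mono ?_)
    (Submodule.finrank_map_le (ad ℂ L e) (spanOf b (idx a fun m => m == n)))
  intro z hz
  obtain ⟨y, hy, rfl⟩ := h.surj z n hn (IsF4Basis.lie_of_mem_spanOf_idx h.lie_b hz)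
  exact ⟨y, h.basis.mem_spanOf_idx h.lie_b hy, rfl⟩

theorem intDiag (h : Adapted b s e a) : IntDiag s := by
  rw [IntDiag, eq_top_iff, ← h.basis.spanOf_range]
  refine spanOf_le fun i _ => Submodule.mem_iSup_of_mem (dg a i) ?_
  rw [Module.End.mem_eigenspace_iff, ad_apply, h.lie_b]

theorem finrank_ker (h : Adapted b s e a) :
    (idx a fun m => decide (2 ≤ m)).length + Module.finrank ℂ (LinearMap.ker (ad ℂ L e)) =
      (idx a fun m => decide (0 ≤ m)).length := by
  have := h.basis.finiteDimensional
  obtain ⟨N, π, h₁, -, h₃, h₄, -⟩ := exists_proj h.intDiag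
  have inv : ∀ x ∈ LinearMap.ker (ad ℂ L e), ad ℂ L s x ∈ LinearMap.ker (ad ℂ L e) := by
    intro x hx
    rw [LinearMap.mem_ker, ad_apply] at hx ⊢
    rw [ad_apply, leibniz_lie, hx, ← lie_skew e s, h.lie_e, neg_lie, smul_lie, hx, lie_zero, smul_zero,
      neg_zero, add_zero]
  have hker : LinearMap.ker (ad ℂ L e) ≤ spanOf b (idx a fun m => decide (0 ≤ m)) := by
    intro x hx
    rw [← h₃ x]
    refine Submodule.sum_mem _ fun i _ => ?_
    have hi := h₄ _ inv i x hx
    rcases lt_or_ge i 0 with h0 | h0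
    · rw [h.inj (π i x) i h0 (h₁ i x) hi]
      exact Submodule.zero_mem _
    · refine spanOf_le (fun j hj => mem_spanOf ?_) (h.basis.mem_spanOf_idx h.lie_b (h₁ i x))
      have := mem_idx.1 hj
      exact mem_idx.2 ⟨this.1, decide_eq_true (by rw [eq_of_beq this.2]; exact h0)⟩
  have hmap : (spanOf b (idx a fun m => decide (0 ≤ m))).map (ad ℂ L e) =
      spanOf b (idx a fun m => decide (2 ≤ m)) := by
    apply le_antisymm
    · rw [Submodule.map_le_iff_le_comap]
      refine spanOf_le fun j hj => ?_
      rw [Submodule.mem_comap, ad_apply]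
      have hj := mem_idx.1 hj
      have := of_decide_eq_true hj.2
      have h5 := h.basis.mem_spanOf_idx h.lie_b
        (lie_lie_eq_smul h.lie_e (h.lie_b j) ((2 + dg a j : ℤ) : ℂ) (by push_cast; ring))
      refine spanOf_le (fun k hk => mem_spanOf ?_) h5
      have hk := mem_idx.1 hk
      exact mem_idx.2 ⟨hk.1, decide_eq_true (by rw [eq_of_beq hk.2]; omega)⟩
    · refine spanOf_le fun j hj => ?_
      have hj := mem_idx.1 hj
      have := of_decide_eq_true hj.2
      obtain ⟨y, hy, hy'⟩ := h.surj (b j) (dg a j - 2) (by omega)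
        (by rw [h.lie_b]; congr 2; ring)
      refine ⟨y, spanOf_le (fun k hk => mem_spanOf ?_) (h.basis.mem_spanOf_idx h.lie_b hy), hy'⟩
      have hk := mem_idx.1 hk
      exact mem_idx.2 ⟨hk.1, decide_eq_true (by rw [eq_of_beq hk.2]; omega)⟩
  have key := LinearMap.finrank_range_add_finrank_ker
    ((ad ℂ L e).domRestrict (spanOf b (idx a fun m => decide (0 ≤ m))))
  rw [LinearMap.range_domRestrict, hmap, h.basis.finrank_spanOf_idx, h.basis.finrank_spanOf_idx,
    LinearMap.ker_domRestrict] at key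
  rw [← key]
  congr 1
  exact (Submodule.comapSubtypeEquivOfLe hker).finrank_eq.symm

/-- The weighted Dynkin diagrams compatible with a centralizer of dimension `16`. -/
theorem eq_or_eq (h : Adapted b s e a)
    (hdim : Module.finrank ℂ (LinearMap.ker (ad ℂ L e)) = 16) :
    (a 0 = 1 ∧ a 1 = 0 ∧ a 2 = 0 ∧ a 3 = 2) ∨ (a 0 = 1 ∧ a 1 = 0 ∧ a 2 = 1 ∧ a 3 = 0) := by
  have key : ∀ x₀ x₁ x₂ x₃ : Fin 3, diagram x₀ x₁ x₂ x₃ = true →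
      [x₀, x₁, x₂, x₃] = [1, 0, 0, 2] ∨ [x₀, x₁, x₂, x₃] = [1, 0, 1, 0] := by
    decide +kernel
  have ha : ∃ x : ℕ → ℕ, ∀ c < 4, a c = x c ∧ x c < 3 := by
    refine ⟨fun c => (a c).toNat, fun c hc => ?_⟩
    dsimp only
    have := h.nonneg c hc
    have := h.le_two c hc
    omega
  obtain ⟨x, hx⟩ := ha
  have hdg : ∀ i, dg a i = dg (label (x 0) (x 1) (x 2) (x 3)) i := by
    intro i
    simp only [dg, hx 0 (by norm_num), hx 1 (by norm_num), hx 2 (by norm_num), hx 3 (by norm_num)]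
    rfl
  have hidx : ∀ P, idx a P = idx (label (x 0) (x 1) (x 2) (x 3)) P := by
    intro P
    simp only [idx, hdg]
  have h₁ := h.finrank_ker
  have h₂ := h.length_le 2 (by norm_num)
  rw [hdim, hidx, hidx] at h₁
  rw [hidx, hidx] at h₂
  have h₃ := key ⟨x 0, (hx 0 (by norm_num)).2⟩ ⟨x 1, (hx 1 (by norm_num)).2⟩
    ⟨x 2, (hx 2 (by norm_num)).2⟩ ⟨x 3, (hx 3 (by norm_num)).2⟩
    (by rw [diagram, h₁, Nat.beq_refl, Bool.true_and]; exact Nat.ble_eq_true_of_le h₂)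
  have := (hx 0 (by norm_num)).1
  have := (hx 1 (by norm_num)).1
  have := (hx 2 (by norm_num)).1
  have := (hx 3 (by norm_num)).1
  simp only [List.cons.injEq, and_true, Fin.ext_iff] at h₃
  norm_num at h₃
  omega

end Adapted

end F4

namespace F4

open LieAlgebra

variable {L : Type*} [LieRing L] [LieAlgebra ℂ L] {b : ℕ → L}

theorem mem_spanOf_cons {i : ℕ} {I : List ℕ} {x : L} (hx : x ∈ spanOf b (i :: I)) :
    ∃ c : ℂ, ∃ y ∈ spanOf b I, x = c • b i + y := by
  have h : b '' {j | j ∈ i :: I} = insert (b i) (b '' {j | j ∈ I}) := by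
    ext y; simp [eq_comm]
  rw [spanOf, h, Submodule.mem_span_insert] at hx
  exact hx

theorem mem_spanOf_nil {x : L} (hx : x ∈ spanOf b []) : x = 0 := by
  simpa [spanOf] using hx

namespace Adapted

variable {s e : L} {a : ℕ → ℤ}

theorem lie_ne_zero (h : Adapted b s e a) {i : ℕ} (hi : i < 52) (hd : dg a i < 0) :
    ⁅e, b i⁆ ≠ 0 := fun h0 => h.basis.ne_zero hi (h.inj _ _ hd (h.lie_b i) h0)

/-- Change of basis by `exp (t ad b_k)` for a root vector number `k` of degree zero. -/
theorem exists_conj (h : Adapted b s e a) {k c : ℕ} (hc : c < 4) (hk : dg (cartan c) k ≠ 0)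
    (hd : dg a k = 0) (t : ℂ) :
    ∃ b' : ℕ → L, Adapted b' s e a ∧
      (∀ i, Comb.isZero (sc k i) = true → b i = b' i) ∧
      (∀ i j n, Comb.eqv (sc k i) [(j, n)] = true → Comb.isZero (sc k j) = true →
        b i = b' i + (t * n) • b' j) ∧
      ∀ i j l n m, Comb.eqv (sc k i) [(j, n)] = true → Comb.eqv (sc k j) [(l, m)] = true →
        Comb.isZero (sc k l) = true → b i = b' i + (t * n) • b' j + (t ^ 2 * n * m / 2) • b' l := by
  have := h.basis.finiteDimensional
  have hl := h.basis.lie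
  have hnil : IsNilpotent (ad ℂ L (t • b k)) := isNilpotent_ad_smul
    (isNilpotent_ad_of_lie_eq_smul (by exact_mod_cast hk) (h.basis.cartan_lie hc k)) t
  have hz : ∀ i, Comb.isZero (sc k i) = true → ⁅t • b k, b i⁆ = 0 := fun i hi => by
    rw [smul_lie, lie_eq_zero hl hi, smul_zero]
  have he : ∀ i j n, Comb.eqv (sc k i) [(j, n)] = true → ⁅t • b k, b i⁆ = (t * n) • b j :=
    fun i j n hi => by
      rw [smul_lie, lie_eq_smul hl j n hi, mul_smul]
  set φ := adExp (t • b k) hnil with hφ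
  have hs : φ.symm s = s := by
    apply φ.injective
    change φ _ = φ _
    rw [LieEquiv.apply_symm_apply, hφ, adExp_apply_eq_self]
    rw [smul_lie, ← lie_skew, h.lie_b, hd]
    simp
  refine ⟨fun i => φ.symm (b i), ⟨h.basis.map _, h.nonneg, fun i => ?_, h.lie_e, h.inj, h.surj⟩,
    fun i hi => ?_, fun i j n hi hj => ?_, fun i j l n m hi hj hm => ?_⟩
  · rw [← map_smul, ← h.lie_b, LieEquiv.map_lie, hs]
  · apply φ.injective
    change φ _ = φ _
    rw [LieEquiv.apply_symm_apply, hφ, adExp_apply_eq_self _ (hz i hi)]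
  · apply φ.injective
    change φ _ = φ _
    rw [map_add, map_smul, LieEquiv.apply_symm_apply, LieEquiv.apply_symm_apply, hφ,
      adExp_apply_eq_add, he i j n hi]
    rw [he i j n hi, lie_smul, hz j hj, smul_zero]
  · apply φ.injective
    change φ _ = φ _
    rw [map_add, map_add, map_smul, map_smul, LieEquiv.apply_symm_apply, LieEquiv.apply_symm_apply,
      LieEquiv.apply_symm_apply, hφ, adExp_apply_eq_add_add, he i j n hi, lie_smul, he j l m hj]
    · module
    · rw [he i j n hi, lie_smul, he j l m hj, lie_smul, lie_smul, hz l hm, smul_zero, smul_zero]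

end Adapted

end F4

namespace F4

open LieAlgebra

variable {L : Type*} [LieRing L] [LieAlgebra ℂ L] {b : ℕ → L}

variable {s e : L} {a : ℕ → ℤ}

/-- The grading with diagram `1002`, and the coordinates of `e` in degree two. -/
structure FormB₂ (b : ℕ → L) (s e : L) (a : ℕ → ℤ) (x₇ x₁₀ x₁₃ x₁₆ x₁₇ x₁₉ : ℂ) : Prop where
  adapted : Adapted b s e a
  label : a 0 = 1 ∧ a 1 = 0 ∧ a 2 = 0 ∧ a 3 = 2
  eq : e = x₇ • b 7 + x₁₀ • b 10 + x₁₃ • b 13 + x₁₆ • b 16 + x₁₇ • b 17 + x₁₉ • b 19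

namespace FormB₂

variable {x₇ x₁₀ x₁₃ x₁₆ x₁₇ x₁₉ : ℂ}

theorem dg_eq (h : FormB₂ b s e a x₇ x₁₀ x₁₃ x₁₆ x₁₇ x₁₉) (i : ℕ) : dg a i = wt 0 i + 2 * wt 3 i := by
  obtain ⟨h₀, h₁, h₂, h₃⟩ := h.label
  simp [dg, h₀, h₁, h₂, h₃]

theorem conj_six (h : FormB₂ b s e a x₇ x₁₀ x₁₃ x₁₆ x₁₇ x₁₉) (t : ℂ) :
    ∃ b', FormB₂ b' s e a x₇ (x₁₀ + t * x₇) x₁₃ x₁₆ x₁₇ (x₁₉ + t * x₁₆) := by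
  obtain ⟨b', hb', f₀, f₁, -⟩ := h.adapted.exists_conj (k := 6) (c := 2) (by norm_num) (by decide)
    (by rw [h.dg_eq]; decide) t
  refine ⟨b', hb', h.label, ?_⟩
  rw [h.eq, f₁ 7 10 1 (by decide) (by decide), f₀ 10 (by decide), f₀ 13 (by decide),
    f₁ 16 19 1 (by decide) (by decide), f₀ 17 (by decide), f₀ 19 (by decide)]
  push_cast
  module

theorem conj_nine (h : FormB₂ b s e a x₇ x₁₀ x₁₃ x₁₆ x₁₇ x₁₉) (t : ℂ) :
    ∃ b', FormB₂ b' s e a x₇ x₁₀ (x₁₃ + t * x₇) x₁₆ x₁₇ (x₁₉ + 2 * t * x₁₃ + t ^ 2 * x₇) := by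
  obtain ⟨b', hb', f₀, f₁, f₂⟩ := h.adapted.exists_conj (k := 9) (c := 2) (by norm_num) (by decide)
    (by rw [h.dg_eq]; decide) t
  refine ⟨b', hb', h.label, ?_⟩
  rw [h.eq, f₂ 7 13 19 1 2 (by decide) (by decide) (by decide), f₀ 10 (by decide),
    f₁ 13 19 2 (by decide) (by decide), f₀ 16 (by decide), f₀ 17 (by decide), f₀ 19 (by decide)]
  push_cast
  module

theorem conj_twelve (h : FormB₂ b s e a x₇ x₁₀ x₁₃ x₁₆ x₁₇ x₁₉) (t : ℂ) :
    ∃ b', FormB₂ b' s e a x₇ x₁₀ x₁₃ (x₁₆ - t * x₇) x₁₇ (x₁₉ - t * x₁₀) := by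
  obtain ⟨b', hb', f₀, f₁, -⟩ := h.adapted.exists_conj (k := 12) (c := 1) (by norm_num) (by decide)
    (by rw [h.dg_eq]; decide) t
  refine ⟨b', hb', h.label, ?_⟩
  rw [h.eq, f₁ 7 16 (-1) (by decide) (by decide), f₁ 10 19 (-1) (by decide) (by decide),
    f₀ 13 (by decide), f₀ 16 (by decide), f₀ 17 (by decide), f₀ 19 (by decide)]
  push_cast
  module

theorem conj_thirty (h : FormB₂ b s e a x₇ x₁₀ x₁₃ x₁₆ x₁₇ x₁₉) (t : ℂ) :
    ∃ b', FormB₂ b' s e a (x₇ + t * x₁₀) x₁₀ x₁₃ (x₁₆ + t * x₁₉) x₁₇ x₁₉ := by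
  obtain ⟨b', hb', f₀, f₁, -⟩ := h.adapted.exists_conj (k := 30) (c := 2) (by norm_num) (by decide)
    (by rw [h.dg_eq]; decide) t
  refine ⟨b', hb', h.label, ?_⟩
  rw [h.eq, f₁ 10 7 1 (by decide) (by decide), f₀ 7 (by decide), f₀ 13 (by decide),
    f₁ 19 16 1 (by decide) (by decide), f₀ 17 (by decide), f₀ 16 (by decide)]
  push_cast
  module

theorem conj_thirtyThree (h : FormB₂ b s e a x₇ x₁₀ x₁₃ x₁₆ x₁₇ x₁₉) (t : ℂ) :
    ∃ b', FormB₂ b' s e a (x₇ - 2 * t * x₁₃ + t ^ 2 * x₁₉) x₁₀ (x₁₃ - t * x₁₉) x₁₆ x₁₇ x₁₉ := by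
  obtain ⟨b', hb', f₀, f₁, f₂⟩ := h.adapted.exists_conj (k := 33) (c := 2) (by norm_num) (by decide)
    (by rw [h.dg_eq]; decide) t
  refine ⟨b', hb', h.label, ?_⟩
  rw [h.eq, f₂ 19 13 7 (-1) (-2) (by decide) (by decide) (by decide), f₀ 10 (by decide),
    f₁ 13 7 (-2) (by decide) (by decide), f₀ 16 (by decide), f₀ 17 (by decide), f₀ 7 (by decide)]
  push_cast
  module

theorem conj_thirtySix (h : FormB₂ b s e a x₇ x₁₀ x₁₃ x₁₆ x₁₇ x₁₉) (t : ℂ) :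
    ∃ b', FormB₂ b' s e a (x₇ - t * x₁₆) (x₁₀ - t * x₁₉) x₁₃ x₁₆ x₁₇ x₁₉ := by
  obtain ⟨b', hb', f₀, f₁, -⟩ := h.adapted.exists_conj (k := 36) (c := 1) (by norm_num) (by decide)
    (by rw [h.dg_eq]; decide) t
  refine ⟨b', hb', h.label, ?_⟩
  rw [h.eq, f₁ 16 7 (-1) (by decide) (by decide), f₁ 19 10 (-1) (by decide) (by decide),
    f₀ 13 (by decide), f₀ 7 (by decide), f₀ 17 (by decide), f₀ 10 (by decide)]
  push_cast
  module

theorem exists_ne_zero (h : FormB₂ b s e a x₇ x₁₀ x₁₃ x₁₆ x₁₇ x₁₉) :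
    ∃ b' y₇ y₁₀ y₁₃ y₁₆ y₁₇ y₁₉, y₇ ≠ 0 ∧ FormB₂ b' s e a y₇ y₁₀ y₁₃ y₁₆ y₁₇ y₁₉ := by
  by_cases h₇ : x₇ = 0
  swap
  · exact ⟨b, _, _, _, _, _, _, h₇, h⟩
  by_cases h₁₀ : x₁₀ = 0
  swap
  · obtain ⟨b', h'⟩ := h.conj_thirty 1
    exact ⟨b', _, _, _, _, _, _, by simpa [h₇] using h₁₀, h'⟩
  by_cases h₁₆ : x₁₆ = 0
  swap
  · obtain ⟨b', h'⟩ := h.conj_thirtySix 1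
    exact ⟨b', _, _, _, _, _, _, by simpa [h₇] using h₁₆, h'⟩
  by_cases h₁ : -2 * x₁₃ + x₁₉ = 0
  swap
  · obtain ⟨b', h'⟩ := h.conj_thirtyThree 1
    exact ⟨b', _, _, _, _, _, _, fun h0 => h₁ (by linear_combination h0 - h₇), h'⟩
  by_cases h₂ : 2 * x₁₃ + x₁₉ = 0
  swap
  · obtain ⟨b', h'⟩ := h.conj_thirtyThree (-1)
    exact ⟨b', _, _, _, _, _, _, fun h0 => h₂ (by linear_combination h0 - h₇), h'⟩
  have h₁₃ : x₁₃ = 0 := by linear_combination (h₂ - h₁) / 4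
  have h₁₉ : x₁₉ = 0 := by linear_combination (h₂ + h₁) / 2
  refine absurd ?_ (h.adapted.lie_ne_zero (i := 31) (by norm_num) (by rw [h.dg_eq]; decide))
  have hl := h.adapted.basis.lie
  rw [h.eq, h₇, h₁₀, h₁₃, h₁₆, h₁₉]
  simp only [zero_smul, zero_add, add_zero, smul_lie]
  rw [lie_eq_zero hl (by decide), smul_zero]

theorem exists_sum (h : FormB₂ b s e a x₇ x₁₀ x₁₃ x₁₆ x₁₇ x₁₉) :
    ∃ (b' : ℕ → L) (p q r : ℂ), p ≠ 0 ∧ q ≠ 0 ∧ r ≠ 0 ∧ IsF4Basis b' ∧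
      e = p • b' 7 + q • b' 17 + r • b' 19 := by
  obtain ⟨b, x₇, x₁₀, x₁₃, x₁₆, x₁₇, x₁₉, h₇, h⟩ := h.exists_ne_zero
  obtain ⟨b, h⟩ := h.conj_six (-(x₁₀ / x₇))
  rw [show x₁₀ + -(x₁₀ / x₇) * x₇ = 0 by field_simp; ring] at h
  generalize x₁₉ + -(x₁₀ / x₇) * x₁₆ = x₁₉ at h
  obtain ⟨b, h⟩ := h.conj_nine (-(x₁₃ / x₇))
  rw [show x₁₃ + -(x₁₃ / x₇) * x₇ = 0 by field_simp; ring] at h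
  generalize x₁₉ + 2 * -(x₁₃ / x₇) * x₁₃ + (-(x₁₃ / x₇)) ^ 2 * x₇ = x₁₉ at h
  obtain ⟨b, h⟩ := h.conj_twelve (x₁₆ / x₇)
  rw [show x₁₆ - x₁₆ / x₇ * x₇ = 0 by field_simp; ring] at h
  generalize x₁₉ - x₁₆ / x₇ * 0 = x₁₉ at h
  have hl := h.adapted.basis.lie
  have he : e = x₇ • b 7 + x₁₇ • b 17 + x₁₉ • b 19 := by rw [h.eq]; module
  refine ⟨b, x₇, x₁₇, x₁₉, h₇, ?_, ?_, h.adapted.basis, he⟩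
  · rintro rfl
    refine h.adapted.lie_ne_zero (i := 28) (by norm_num) (by rw [h.dg_eq]; decide) ?_
    rw [he, zero_smul, add_zero, add_lie, smul_lie, smul_lie, lie_eq_zero hl (by decide),
      lie_eq_zero hl (by decide)]
    simp
  · rintro rfl
    refine h.adapted.lie_ne_zero (i := 43) (by norm_num) (by rw [h.dg_eq]; decide) ?_
    rw [he, zero_smul, add_zero, add_lie, smul_lie, smul_lie, lie_eq_zero hl (by decide),
      lie_eq_zero hl (by decide)]
    simp

end FormB₂

end F4

namespace F4

open LieAlgebra

variable {L : Type*} [LieRing L] [LieAlgebra ℂ L] {b : ℕ → L} {s e : L} {a : ℕ → ℤ}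

/-- The grading with diagram `1010`, and the coordinates of `e` in degree two. -/
structure FormA₂A₁ (b : ℕ → L) (s e : L) (a : ℕ → ℤ) (x₁₁ x₁₄ x₁₅ x₁₈ x₁₉ : ℂ) : Prop where
  adapted : Adapted b s e a
  label : a 0 = 1 ∧ a 1 = 0 ∧ a 2 = 1 ∧ a 3 = 0
  eq : e = x₁₁ • b 11 + x₁₄ • b 14 + x₁₅ • b 15 + x₁₈ • b 18 + x₁₉ • b 19

namespace FormA₂A₁

variable {x₁₁ x₁₄ x₁₅ x₁₈ x₁₉ : ℂ}

theorem dg_eq (h : FormA₂A₁ b s e a x₁₁ x₁₄ x₁₅ x₁₈ x₁₉) (i : ℕ) : dg a i = wt 0 i + wt 2 i := by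
  obtain ⟨h₀, h₁, h₂, h₃⟩ := h.label
  simp [dg, h₀, h₁, h₂, h₃]

theorem conj_five (h : FormA₂A₁ b s e a x₁₁ x₁₄ x₁₅ x₁₈ x₁₉) (t : ℂ) :
    ∃ b', FormA₂A₁ b' s e a x₁₁ (x₁₄ + t * x₁₁) x₁₅ (x₁₈ - t * x₁₅) x₁₉ := by
  obtain ⟨b', hb', f₀, f₁, -⟩ := h.adapted.exists_conj (k := 5) (c := 1) (by norm_num) (by decide)
    (by rw [h.dg_eq]; decide) t
  refine ⟨b', hb', h.label, ?_⟩
  rw [h.eq, f₁ 11 14 1 (by decide) (by decide), f₁ 15 18 (-1) (by decide) (by decide),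
    f₀ 14 (by decide), f₀ 18 (by decide), f₀ 19 (by decide)]
  push_cast
  module

theorem conj_seven (h : FormA₂A₁ b s e a x₁₁ x₁₄ x₁₅ x₁₈ x₁₉) (t : ℂ) :
    ∃ b', FormA₂A₁ b' s e a x₁₁ x₁₄ (x₁₅ - t * x₁₁) (x₁₈ + t * x₁₄) x₁₉ := by
  obtain ⟨b', hb', f₀, f₁, -⟩ := h.adapted.exists_conj (k := 7) (c := 3) (by norm_num) (by decide)
    (by rw [h.dg_eq]; decide) t
  refine ⟨b', hb', h.label, ?_⟩
  rw [h.eq, f₁ 11 15 (-1) (by decide) (by decide), f₁ 14 18 1 (by decide) (by decide),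
    f₀ 15 (by decide), f₀ 18 (by decide), f₀ 19 (by decide)]
  push_cast
  module

theorem conj_twentyNine (h : FormA₂A₁ b s e a x₁₁ x₁₄ x₁₅ x₁₈ x₁₉) (t : ℂ) :
    ∃ b', FormA₂A₁ b' s e a (x₁₁ + t * x₁₄) x₁₄ (x₁₅ - t * x₁₈) x₁₈ x₁₉ := by
  obtain ⟨b', hb', f₀, f₁, -⟩ := h.adapted.exists_conj (k := 29) (c := 1) (by norm_num) (by decide)
    (by rw [h.dg_eq]; decide) t
  refine ⟨b', hb', h.label, ?_⟩
  rw [h.eq, f₁ 14 11 1 (by decide) (by decide), f₁ 18 15 (-1) (by decide) (by decide),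
    f₀ 11 (by decide), f₀ 15 (by decide), f₀ 19 (by decide)]
  push_cast
  module

theorem conj_thirtyOne (h : FormA₂A₁ b s e a x₁₁ x₁₄ x₁₅ x₁₈ x₁₉) (t : ℂ) :
    ∃ b', FormA₂A₁ b' s e a (x₁₁ - t * x₁₅) (x₁₄ + t * x₁₈) x₁₅ x₁₈ x₁₉ := by
  obtain ⟨b', hb', f₀, f₁, -⟩ := h.adapted.exists_conj (k := 31) (c := 3) (by norm_num) (by decide)
    (by rw [h.dg_eq]; decide) t
  refine ⟨b', hb', h.label, ?_⟩
  rw [h.eq, f₁ 15 11 (-1) (by decide) (by decide), f₁ 18 14 1 (by decide) (by decide),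
    f₀ 11 (by decide), f₀ 14 (by decide), f₀ 19 (by decide)]
  push_cast
  module

theorem exists_ne_zero (h : FormA₂A₁ b s e a x₁₁ x₁₄ x₁₅ x₁₈ x₁₉) :
    ∃ b' y₁₁ y₁₄ y₁₅ y₁₈ y₁₉, y₁₄ ≠ 0 ∧ FormA₂A₁ b' s e a y₁₁ y₁₄ y₁₅ y₁₈ y₁₉ := by
  by_cases h₁₄ : x₁₄ = 0
  swap
  · exact ⟨b, _, _, _, _, _, h₁₄, h⟩
  by_cases h₁₁ : x₁₁ = 0
  swap
  · obtain ⟨b', h'⟩ := h.conj_five 1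
    exact ⟨b', _, _, _, _, _, by simpa [h₁₄] using h₁₁, h'⟩
  by_cases h₁₈ : x₁₈ = 0
  swap
  · obtain ⟨b', h'⟩ := h.conj_thirtyOne 1
    exact ⟨b', _, _, _, _, _, by simpa [h₁₄] using h₁₈, h'⟩
  by_cases h₁₅ : x₁₅ = 0
  swap
  · obtain ⟨b₁, h₁⟩ := h.conj_thirtyOne 1
    obtain ⟨b', h'⟩ := h₁.conj_five 1
    exact ⟨b', _, _, _, _, _, by simpa [h₁₄, h₁₁, h₁₈] using h₁₅, h'⟩
  refine absurd ?_ (h.adapted.lie_ne_zero (i := 28) (by norm_num) (by rw [h.dg_eq]; decide))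
  have hl := h.adapted.basis.lie
  rw [h.eq, h₁₁, h₁₄, h₁₅, h₁₈]
  simp only [zero_smul, zero_add, smul_lie]
  rw [lie_eq_zero hl (by decide), smul_zero]

theorem exists_sum (h : FormA₂A₁ b s e a x₁₁ x₁₄ x₁₅ x₁₈ x₁₉) :
    ∃ (b' : ℕ → L) (p q r : ℂ), p ≠ 0 ∧ q ≠ 0 ∧ r ≠ 0 ∧ IsF4Basis b' ∧
      e = p • b' 14 + q • b' 15 + r • b' 19 := by
  obtain ⟨b, x₁₁, x₁₄, x₁₅, x₁₈, x₁₉, h₁₄, h⟩ := h.exists_ne_zero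
  obtain ⟨b, h⟩ := h.conj_seven (-(x₁₈ / x₁₄))
  rw [show x₁₈ + -(x₁₈ / x₁₄) * x₁₄ = 0 by field_simp; ring] at h
  generalize x₁₅ - -(x₁₈ / x₁₄) * x₁₁ = x₁₅ at h
  obtain ⟨b, h⟩ := h.conj_twentyNine (-(x₁₁ / x₁₄))
  rw [show x₁₁ + -(x₁₁ / x₁₄) * x₁₄ = 0 by field_simp; ring, mul_zero, sub_zero] at h
  have hl := h.adapted.basis.lie
  have he : e = x₁₄ • b 14 + x₁₅ • b 15 + x₁₉ • b 19 := by rw [h.eq]; module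
  refine ⟨b, x₁₄, x₁₅, x₁₉, h₁₄, ?_, ?_, h.adapted.basis, he⟩
  · rintro rfl
    refine h.adapted.lie_ne_zero (i := 39) (by norm_num) (by rw [h.dg_eq]; decide) ?_
    rw [he, zero_smul, add_zero, add_lie, smul_lie, smul_lie, lie_eq_zero hl (by decide),
      lie_eq_zero hl (by decide)]
    simp
  · rintro rfl
    refine h.adapted.lie_ne_zero (i := 30) (by norm_num) (by rw [h.dg_eq]; decide) ?_
    rw [he, zero_smul, add_zero, add_lie, smul_lie, smul_lie, lie_eq_zero hl (by decide),
      lie_eq_zero hl (by decide)]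
    simp

end FormA₂A₁

namespace IsF4Basis

/-- Rescaling the basis by a character of the root lattice. -/
theorem scale (hb : IsF4Basis b) {t : ℕ → ℂ} (ht : ∀ c, t c ≠ 0) : IsF4Basis fun i =>
    (t 0 ^ wt 0 i * t 1 ^ wt 1 i * t 2 ^ wt 2 i * t 3 ^ wt 3 i) • b i where
  lie i j := by
    rw [smul_lie, lie_smul, smul_smul, hb.lie]
    rcases lt_or_ge i 52 with hi | hi
    swap
    · rw [← hb.lie, sc_eq_nil_left hi j, hb.eq_zero i hi]; simp
    rcases lt_or_ge j 52 with hj | hj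
    swap
    · rw [← hb.lie, sc_eq_nil_right i hj, hb.eq_zero j hj]; simp
    have h : ∀ l : Comb, (∀ p ∈ l, p ∈ sc i j) → (t 0 ^ wt 0 i * t 1 ^ wt 1 i * t 2 ^ wt 2 i *
        t 3 ^ wt 3 i * (t 0 ^ wt 0 j * t 1 ^ wt 1 j * t 2 ^ wt 2 j * t 3 ^ wt 3 j)) • ev b l =
        ev (fun i => (t 0 ^ wt 0 i * t 1 ^ wt 1 i * t 2 ^ wt 2 i * t 3 ^ wt 3 i) • b i) l := by
      intro l
      induction l with
      | nil => simp
      | cons p l ih =>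
        intro hl
        obtain ⟨-, h₀, h₁, h₂, h₃⟩ := wt_add i hi j hj p (hl p (by simp))
        rw [ev_cons, ev_cons, smul_add, ih fun q hq => hl q (by simp [hq]), h₀, h₁, h₂, h₃,
          zpow_add₀ (ht 0), zpow_add₀ (ht 1), zpow_add₀ (ht 2), zpow_add₀ (ht 3), smul_comm]
        congr 3
        ring
    exact h _ fun _ h => h
  eq_zero i hi := by rw [hb.eq_zero i hi, smul_zero]
  linearIndependent := by
    refine hb.linearIndependent.units_smul fun i : Fin 52 => Units.mk0 _ (mul_ne_zero (mul_ne_zero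
      (mul_ne_zero (zpow_ne_zero (wt 0 i) (ht 0)) (zpow_ne_zero (wt 1 i) (ht 1)))
      (zpow_ne_zero (wt 2 i) (ht 2))) (zpow_ne_zero (wt 3 i) (ht 3)))
  span_eq_top := by
    rw [eq_top_iff, ← hb.span_eq_top, Submodule.span_le]
    rintro _ ⟨i, rfl⟩
    have h : t 0 ^ wt 0 i * t 1 ^ wt 1 i * t 2 ^ wt 2 i * t 3 ^ wt 3 i ≠ 0 := mul_ne_zero
      (mul_ne_zero (mul_ne_zero (zpow_ne_zero _ (ht 0)) (zpow_ne_zero _ (ht 1)))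
      (zpow_ne_zero _ (ht 2))) (zpow_ne_zero _ (ht 3))
    exact (Submodule.smul_mem_iff _ h).1 (Submodule.subset_span ⟨i, rfl⟩)

theorem exists_scale (hb : IsF4Basis b) {t₀ t₁ t₂ t₃ : ℂ} (h₀ : t₀ ≠ 0) (h₁ : t₁ ≠ 0) (h₂ : t₂ ≠ 0)
    (h₃ : t₃ ≠ 0) : ∃ b' : ℕ → L, IsF4Basis b' ∧
      ∀ i, b' i = (t₀ ^ wt 0 i * t₁ ^ wt 1 i * t₂ ^ wt 2 i * t₃ ^ wt 3 i) • b i := by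
  refine ⟨_, hb.scale (t := fun c => match c with | 0 => t₀ | 1 => t₁ | 2 => t₂ | _ => t₃) ?_,
    fun i => rfl⟩
  rintro (_ | _ | _ | _) <;> assumption

theorem exists_eq_add_B₂ (hb : IsF4Basis b) {p q r : ℂ} (hp : p ≠ 0) (hq : q ≠ 0) (hr : r ≠ 0) :
    ∃ b' : ℕ → L, IsF4Basis b' ∧ p • b 7 + q • b 17 + r • b 19 = b' 7 + b' 17 + b' 19 := by
  obtain ⟨u, hu⟩ := IsAlgClosed.exists_pow_nat_eq (r / p) (n := 2) (by norm_num)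
  have hu0 : u ≠ 0 := by
    rintro rfl
    exact div_ne_zero hr hp (by rw [← hu]; norm_num)
  obtain ⟨v, hv⟩ := IsAlgClosed.exists_pow_nat_eq (q / u) (n := 2) (by norm_num)
  have hv0 : v ≠ 0 := by
    rintro rfl
    exact div_ne_zero hq hu0 (by rw [← hv]; norm_num)
  obtain ⟨b', hb', h⟩ := hb.exists_scale hv0 one_ne_zero hu0 hp
  refine ⟨b', hb', ?_⟩
  have e₇ : b' 7 = p • b 7 := by
    rw [h, show wt 0 7 = 0 by decide, show wt 1 7 = 0 by decide, show wt 2 7 = 0 by decide, show wt 3 7 = 1 by decide]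
    norm_num
  have e₁₇ : b' 17 = q • b 17 := by
    rw [h, show wt 0 17 = 2 by decide, show wt 1 17 = 2 by decide, show wt 2 17 = 1 by decide, show wt 3 17 = 0 by decide]
    congr 1
    norm_cast
    rw [hv]
    field_simp
    norm_num
  have e₁₉ : b' 19 = r • b 19 := by
    rw [h, show wt 0 19 = 0 by decide, show wt 1 19 = 2 by decide, show wt 2 19 = 2 by decide, show wt 3 19 = 1 by decide]
    congr 1
    norm_cast
    rw [hu]
    field_simp
    norm_num
  rw [e₇, e₁₇, e₁₉]

theorem exists_eq_add_A₂A₁ (hb : IsF4Basis b) {p q r : ℂ} (hp : p ≠ 0) (hq : q ≠ 0)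
    (hr : r ≠ 0) :
    ∃ b' : ℕ → L, IsF4Basis b' ∧ p • b 14 + q • b 15 + r • b 19 = b' 14 + b' 15 + b' 19 := by
  obtain ⟨b', hb', h⟩ := hb.exists_scale one_ne_zero (div_ne_zero (mul_ne_zero hp hq) hr)
    (div_ne_zero (pow_ne_zero 2 hr) (mul_ne_zero hp (pow_ne_zero 2 hq)))
    (div_ne_zero (pow_ne_zero 2 hq) hr)
  refine ⟨b', hb', ?_⟩
  have e₁₄ : b' 14 = p • b 14 := by
    rw [h, show wt 0 14 = 1 by decide, show wt 1 14 = 2 by decide, show wt 2 14 = 1 by decide, show wt 3 14 = 0 by decide]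
    congr 1
    norm_cast
    field_simp
    norm_num
  have e₁₅ : b' 15 = q • b 15 := by
    rw [h, show wt 0 15 = 1 by decide, show wt 1 15 = 1 by decide, show wt 2 15 = 1 by decide, show wt 3 15 = 1 by decide]
    congr 1
    norm_cast
    field_simp
    norm_num
  have e₁₉ : b' 19 = r • b 19 := by
    rw [h, show wt 0 19 = 0 by decide, show wt 1 19 = 2 by decide, show wt 2 19 = 2 by decide, show wt 3 19 = 1 by decide]
    congr 1
    norm_cast
    field_simp
    norm_num
  rw [e₁₄, e₁₅, e₁₉]

end IsF4Basis

/-- Normal forms of the nilpotent elements with centralizer of dimension `16`. -/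
theorem Adapted.exists_eq_add (h : Adapted b s e a)
    (hdim : Module.finrank ℂ (LinearMap.ker (ad ℂ L e)) = 16) :
    ∃ b' : ℕ → L, IsF4Basis b' ∧ (e = b' 7 + b' 17 + b' 19 ∨ e = b' 14 + b' 15 + b' 19) := by
  have he := h.mem_two
  rcases h.eq_or_eq hdim with hl | hl
  · have hdg : ∀ i, dg a i = wt 0 i + 2 * wt 3 i := by simp [dg, hl]
    have hi : (idx a fun m => m == 2) = [7, 10, 13, 16, 17, 19] := by
      simp only [idx, hdg]
      decide
    rw [hi] at he
    obtain ⟨x₁, y₁, he, h₁⟩ := mem_spanOf_cons he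
    obtain ⟨x₂, y₂, he, h₂⟩ := mem_spanOf_cons he
    obtain ⟨x₃, y₃, he, h₃⟩ := mem_spanOf_cons he
    obtain ⟨x₄, y₄, he, h₄⟩ := mem_spanOf_cons he
    obtain ⟨x₅, y₅, he, h₅⟩ := mem_spanOf_cons he
    obtain ⟨x₆, y₆, he, h₆⟩ := mem_spanOf_cons he
    obtain h₇ := mem_spanOf_nil he
    obtain ⟨b', p, q, r, hp, hq, hr, hb', h'⟩ := FormB₂.exists_sum
      ⟨h, hl, by rw [h₁, h₂, h₃, h₄, h₅, h₆, h₇]; module⟩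
    obtain ⟨b'', hb'', h''⟩ := hb'.exists_eq_add_B₂ hp hq hr
    exact ⟨b'', hb'', Or.inl (h'.trans h'')⟩
  · have hdg : ∀ i, dg a i = wt 0 i + wt 2 i := by simp [dg, hl]
    have hi : (idx a fun m => m == 2) = [11, 14, 15, 18, 19] := by
      simp only [idx, hdg]
      decide
    rw [hi] at he
    obtain ⟨x₁, y₁, he, h₁⟩ := mem_spanOf_cons he
    obtain ⟨x₂, y₂, he, h₂⟩ := mem_spanOf_cons he
    obtain ⟨x₃, y₃, he, h₃⟩ := mem_spanOf_cons he
    obtain ⟨x₄, y₄, he, h₄⟩ := mem_spanOf_cons he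
    obtain ⟨x₅, y₅, he, h₅⟩ := mem_spanOf_cons he
    obtain h₆ := mem_spanOf_nil he
    obtain ⟨b', p, q, r, hp, hq, hr, hb', h'⟩ := FormA₂A₁.exists_sum
      ⟨h, hl, by rw [h₁, h₂, h₃, h₄, h₅, h₆]; module⟩
    obtain ⟨b'', hb'', h''⟩ := hb'.exists_eq_add_A₂A₁ hp hq hr
    exact ⟨b'', hb'', Or.inr (h'.trans h'')⟩

/-- Normal forms of the nilpotent elements with centralizer of dimension `16`. -/
theorem IsF4Basis.exists_eq_add (hb : IsF4Basis b) (hnil : IsNilpotent (ad ℂ L e))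
    (hdim : Module.finrank ℂ (LinearMap.ker (ad ℂ L e)) = 16) :
    ∃ b' : ℕ → L, IsF4Basis b' ∧ (e = b' 7 + b' 17 + b' 19 ∨ e = b' 14 + b' 15 + b' 19) := by
  have := hb.finiteDimensional
  have := hb.isKilling
  obtain ⟨s, hse, hs, hinj, hsurj⟩ := exists_grading hnil
  obtain ⟨b', hb', a, ha, hsb⟩ := hb.exists_dominant hs
  exact Adapted.exists_eq_add ⟨hb', ha, hsb, hse, hinj, hsurj⟩ hdim

end F4

namespace F4

open LieAlgebra

variable {L : Type*} [LieRing L] [LieAlgebra ℂ L] {b : ℕ → L}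

/-- A certificate that the elements listed in `T` span the derived algebra of the centralizer of
`E`. An entry `(v, k, n, i, j)` consists of a formal combination `v`, a coordinate `k` in which
only `v` is nonzero, and entry numbers `i` and `j` whose bracket is `n` times `v`. No bracket
involves the coordinate `p`, but `E` does. -/
structure CentralizerCert (E : Comb) (p : ℕ) (T : List (Comb × ℕ × ℤ × ℕ × ℕ)) : Prop where
  lt : p < 52
  coeff_ne : Comb.coeff E p ≠ 0
  comm : ∀ t ∈ T, Comb.isZero (Comb.lie sc E t.1) = true
  coord_lt : ∀ t ∈ T, t.2.1 < 52
  coord : ∀ i < T.length, ∀ j < T.length,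
    (Comb.coeff (T.getD i default).1 (T.getD j default).2.1 = 0 ↔ i ≠ j)
  bracket : ∀ t ∈ T, ∀ t' ∈ T, Comb.coeff (Comb.lie sc t.1 t'.1) p = 0
  gen : ∀ t ∈ T, t.2.2.1 ≠ 0 ∧ t.2.2.2.1 < T.length ∧ t.2.2.2.2 < T.length ∧
    Comb.eqv (Comb.smul t.2.2.1 t.1)
      (Comb.lie sc (T.getD t.2.2.2.1 default).1 (T.getD t.2.2.2.2 default).1) = true

namespace CentralizerCert

variable {E : Comb} {p : ℕ} {T : List (Comb × ℕ × ℤ × ℕ × ℕ)}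

theorem linearIndependent (h : CentralizerCert E p T) (hb : IsF4Basis b) :
    LinearIndependent ℂ fun i : Fin T.length => ev b (T.getD i default).1 := by
  rw [Fintype.linearIndependent_iff]
  intro g hg j
  have hk := h.coord_lt _ (by
    rw [List.getD_eq_getElem _ _ j.2]
    exact List.getElem_mem j.2 : T.getD j default ∈ T)
  have h₁ := congrArg (fun x => hb.toBasis.repr x ⟨_, hk⟩) hg
  simp only [map_sum, map_smul, Finsupp.finsetSum_apply, Finsupp.smul_apply, hb.repr_ev, map_zero,
    Finsupp.zero_apply, smul_eq_mul] at h₁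
  rw [Finset.sum_eq_single j] at h₁
  · refine (mul_eq_zero.1 h₁).resolve_right ?_
    rw [Int.cast_eq_zero]
    exact fun h0 => (h.coord j j.2 j j.2).1 h0 rfl
  · intro i _ hij
    rw [(h.coord i i.2 j j.2).2 fun h => hij (Fin.ext h), Int.cast_zero, mul_zero]
  · simp

theorem derived_eq (h : CentralizerCert E p T) (hb : IsF4Basis b)
    (hdim : Module.finrank ℂ (LinearMap.ker (ad ℂ L (ev b E))) = T.length + 1) :
    let D := Submodule.span ℂ {z : L | ∃ x ∈ LinearMap.ker (ad ℂ L (ev b E)),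
      ∃ y ∈ LinearMap.ker (ad ℂ L (ev b E)), ⁅x, y⁆ = z}
    Module.finrank ℂ D = T.length ∧ ev b E ∉ D ∧
      LinearMap.ker (ad ℂ L (ev b E)) = D ⊔ Submodule.span ℂ {ev b E} := by
  have := hb.finiteDimensional
  intro D
  set e := ev b E with he
  set K := LinearMap.ker (ad ℂ L e) with hK
  have mem_K : ∀ x, x ∈ K ↔ ⁅e, x⁆ = 0 := fun x => Iff.rfl
  have e_mem : e ∈ K := (mem_K e).2 (lie_self e)
  set W := Submodule.span ℂ (Set.range fun i : Fin T.length => ev b (T.getD i default).1) with hW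
  have getD_mem : ∀ i < T.length, T.getD i default ∈ T := fun i hi => by
    rw [List.getD_eq_getElem _ _ hi]
    exact List.getElem_mem hi
  have mem_W : ∀ t ∈ T, ev b t.1 ∈ W := by
    intro t ht
    obtain ⟨i, hi, rfl⟩ := List.getElem_of_mem ht
    refine Submodule.subset_span ⟨⟨i, hi⟩, ?_⟩
    dsimp only
    rw [List.getD_eq_getElem _ _ hi]
  have hWK : W ≤ K := by
    rw [hW, Submodule.span_le]
    rintro _ ⟨i, rfl⟩
    change _ ∈ K
    rw [mem_K, he, ev_lie hb.lie]
    exact ev_eq_zero_of_isZero _ (h.comm _ (getD_mem i i.2))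
  have hDK : D ≤ K := by
    refine Submodule.span_le.2 ?_
    rintro _ ⟨x, hx, y, hy, rfl⟩
    change _ ∈ K
    rw [mem_K] at hx hy ⊢
    rw [leibniz_lie, hx, hy, zero_lie, lie_zero, add_zero]
  have hWD : W ≤ D := by
    rw [hW, Submodule.span_le]
    rintro _ ⟨i, rfl⟩
    obtain ⟨hn, hj, hk, heq⟩ := h.gen _ (getD_mem i i.2)
    have h₁ := ev_eq_of_eqv b heq
    rw [ev_smul, ← ev_lie hb.lie, ← Int.cast_smul_eq_zsmul ℂ] at h₁
    refine (Submodule.smul_mem_iff D (Int.cast_ne_zero.2 hn : ((_ : ℤ) : ℂ) ≠ 0)).1 ?_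
    rw [h₁]
    exact Submodule.subset_span
      ⟨_, hWK (mem_W _ (getD_mem _ hj)), _, hWK (mem_W _ (getD_mem _ hk)), rfl⟩
  have hWrank : Module.finrank ℂ W = T.length := by
    rw [hW, finrank_span_eq_card (h.linearIndependent hb), Fintype.card_fin]
  let F := LinearMap.ker (hb.toBasis.coord ⟨p, h.lt⟩)
  have he_not : e ∉ F := by
    intro h0
    rw [LinearMap.mem_ker, Module.Basis.coord_apply, hb.repr_ev, Int.cast_eq_zero] at h0
    exact h.coeff_ne h0
  have hWW : ∀ x ∈ W, ∀ y ∈ W, ⁅x, y⁆ ∈ F := by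
    intro x hx y hy
    refine lie_mem_of_span hW ?_ hy
    rintro _ ⟨j, rfl⟩
    refine lie_mem_of_span_left hW ?_ hx
    rintro _ ⟨i, rfl⟩
    rw [ev_lie hb.lie, LinearMap.mem_ker, Module.Basis.coord_apply, hb.repr_ev, Int.cast_eq_zero]
    exact h.bracket _ (getD_mem i i.2) _ (getD_mem j j.2)
  have hWF : W ≤ F := by
    rw [hW, Submodule.span_le]
    rintro _ ⟨i, rfl⟩
    obtain ⟨hn, hj, hk, heq⟩ := h.gen _ (getD_mem i i.2)
    have h₁ := ev_eq_of_eqv b heq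
    rw [ev_smul, ← ev_lie hb.lie, ← Int.cast_smul_eq_zsmul ℂ] at h₁
    refine (Submodule.smul_mem_iff F (Int.cast_ne_zero.2 hn : ((_ : ℤ) : ℂ) ≠ 0)).1 ?_
    rw [h₁]
    exact hWW _ (mem_W _ (getD_mem _ hj)) _ (mem_W _ (getD_mem _ hk))
  have sup_eq : ∀ U : Submodule ℂ L, U ≤ K → T.length ≤ Module.finrank ℂ U → e ∉ U →
      K = U ⊔ Submodule.span ℂ {e} := by
    intro U hU hr heU
    have hle : U ⊔ Submodule.span ℂ {e} ≤ K :=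
      sup_le hU (Submodule.span_le.2 (Set.singleton_subset_iff.2 e_mem))
    have hlt : U < U ⊔ Submodule.span ℂ {e} := by
      refine lt_of_le_of_ne le_sup_left fun h0 => heU ?_
      rw [h0]
      exact Submodule.mem_sup_right (Submodule.mem_span_singleton_self e)
    have := Submodule.finrank_lt_finrank_of_lt hlt
    exact (Submodule.eq_of_le_of_finrank_le hle (by omega)).symm
  have hKW := sup_eq W hWK hWrank.ge fun h0 => he_not (hWF h0)
  have hDF : D ≤ F := by
    refine Submodule.span_le.2 ?_
    rintro _ ⟨x, hx, y, hy, rfl⟩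
    have hx' : x ∈ K := hx
    have hy' : y ∈ K := hy
    rw [hKW, Submodule.mem_sup] at hx' hy'
    obtain ⟨w, hw, u, hu, rfl⟩ := hx'
    obtain ⟨w', hw', u', hu', rfl⟩ := hy'
    obtain ⟨c, rfl⟩ := Submodule.mem_span_singleton.1 hu
    obtain ⟨c', rfl⟩ := Submodule.mem_span_singleton.1 hu'
    have h₁ : ⁅w, e⁆ = 0 := by rw [← lie_skew, (mem_K w).1 (hWK hw), neg_zero]
    have h₂ : ⁅w + c • e, w' + c' • e⁆ = ⁅w, w'⁆ := by
      rw [add_lie, lie_add, smul_lie, (mem_K _).1 hy, lie_smul, h₁]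
      simp
    rw [h₂]
    exact hWW w hw w' hw'
  have heD : e ∉ D := fun h0 => he_not (hDF h0)
  refine ⟨le_antisymm ?_ (hWrank ▸ Submodule.finrank_mono hWD), heD,
    sup_eq D hDK (hWrank ▸ Submodule.finrank_mono hWD) heD⟩
  have := Submodule.finrank_lt_finrank_of_lt (lt_of_le_of_ne hDK fun h0 => heD (h0 ▸ e_mem))
  omega

end CentralizerCert

/-- Generators of the derived algebra of the centralizer for the orbit `B₂`. -/
def tableB₂ : List (Comb × ℕ × ℤ × ℕ × ℕ) := [
  ([(1, 1)], 1, 1, 1, 11),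
  ([(5, 1)], 5, 2, 0, 1),
  ([(15, 1)], 15, -1, 0, 2),
  ([(18, 1)], 18, 1, 0, 3),
  ([(21, 1)], 21, -1, 0, 4),
  ([(22, 1)], 22, -2, 0, 5),
  ([(23, 1)], 23, 1, 0, 6),
  ([(24, 1)], 24, 1, 1, 5),
  ([(25, 1)], 25, 2, 0, 8),
  ([(20, 1), (26, 1)], 20, -1, 5, 12),
  ([(27, 1)], 27, -2, 2, 6),
  ([(29, 1)], 29, -2, 0, 11),
  ([(12, 1), (30, 1)], 12, 2, 0, 12),
  ([(9, 1), (33, 1)], 9, 1, 1, 14),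
  ([(6, 1), (36, 1)], 6, -2, 0, 14)]

theorem centralizerCertB₂ : CentralizerCert [(7, 1), (17, 1), (19, 1)] 7 tableB₂ where
  lt := by decide
  coeff_ne := by decide
  comm := by decide +kernel
  coord_lt := by decide +kernel
  coord := by decide +kernel
  bracket := by decide +kernel
  gen := by decide +kernel

/-- Generators of the derived algebra of the centralizer for the orbit `Ã₂ + A₁`. -/
def tableA₂A₁ : List (Comb × ℕ × ℤ × ℕ × ℕ) := [
  ([(1, 1), (3, 1)], 1, 1, 2, 13),
  ([(6, 1)], 6, -3, 0, 1),
  ([(5, 1), (7, 1)], 5, 2, 0, 2),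
  ([(9, -1), (10, 1)], 9, -1, 0, 3),
  ([(12, -1), (13, 1)], 12, 1, 0, 4),
  ([(16, 1)], 16, 3, 0, 5),
  ([(17, -2), (21, 1)], 17, -1, 0, 6),
  ([(22, 1)], 22, -2, 0, 7),
  ([(20, -2), (23, 1)], 20, 1, 0, 8),
  ([(24, 1)], 24, 1, 2, 7),
  ([(25, 1)], 25, 2, 0, 10),
  ([(26, 1)], 26, -1, 0, 11),
  ([(27, 1)], 27, 1, 0, 12),
  ([(29, 1), (31, 1)], 29, -2, 0, 13),
  ([(19, 1)], 19, 1, 1, 5)]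

theorem centralizerCertA₂A₁ : CentralizerCert [(14, 1), (15, 1), (19, 1)] 14 tableA₂A₁ where
  lt := by decide
  coeff_ne := by decide
  comm := by decide +kernel
  coord_lt := by decide +kernel
  coord := by decide +kernel
  bracket := by decide +kernel
  gen := by decide +kernel

theorem dim16 {L : Type*} [LieRing L] [LieAlgebra ℂ L] {b : ℕ → L} (hb : IsF4Basis b) {e : L}
    (hnil : IsNilpotent (ad ℂ L e)) (hdim : Module.finrank ℂ (LinearMap.ker (ad ℂ L e)) = 16) :
    let D := Submodule.span ℂ {z : L | ∃ x ∈ LinearMap.ker (ad ℂ L e),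
      ∃ y ∈ LinearMap.ker (ad ℂ L e), ⁅x, y⁆ = z}
    Module.finrank ℂ D = 15 ∧ e ∉ D ∧
      LinearMap.ker (ad ℂ L e) = D ⊔ Submodule.span ℂ {e} := by
  obtain ⟨b', hb', he | he⟩ := hb.exists_eq_add hnil hdim
  · have h : e = ev b' [(7, 1), (17, 1), (19, 1)] := by simp [he, add_assoc]
    subst h
    exact centralizerCertB₂.derived_eq hb' hdim
  · have h : e = ev b' [(14, 1), (15, 1), (19, 1)] := by simp [he, add_assoc]
    subst h
    exact centralizerCertA₂A₁.derived_eq hb' hdim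

end F4

/-- The centralizer `g_e` of `e`, i.e. the kernel of `ad e`. -/
noncomputable def centralizer (e : LieAlgebra.f₄ ℂ) : Submodule ℂ (LieAlgebra.f₄ ℂ) :=
  LinearMap.ker (LieAlgebra.ad ℂ (LieAlgebra.f₄ ℂ) e)

/-- The derived subalgebra `[g_e, g_e]` of the centralizer, as the linear span of all
brackets of pairs of elements of `g_e`. -/
noncomputable def derived (e : LieAlgebra.f₄ ℂ) : Submodule ℂ (LieAlgebra.f₄ ℂ) :=
  Submodule.span ℂ
    {z : LieAlgebra.f₄ ℂ | ∃ x ∈ centralizer e, ∃ y ∈ centralizer e, ⁅x, y⁆ = z}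

/-- In type F₄, for nilpotent `e` with `dim g_e = 16` one has `dim [g_e,g_e] = 15`,
`e ∉ [g_e,g_e]` and `g_e = [g_e,g_e] + ℂ·e`. -/
theorem dim16_F4 (e : LieAlgebra.f₄ ℂ)
    (hnil : IsNilpotent (LieAlgebra.ad ℂ (LieAlgebra.f₄ ℂ) e))
    (hdim : Module.finrank ℂ ↥(centralizer e) = 16) :
    Module.finrank ℂ ↥(derived e) = 15 ∧ e ∉ derived e ∧
      centralizer e = derived e ⊔ Submodule.span ℂ {e} := by
  exact F4.dim16 F4.isF4Basis_basis hnil hdim
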